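/- arXiv:2201.06067 — 6 statements merged into one kernel-verified Lean document; each statement's English description precedes it below -/
import Mathlib

section
/- Let 𝒻 ⊆ 𝕄 be an intersecting family, i.e. for all f, g ∈ 𝒻 there exists x ∈ ℙ¹ with f(x) = g(x). If |𝒻| ≥ (1/√2)·q² + 2√2·q + 8 (as real numbers), then there exist points P, Q ∈ ℙ¹ such that f(P) = Q for every f ∈ 𝒻 (equivalently, 𝒻 lies in a coset of the stabiliser of a point of ℙ¹ in PGL(2,q)). -/
noncomputable section

/-- The map `ℙ¹ → ℙ¹` induced by an invertible 2×2 matrix `M` over `F`,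
sending the class of `v` to the class of `M v`. -/
def indMap {F : Type} [Field F] (M : GL (Fin 2) F) :
    Projectivization F (Fin 2 → F) → Projectivization F (Fin 2 → F) :=
  Projectivization.map
    ((Matrix.GeneralLinearGroup.toLin M).toLinearEquiv : (Fin 2 → F) →ₗ[F] (Fin 2 → F))
    (Matrix.GeneralLinearGroup.toLin M).toLinearEquiv.injective

/-- The set `𝕄` of all maps `ℙ¹ → ℙ¹` induced by invertible 2×2 matrices over `F`,
i.e. the elements of `PGL(2,q)` acting on the projective line. -/
def pglMaps (F : Type) [Field F] :
    Set (Projectivization F (Fin 2 → F) → Projectivization F (Fin 2 → F)) :=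
  Set.range indMap


/-- A finite set of injective self-maps of a set with `q + 1` elements which is sharply
transitive on triples of distinct elements. -/
structure IsSharp {X : Type*} [Fintype X] [DecidableEq X] (G : Finset (X → X)) (q : ℕ) :
    Prop where
  card_eq : Fintype.card X = q + 1
  two_le : 2 ≤ q
  inj : ∀ f ∈ G, Function.Injective f
  exists_map : ∀ a b c a' b' c' : X, a ≠ b → a ≠ c → b ≠ c → a' ≠ b' → a' ≠ c' → b' ≠ c' →
    ∃ f ∈ G, f a = a' ∧ f b = b' ∧ f c = c'
  unique : ∀ f ∈ G, ∀ g ∈ G, ∀ a b c : X, a ≠ b → a ≠ c → b ≠ c →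
    f a = g a → f b = g b → f c = g c → f = g

/-- The set of points where two maps agree. -/
def agree {X : Type*} [Fintype X] [DecidableEq X] (f g : X → X) : Finset X :=
  Finset.univ.filter fun x => f x = g x

/-- Indicator of tangency: agreement at exactly one point. -/
def tangency {X : Type*} [Fintype X] [DecidableEq X] (f g : X → X) : ℤ :=
  if (agree f g).card = 1 then 1 else 0

/-- The maps in `G` that are equal to `f` or agree with `f` exactly at `a`. -/
def pencil {X : Type*} [Fintype X] [DecidableEq X] (G : Finset (X → X)) (f : X → X) (a : X) :
    Finset (X → X) :=
  G.filter fun h => h = f ∨ agree f h = {a}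

section Agree

variable {X : Type*} [Fintype X] [DecidableEq X]

lemma mem_agree {f g : X → X} {x : X} : x ∈ agree f g ↔ f x = g x := by
  simp [agree]

lemma agree_comm (f g : X → X) : agree f g = agree g f := by
  ext x; simp [mem_agree, eq_comm]

lemma tangency_comm (f g : X → X) : tangency f g = tangency g f := by
  simp [tangency, agree_comm f g]

lemma card_agree_eq_sum (f g : X → X) :
    ((agree f g).card : ℤ) = ∑ x, if f x = g x then 1 else 0 := by
  simp [agree]

lemma mem_pencil {G : Finset (X → X)} {f h : X → X} {a : X} :
    h ∈ pencil G f a ↔ h ∈ G ∧ (h = f ∨ agree f h = {a}) := by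
  simp [pencil]

lemma apply_of_mem_pencil {G : Finset (X → X)} {f h : X → X} {a : X} (hh : h ∈ pencil G f a) :
    h a = f a := by
  rcases (mem_pencil.1 hh).2 with rfl | h1
  · rfl
  · exact (mem_agree.1 (h1 ▸ Finset.mem_singleton_self a)).symm

lemma agree_eq_singleton_iff {f g : X → X} {a : X} : agree f g = {a} ↔ ∀ x, f x = g x ↔ x = a := by
  simp [Finset.ext_iff, mem_agree]

lemma exists_of_tangency {f g : X → X} (h : tangency f g = 1) : ∃ a, ∀ x, f x = g x ↔ x = a := by
  rw [tangency] at h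
  split_ifs at h with h1
  · obtain ⟨a, ha⟩ := Finset.card_eq_one.1 h1
    exact ⟨a, agree_eq_singleton_iff.1 ha⟩
  · exact absurd h zero_ne_one

end Agree

namespace IsSharp

variable {X : Type*} [Fintype X] [DecidableEq X] {G : Finset (X → X)} {q : ℕ}

lemma card_agree_le (hG : IsSharp G q) {f g : X → X} (hf : f ∈ G) (hg : g ∈ G) (hfg : f ≠ g) :
    (agree f g).card ≤ 2 := by
  by_contra! h
  obtain ⟨a, b, c, ha, hb, hc, hab, hac, hbc⟩ := Finset.two_lt_card_iff.1 h
  exact hfg (hG.unique f hf g hg a b c hab hac hbc (mem_agree.1 ha) (mem_agree.1 hb)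
    (mem_agree.1 hc))

lemma card_agree_self (hG : IsSharp G q) (f : X → X) : (agree f f).card = q + 1 := by
  simp [agree, hG.card_eq]

lemma tangency_self (hG : IsSharp G q) (f : X → X) : tangency f f = 0 := by
  have := hG.two_le
  rw [tangency, hG.card_agree_self, if_neg (by omega)]

lemma surj (hG : IsSharp G q) {f : X → X} (hf : f ∈ G) : Function.Surjective f :=
  Finite.surjective_of_injective (hG.inj f hf)

lemma card_erase (hG : IsSharp G q) (a : X) : (Finset.univ.erase a).card = q := by
  rw [Finset.card_erase_of_mem (Finset.mem_univ a), Finset.card_univ, hG.card_eq]; rfl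

lemma card_compl_pair (hG : IsSharp G q) {a b : X} (h : a ≠ b) :
    (({a, b} : Finset X)ᶜ).card = q - 1 := by
  rw [Finset.card_compl, hG.card_eq, Finset.card_pair h]; omega

lemma card_compl_triple (hG : IsSharp G q) {a b c : X} (hab : a ≠ b) (hac : a ≠ c) (hbc : b ≠ c) :
    (({a, b, c} : Finset X)ᶜ).card = q - 2 := by
  rw [Finset.card_compl, hG.card_eq, Finset.card_eq_three.2 ⟨a, b, c, hab, hac, hbc, rfl⟩]; omega

lemma exists_ne_ne (hG : IsSharp G q) (a b : X) : ∃ c, c ≠ a ∧ c ≠ b := by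
  have h2 := hG.two_le
  have : 0 < (({a, b} : Finset X)ᶜ).card := by
    rw [Finset.card_compl, hG.card_eq]
    have := Finset.card_le_two (a := a) (b := b)
    omega
  obtain ⟨c, hc⟩ := Finset.card_pos.1 this
  exact ⟨c, by simpa using hc⟩

lemma card_through_three (hG : IsSharp G q) {a b c a' b' c' : X} (h1 : a ≠ b) (h2 : a ≠ c)
    (h3 : b ≠ c) (h1' : a' ≠ b') (h2' : a' ≠ c') (h3' : b' ≠ c') :
    (G.filter fun g => g a = a' ∧ g b = b' ∧ g c = c').card = 1 := by
  obtain ⟨f, hf, ha, hb, hc⟩ := hG.exists_map a b c a' b' c' h1 h2 h3 h1' h2' h3'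
  refine Finset.card_eq_one.2 ⟨f, ?_⟩
  ext g
  simp only [Finset.mem_filter, Finset.mem_singleton]
  constructor
  · rintro ⟨hg, ga, gb, gc⟩
    exact hG.unique g hg f hf a b c h1 h2 h3 (by rw [ga, ha]) (by rw [gb, hb]) (by rw [gc, hc])
  · rintro rfl
    exact ⟨hf, ha, hb, hc⟩

lemma card_through_two (hG : IsSharp G q) {a b a' b' : X} (h1 : a ≠ b) (h1' : a' ≠ b') :
    (G.filter fun g => g a = a' ∧ g b = b').card = q - 1 := by
  obtain ⟨c, hca, hcb⟩ := hG.exists_ne_ne a b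
  rw [← hG.card_compl_pair h1', Finset.card_eq_sum_card_fiberwise (f := fun g => g c)
    (t := ({a', b'} : Finset X)ᶜ)]
  · rw [Finset.card_eq_sum_ones]
    refine Finset.sum_congr rfl fun y hy => ?_
    have hy' : y ≠ a' ∧ y ≠ b' := by simpa using hy
    rw [Finset.filter_filter, ← hG.card_through_three h1 hca.symm hcb.symm
      h1' hy'.1.symm hy'.2.symm]
    congr 1
    ext g
    simp [and_assoc]
  · intro g hg
    have hg' := Finset.mem_filter.1 hg
    have := hG.inj g hg'.1
    simp only [Finset.coe_compl, Finset.coe_insert, Finset.coe_singleton, Set.mem_compl_iff,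
      Set.mem_insert_iff, Set.mem_singleton_iff, not_or]
    refine ⟨fun h => hca (this (h.trans hg'.2.1.symm)), fun h => hcb (this (h.trans hg'.2.2.symm))⟩

lemma card_through_one (hG : IsSharp G q) (a a' : X) :
    (G.filter fun g => g a = a').card = q * (q - 1) := by
  obtain ⟨c, hca, -⟩ := hG.exists_ne_ne a a
  rw [Finset.card_eq_sum_card_fiberwise (f := fun g => g c) (t := Finset.univ.erase a'),
    Finset.sum_const_nat (m := q - 1), hG.card_erase]
  · intro y hy
    rw [Finset.filter_filter]
    exact hG.card_through_two hca.symm (Finset.ne_of_mem_erase hy).symm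
  · intro g hg
    have hg' := Finset.mem_filter.1 hg
    simp only [Finset.coe_erase, Finset.coe_univ, Set.mem_sdiff, Set.mem_univ, true_and,
      Set.mem_singleton_iff]
    exact fun h => hca (hG.inj g hg'.1 (h.trans hg'.2.symm))

lemma card_eq_mul (hG : IsSharp G q) : G.card = (q + 1) * (q * (q - 1)) := by
  have : 0 < Fintype.card X := by rw [hG.card_eq]; omega
  obtain ⟨a⟩ := Fintype.card_pos_iff.1 this
  rw [Finset.card_eq_sum_card_fiberwise (f := fun g => g a) (t := Finset.univ)
    (fun _ _ => Finset.mem_coe.2 (Finset.mem_univ _)), Finset.sum_const_nat (m := q * (q - 1)),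
    Finset.card_univ, hG.card_eq]
  exact fun y _ => hG.card_through_one a y

/-- A member of `G` agrees with `f` at most at one further point besides `a`. -/
lemma agree_eq_pair (hG : IsSharp G q) {f g : X → X} (hf : f ∈ G) (hg : g ∈ G) (hfg : f ≠ g)
    {a b : X} (hab : a ≠ b) (ha : f a = g a) (hb : f b = g b) : agree f g = {a, b} := by
  symm
  refine Finset.eq_of_subset_of_card_le ?_ ?_
  · intro x hx
    rcases Finset.mem_insert.1 hx with rfl | hx
    · exact mem_agree.2 ha
    · rw [Finset.mem_singleton.1 hx]; exact mem_agree.2 hb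
  · rw [Finset.card_pair hab]; exact hG.card_agree_le hf hg hfg

lemma card_pencil_through (hG : IsSharp G q) {f : X → X} (hf : f ∈ G) {a x y : X} (hx : x ≠ a)
    (hy : y ≠ f a) : ((pencil G f a).filter fun h => h x = y).card = 1 := by
  by_cases hfx : f x = y
  · refine Finset.card_eq_one.2 ⟨f, ?_⟩
    ext h
    simp only [Finset.mem_filter, Finset.mem_singleton, mem_pencil]
    constructor
    · rintro ⟨⟨-, rfl | h1⟩, h2⟩
      · rfl
      · have : x ∈ agree f h := mem_agree.2 (hfx.trans h2.symm)
        rw [h1] at this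
        exact absurd (Finset.mem_singleton.1 this) hx
    · rintro rfl
      exact ⟨⟨hf, Or.inl rfl⟩, hfx⟩
  · obtain ⟨z, hz⟩ := hG.surj hf y
    have hza : a ≠ z := fun h => hy (by rw [h, hz])
    have hzx : x ≠ z := fun h => hfx (by rw [h, hz])
    set S := G.filter fun g => g a = f a ∧ g x = y with hS
    have hScard : S.card = q - 1 := hG.card_through_two hx.symm hy.symm
    have hbad : (S.filter fun g => ¬ agree f g = {a}).card = q - 2 := by
      rw [← hG.card_compl_triple hx.symm hza hzx]
      rw [Finset.card_eq_sum_card_fiberwise (f := fun g => if h : ∃ b, b ≠ a ∧ f b = g b then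
        h.choose else a) (t := ({a, x, z} : Finset X)ᶜ)]
      · rw [Finset.card_eq_sum_ones]
        refine Finset.sum_congr rfl fun b hb => ?_
        have hb' : b ≠ a ∧ b ≠ x ∧ b ≠ z := by simpa using hb
        have hfb : f b ≠ y := fun h => hb'.2.2 (hG.inj f hf (h.trans hz.symm))
        rw [← hG.card_through_three hx.symm hb'.1.symm hb'.2.1.symm hy.symm
          (fun h => hb'.1 (hG.inj f hf h).symm) hfb.symm]
        congr 1
        ext g
        simp only [hS, Finset.mem_filter]
        constructor
        · rintro ⟨⟨⟨hg, ga, gx⟩, hne⟩, h⟩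
          refine ⟨hg, ga, gx, ?_⟩
          split_ifs at h with hex
          · rw [← h]; exact hex.choose_spec.2.symm
          · exact absurd h.symm hb'.1
        · rintro ⟨hg, ga, gx, gb⟩
          have hfg : f ≠ g := fun h => hfx (h ▸ gx)
          have hp := hG.agree_eq_pair hf hg hfg hb'.1.symm ga.symm gb.symm
          refine ⟨⟨⟨hg, ga, gx⟩, ?_⟩, ?_⟩
          · rw [hp]
            intro h
            have : b ∈ ({a, b} : Finset X) := by simp
            rw [h] at this
            exact hb'.1 (Finset.mem_singleton.1 this)
          · have hex : ∃ b, b ≠ a ∧ f b = g b := ⟨b, hb'.1, gb.symm⟩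
            rw [dif_pos hex]
            have hm : hex.choose ∈ agree f g := mem_agree.2 hex.choose_spec.2
            rw [hp] at hm
            rcases Finset.mem_insert.1 hm with h | h
            · exact absurd h hex.choose_spec.1
            · exact Finset.mem_singleton.1 h
      · intro g hg
        simp only [hS, Finset.coe_filter, Finset.mem_filter, Set.mem_ofPred_eq] at hg
        obtain ⟨⟨hg, ga, gx⟩, hne⟩ := hg
        have hex : ∃ b, b ≠ a ∧ f b = g b := by
          by_contra! hno
          apply hne
          ext b
          rw [mem_agree, Finset.mem_singleton]
          exact ⟨fun h => by_contra fun hb => hno b hb h, fun h => by rw [h, ga]⟩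
        simp only [dif_pos hex, Finset.coe_compl, Finset.coe_insert, Finset.coe_singleton,
          Set.mem_compl_iff, Set.mem_insert_iff, Set.mem_singleton_iff, not_or]
        obtain ⟨h1, h2⟩ := hex.choose_spec
        refine ⟨h1, fun h => hfx ?_, fun h => ?_⟩
        · rw [← gx, ← h, h2]
        · have : g hex.choose = g x := by rw [← h2, h, hz, gx]
          exact hzx ((hG.inj g hg this).symm.trans h)
    have hsum := Finset.card_filter_add_card_filter_not (s := S) (fun g => agree f g = {a})
    have heq : (pencil G f a).filter (fun h => h x = y) = S.filter fun g => agree f g = {a} := by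
      ext h
      simp only [hS, Finset.mem_filter, mem_pencil]
      constructor
      · rintro ⟨⟨hh, h1⟩, h2⟩
        rcases h1 with rfl | h1
        · exact absurd h2 hfx
        · exact ⟨⟨hh, (mem_agree.1 (h1 ▸ Finset.mem_singleton_self a)).symm, h2⟩, h1⟩
      · rintro ⟨⟨hh, h1, h2⟩, h3⟩
        exact ⟨⟨hh, Or.inr h3⟩, h2⟩
    have := hG.two_le
    rw [heq]
    omega

lemma mem_pencil_self {f : X → X} (hf : f ∈ G) (a : X) : f ∈ pencil G f a :=
  mem_pencil.2 ⟨hf, Or.inl rfl⟩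

lemma card_pencil (hG : IsSharp G q) {f : X → X} (hf : f ∈ G) (a : X) :
    (pencil G f a).card = q := by
  obtain ⟨c, hca, -⟩ := hG.exists_ne_ne a a
  rw [Finset.card_eq_sum_card_fiberwise (f := fun g => g c) (t := Finset.univ.erase (f a)),
    Finset.sum_const_nat (m := 1), hG.card_erase, mul_one]
  · intro y hy
    exact hG.card_pencil_through hf hca (Finset.ne_of_mem_erase hy)
  · intro g hg
    have hg' := mem_pencil.1 hg
    simp only [Finset.coe_erase, Finset.coe_univ, Set.mem_sdiff, Set.mem_univ, true_and,
      Set.mem_singleton_iff]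
    exact fun h => hca (hG.inj g hg'.1 (h.trans (apply_of_mem_pencil hg).symm))

lemma agree_of_mem_pencil (hG : IsSharp G q) {f g h : X → X} (hf : f ∈ G) {a : X}
    (hg : g ∈ pencil G f a) (hh : h ∈ pencil G f a) (hgh : g ≠ h) : agree g h = {a} := by
  ext x
  rw [mem_agree, Finset.mem_singleton]
  constructor
  · intro hx
    by_contra hxa
    have hy : g x ≠ f a := fun h' =>
      hxa (hG.inj g (mem_pencil.1 hg).1 (h'.trans (apply_of_mem_pencil hg).symm))
    obtain ⟨k, hk⟩ := Finset.card_eq_one.1 (hG.card_pencil_through hf hxa hy)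
    have h1 : g = k := Finset.mem_singleton.1 (hk ▸ Finset.mem_filter.2 ⟨hg, rfl⟩)
    have h2 : h = k := Finset.mem_singleton.1 (hk ▸ Finset.mem_filter.2 ⟨hh, hx.symm⟩)
    exact hgh (h1.trans h2.symm)
  · rintro rfl
    rw [apply_of_mem_pencil hg, apply_of_mem_pencil hh]

lemma agree_self_ne_singleton (hG : IsSharp G q) (f : X → X) (a : X) : agree f f ≠ {a} := by
  intro h
  have h1 := hG.card_agree_self f
  have := hG.two_le
  rw [h, Finset.card_singleton] at h1
  omega

lemma filter_agree_eq (hG : IsSharp G q) (f : X → X) (a : X) :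
    (G.filter fun g => agree f g = {a}) = (pencil G f a).erase f := by
  ext g
  simp only [Finset.mem_filter, Finset.mem_erase, mem_pencil]
  constructor
  · rintro ⟨hg, h⟩
    refine ⟨?_, hg, Or.inr h⟩
    rintro rfl
    exact hG.agree_self_ne_singleton _ a h
  · rintro ⟨h1, hg, h2⟩
    exact ⟨hg, h2.resolve_left h1⟩

lemma tangency_eq_sum (f g : X → X) :
    tangency f g = ∑ a, if agree f g = {a} then 1 else 0 := by
  rw [tangency]
  split_ifs with h
  · obtain ⟨a, ha⟩ := Finset.card_eq_one.1 h
    simp [ha]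
  · symm
    refine Finset.sum_eq_zero fun a _ => if_neg fun ha => h ?_
    rw [ha, Finset.card_singleton]

/-- A sum over the maps tangent to `f` splits according to the point of tangency. -/
lemma sum_tangency_mul (hG : IsSharp G q) (f : X → X) (φ : (X → X) → ℤ) :
    ∑ g ∈ G, tangency f g * φ g = ∑ a, ∑ g ∈ (pencil G f a).erase f, φ g := by
  simp only [tangency_eq_sum, Finset.sum_mul]
  rw [Finset.sum_comm]
  refine Finset.sum_congr rfl fun a _ => ?_
  rw [← hG.filter_agree_eq, Finset.sum_filter]
  exact Finset.sum_congr rfl fun g _ => by split_ifs <;> simp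

lemma sum_pencil_agree (hG : IsSharp G q) {f g : X → X} (hf : f ∈ G) (hg : g ∈ G) {a : X}
    (ha : f a ≠ g a) : ∑ h ∈ pencil G f a, ((agree h g).card : ℤ) = q - 1 := by
  simp only [card_agree_eq_sum]
  rw [Finset.sum_comm]
  obtain ⟨z, hz⟩ := hG.surj hg (f a)
  have haz : a ≠ z := fun h => ha (by rw [h, hz, h])
  have hx : ∀ x, ∑ h ∈ pencil G f a, (if h x = g x then (1 : ℤ) else 0) =
      if x ∈ (({a, z} : Finset X)ᶜ) then 1 else 0 := by
    intro x
    split_ifs with hx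
    · have hx' : x ≠ a ∧ x ≠ z := by simpa using hx
      have := hG.card_pencil_through hf hx'.1
        (y := g x) (fun h => hx'.2 (hG.inj g hg (h.trans hz.symm)))
      simp [this]
    · refine Finset.sum_eq_zero fun h hh => if_neg fun he => ?_
      have hx' : x = a ∨ x = z := by
        by_contra! hcon
        exact hx (by simpa using hcon)
      rcases hx' with rfl | rfl
      · exact ha ((apply_of_mem_pencil hh).symm.trans he)
      · exact haz (hG.inj h (mem_pencil.1 hh).1 ((apply_of_mem_pencil hh).trans
          (hz.symm.trans he.symm)))
  simp only [hx]
  have h2 := hG.two_le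
  rw [← Finset.sum_filter, Finset.filter_mem_eq_inter, Finset.univ_inter, Finset.sum_const,
    hG.card_compl_pair haz]
  rw [nsmul_eq_mul, mul_one]
  omega

lemma sum_pencil_agree' (hG : IsSharp G q) {f g : X → X} (hf : f ∈ G) (hg : g ∈ G) {a : X}
    (ha : f a = g a) : ∑ h ∈ pencil G f a, ((agree h g).card : ℤ) = 2 * q := by
  simp only [card_agree_eq_sum]
  rw [Finset.sum_comm, ← Finset.add_sum_erase _ _ (Finset.mem_univ a)]
  have h1 : ∑ h ∈ pencil G f a, (if h a = g a then (1 : ℤ) else 0) = q := by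
    rw [Finset.sum_congr rfl (g := fun _ => (1 : ℤ))]
    · simp [hG.card_pencil hf a]
    · intro h hh
      rw [if_pos ((apply_of_mem_pencil hh).trans ha)]
  have h2 : ∀ x ∈ Finset.univ.erase a,
      ∑ h ∈ pencil G f a, (if h x = g x then (1 : ℤ) else 0) = 1 := by
    intro x hx
    have hxa := Finset.ne_of_mem_erase hx
    have := hG.card_pencil_through hf hxa
        (y := g x) (fun h => hxa (hG.inj g hg (h.trans ha)))
    simp [this]
  rw [h1, Finset.sum_congr rfl h2, Finset.sum_const, hG.card_erase]
  simp; ring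

lemma tangency_nonneg (f g : X → X) : 0 ≤ tangency f g := by
  rw [tangency]; split_ifs <;> simp

lemma tangency_le_one (f g : X → X) : tangency f g ≤ 1 := by
  rw [tangency]; split_ifs <;> simp

lemma sum_tangency (hG : IsSharp G q) {f : X → X} (hf : f ∈ G) :
    ∑ g ∈ G, tangency f g = (q + 1) * (q - 1) := by
  have h2 := hG.two_le
  have h := hG.sum_tangency_mul f (fun _ => 1)
  simp only [mul_one] at h
  rw [h, Finset.sum_congr rfl (g := fun _ => ((q : ℤ) - 1))]
  · simp [hG.card_eq]
    ring
  · intro a _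
    rw [Finset.sum_const, Finset.card_erase_of_mem (mem_pencil_self hf a), hG.card_pencil hf]
    rw [nsmul_eq_mul, mul_one]
    omega

/-- A bound on the number of maps tangent to two given meeting maps. -/
lemma sum_tangency_mul_tangency_le (hG : IsSharp G q) {r : ℕ} (hr2 : r ≤ 2)
    (hr : ∀ f ∈ G, ∀ g ∈ G, ∀ a, f a ≠ g a → ∑ h ∈ pencil G f a, tangency h g ≤ r)
    {f f' : X → X} (hf : f ∈ G) (hf' : f' ∈ G) (hne : f ≠ f') (hmeet : ∃ x, f x = f' x) :
    ∑ g ∈ G, tangency f g * tangency f' g ≤ r * (q - 1) := by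
  have h2 : (2 : ℤ) ≤ q := by exact_mod_cast hG.two_le
  rw [hG.sum_tangency_mul]
  have hout : ∀ a ∈ (agree f f')ᶜ, ∑ g ∈ (pencil G f a).erase f, tangency f' g ≤
      r - tangency f f' := by
    intro a ha
    have ha' : f a ≠ f' a := fun h => (Finset.mem_compl.1 ha) (mem_agree.2 h)
    have h1 := hr f hf f' hf' a ha'
    rw [← Finset.add_sum_erase _ _ (mem_pencil_self hf a)] at h1
    simp only [tangency_comm f'] 
    linarith
  have hle := hG.card_agree_le hf hf' hne
  have hpos : 0 < (agree f f').card := by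
    obtain ⟨x, hx⟩ := hmeet
    exact Finset.card_pos.2 ⟨x, mem_agree.2 hx⟩
  rw [← Finset.sum_add_sum_compl (agree f f')]
  have hcompl : (((agree f f')ᶜ.card : ℕ) : ℤ) = q + 1 - (agree f f').card := by
    rw [Finset.card_compl, hG.card_eq]
    have := hG.two_le
    push_cast [Nat.cast_sub (by omega : (agree f f').card ≤ q + 1)]
    ring
  have hsum2 := Finset.sum_le_card_nsmul _ _ _ hout
  rw [nsmul_eq_mul, hcompl] at hsum2
  rcases (by omega : (agree f f').card = 1 ∨ (agree f f').card = 2) with hc | hc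
  · obtain ⟨a, ha⟩ := Finset.card_eq_one.1 hc
    have ht : tangency f f' = 1 := by rw [tangency, if_pos hc]
    have hm : f' ∈ (pencil G f a).erase f :=
      Finset.mem_erase.2 ⟨hne.symm, mem_pencil.2 ⟨hf', Or.inr ha⟩⟩
    have hin : ∑ a ∈ agree f f', ∑ g ∈ (pencil G f a).erase f, tangency f' g ≤ q - 2 := by
      rw [ha, Finset.sum_singleton, ← Finset.add_sum_erase _ _ hm, hG.tangency_self, zero_add]
      refine (Finset.sum_le_card_nsmul _ _ 1 fun g _ => tangency_le_one f' g).trans ?_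
      rw [Finset.card_erase_of_mem hm, Finset.card_erase_of_mem (mem_pencil_self hf a),
        hG.card_pencil hf]
      have := hG.two_le
      rw [nsmul_eq_mul, mul_one]
      omega
    rw [hc, ht] at hsum2
    have hr2' : (r : ℤ) ≤ 2 := by exact_mod_cast hr2
    push_cast at hsum2
    nlinarith
  · have ht : tangency f f' = 0 := by rw [tangency, if_neg (by omega)]
    have hin : ∑ a ∈ agree f f', ∑ g ∈ (pencil G f a).erase f, tangency f' g = 0 := by
      refine Finset.sum_eq_zero fun a ha => Finset.sum_eq_zero fun g hg => ?_
      rw [tangency, if_neg]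
      intro h1
      obtain ⟨hgf, hgp⟩ := Finset.mem_erase.1 hg
      have hgG := (mem_pencil.1 hgp).1
      have hga : g a = f a := apply_of_mem_pencil hgp
      have hfa := mem_agree.1 ha
      have h3 : agree g f' = {a} := by
        obtain ⟨c, hcc⟩ := Finset.card_eq_one.1 h1
        have : a ∈ agree f' g := mem_agree.2 (hfa.symm.trans hga.symm)
        rw [hcc] at this
        rw [agree_comm, hcc, Finset.mem_singleton.1 this]
      have h4 : agree g f = {a} := by
        rw [agree_comm]
        exact (mem_pencil.1 hgp).2.resolve_left hgf
      have h5 := hG.agree_of_mem_pencil hgG (mem_pencil.2 ⟨hf, Or.inr h4⟩)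
        (mem_pencil.2 ⟨hf', Or.inr h3⟩) hne
      rw [h5, Finset.card_singleton] at hc
      omega
    rw [hc, ht] at hsum2
    rw [hin]
    push_cast at hsum2
    linarith

/-- The number of agreement points, tangencies counted twice. -/
lemma weight_sq (hG : IsSharp G q) {f g : X → X} (hf : f ∈ G) (hg : g ∈ G) (hfg : f ≠ g) :
    (((agree f g).card : ℤ) + tangency f g) ^ 2 = 2 * ((agree f g).card + tangency f g) := by
  have := hG.card_agree_le hf hg hfg
  rw [tangency]
  interval_cases (agree f g).card <;> simp

lemma weight_of_meet (hG : IsSharp G q) {f g : X → X} (hf : f ∈ G) (hg : g ∈ G) (hfg : f ≠ g)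
    (hmeet : ∃ x, f x = g x) : ((agree f g).card : ℤ) + tangency f g = 2 := by
  have := hG.card_agree_le hf hg hfg
  have hpos : 0 < (agree f g).card := by
    obtain ⟨x, hx⟩ := hmeet
    exact Finset.card_pos.2 ⟨x, mem_agree.2 hx⟩
  rw [tangency]
  interval_cases (agree f g).card <;> simp

section Point

variable {p b : X}

lemma card_avoid_through (hG : IsSharp G q) {x y : X} (hx : x ≠ p) (hy : y ≠ b) :
    (((G.filter fun g => g p ≠ b).filter fun g => g x = y).card : ℤ) = (q - 1) ^ 2 := by
  have h1 := hG.card_through_one x y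
  have h2 := hG.card_through_two hx hy
  have h3 := Finset.card_filter_add_card_filter_not (s := G.filter fun g => g x = y)
    (fun g => g p = b)
  rw [Finset.filter_filter, h1, h2] at h3
  rw [Finset.filter_comm]
  have := hG.two_le
  zify [(by omega : 1 ≤ q)] at h3
  linear_combination h3

lemma card_avoid_through_two (hG : IsSharp G q) {x y x' y' : X} (hx : x ≠ p) (hy : y ≠ b)
    (hx' : x' ≠ p) (hy' : y' ≠ b) (hxx : x ≠ x') (hyy : y ≠ y') :
    (((G.filter fun g => g p ≠ b).filter fun g => g x = y ∧ g x' = y').card : ℤ) = q - 2 := by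
  have h1 := hG.card_through_two hxx hyy
  have h2 := hG.card_through_three hxx hx hx' hyy hy hy'
  have h3 := Finset.card_filter_add_card_filter_not (s := G.filter fun g => g x = y ∧ g x' = y')
    (fun g => g p = b)
  have h4 : ((G.filter fun g => g x = y ∧ g x' = y').filter fun g => g p = b) =
      G.filter fun g => g x = y ∧ g x' = y' ∧ g p = b := by
    ext g; simp [and_assoc]
  rw [h4, h1, h2] at h3
  rw [Finset.filter_comm]
  have := hG.two_le
  zify [(by omega : 1 ≤ q)] at h3
  linear_combination h3

lemma sum_avoid_tangency_mul (hG : IsSharp G q) {f : X → X} (hfp : f p = b)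
    (φ : (X → X) → ℤ) :
    ∑ g ∈ G.filter (fun g => g p ≠ b), tangency f g * φ g =
      ∑ a ∈ Finset.univ.erase p, ∑ g ∈ (pencil G f a).erase f, φ g := by
  have h := hG.sum_tangency_mul f (fun g => if g p ≠ b then φ g else 0)
  rw [Finset.sum_filter]
  rw [Finset.sum_congr rfl (g := fun g => tangency f g * if g p ≠ b then φ g else 0)
    (fun g _ => by split_ifs <;> simp), h, ← Finset.add_sum_erase _ _ (Finset.mem_univ p)]
  rw [Finset.sum_eq_zero, zero_add]
  · refine Finset.sum_congr rfl fun a ha => Finset.sum_congr rfl fun g hg => if_pos fun hgp => ?_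
    obtain ⟨hgf, hgp'⟩ := Finset.mem_erase.1 hg
    have h1 : p ∈ agree f g := mem_agree.2 (hfp.trans hgp.symm)
    rw [(mem_pencil.1 hgp').2.resolve_left hgf] at h1
    exact Finset.ne_of_mem_erase ha (Finset.mem_singleton.1 h1).symm
  · intro g hg
    rw [if_neg]
    rw [not_not, apply_of_mem_pencil (Finset.mem_of_mem_erase hg), hfp]

lemma sum_avoid_agree_mul (hG : IsSharp G q) {f f' : X → X} (hf : f ∈ G) (hf' : f' ∈ G)
    (hfp : f p = b) (hfp' : f' p = b) :
    ∑ g ∈ G.filter (fun g => g p ≠ b), ((agree f g).card : ℤ) * (agree f' g).card =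
      q * (q - 2) ^ 2 + ((agree f f').card - 1) * (q ^ 2 - q - 1) := by
  have h2 := hG.two_le
  have key : ∀ x ∈ Finset.univ.erase p, ∑ g ∈ G.filter (fun g => g p ≠ b),
      (if f x = g x then (1 : ℤ) else 0) * (agree f' g).card =
      (q - 2) ^ 2 + if f x = f' x then (q : ℤ) ^ 2 - q - 1 else 0 := by
    intro x hx
    have hxp := Finset.ne_of_mem_erase hx
    have hfx : f x ≠ b := fun h => hxp (hG.inj f hf (h.trans hfp.symm))
    obtain ⟨z, hz⟩ := hG.surj hf' (f x)
    have hzp : z ≠ p := fun h => hfx (by rw [← hz, h, hfp'])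
    have hstep : ∑ g ∈ G.filter (fun g => g p ≠ b),
        (if f x = g x then (1 : ℤ) else 0) * (agree f' g).card =
        ∑ x', (((G.filter fun g => g p ≠ b).filter fun g =>
          g x = f x ∧ g x' = f' x').card : ℤ) := by
      simp only [card_agree_eq_sum, Finset.mul_sum]
      rw [Finset.sum_comm]
      refine Finset.sum_congr rfl fun x' _ => ?_
      rw [Finset.card_filter]
      push_cast
      refine Finset.sum_congr rfl fun g _ => ?_
      by_cases h1 : f x = g x <;> by_cases h3 : f' x' = g x' <;> simp [h1, h3, eq_comm]
    rw [hstep]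
    have hzero : ∀ x', (x' = p ∨ (x' = x ∧ f x ≠ f' x) ∨ (x' ≠ x ∧ x' = z)) →
        (((G.filter fun g => g p ≠ b).filter fun g => g x = f x ∧ g x' = f' x').card : ℤ) = 0 := by
      intro x' hx'
      rw [Nat.cast_eq_zero, Finset.card_eq_zero, Finset.filter_eq_empty_iff]
      rintro g hg ⟨h3, h4⟩
      obtain ⟨hgG, hgp⟩ := Finset.mem_filter.1 hg
      rcases hx' with rfl | ⟨rfl, h5⟩ | ⟨h5, rfl⟩
      · exact hgp (h4.trans hfp')
      · exact h5 (h3.symm.trans h4)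
      · exact h5 (hG.inj g hgG (h4.trans (hz.trans h3.symm)))
    have hgen : ∀ x', x' ≠ p → x' ≠ x → x' ≠ z →
        (((G.filter fun g => g p ≠ b).filter fun g => g x = f x ∧ g x' = f' x').card : ℤ) =
          q - 2 := by
      intro x' h3 h4 h5
      refine hG.card_avoid_through_two hxp hfx h3 ?_ h4.symm ?_
      · exact fun h => h3 (hG.inj f' hf' (h.trans hfp'.symm))
      · exact fun h => h5 (hG.inj f' hf' (h.symm.trans hz.symm))
    by_cases hxx : f x = f' x
    · have hzx : z = x := hG.inj f' hf' (hz.trans hxx)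
      rw [← Finset.sum_add_sum_compl ({p, x} : Finset X), Finset.sum_pair hxp.symm,
        hzero p (Or.inl rfl), Finset.sum_congr rfl (g := fun _ => (q : ℤ) - 2)]
      · have h5 : ((G.filter fun g => g p ≠ b).filter fun g => g x = f x ∧ g x = f' x) =
            (G.filter fun g => g p ≠ b).filter fun g => g x = f x := by
          ext g; simp [← hxx]
        rw [h5, hG.card_avoid_through hxp hfx, Finset.sum_const, hG.card_compl_pair hxp.symm,
          if_pos hxx]
        push_cast [nsmul_eq_mul, Nat.cast_sub (by omega : 1 ≤ q)]
        ring
      · intro x' hx'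
        have hx'' : x' ≠ p ∧ x' ≠ x := by simpa using hx'
        exact hgen x' hx''.1 hx''.2 (hzx ▸ hx''.2)
    · have hzx : x ≠ z := fun h => hxx (by rw [← hz, h])
      rw [← Finset.sum_add_sum_compl ({p, x, z} : Finset X), Finset.sum_eq_zero,
        Finset.sum_congr rfl (g := fun _ => (q : ℤ) - 2), Finset.sum_const,
        hG.card_compl_triple hxp.symm hzp.symm hzx, if_neg hxx]
      · push_cast [nsmul_eq_mul, Nat.cast_sub h2]
        ring
      · intro x' hx'
        have hx'' : x' ≠ p ∧ x' ≠ x ∧ x' ≠ z := by simpa using hx'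
        exact hgen x' hx''.1 hx''.2.1 hx''.2.2
      · intro x' hx'
        have hx'' : x' = p ∨ x' = x ∨ x' = z := by simpa using hx'
        rcases hx'' with rfl | rfl | rfl
        · exact hzero _ (Or.inl rfl)
        · exact hzero _ (Or.inr (Or.inl ⟨rfl, hxx⟩))
        · exact hzero _ (Or.inr (Or.inr ⟨hzx.symm, rfl⟩))
  have hp0 : ∑ g ∈ G.filter (fun g => g p ≠ b),
      (if f p = g p then (1 : ℤ) else 0) * (agree f' g).card = 0 := by
    refine Finset.sum_eq_zero fun g hg => ?_
    rw [if_neg, zero_mul]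
    rw [hfp]
    exact (Finset.mem_filter.1 hg).2.symm
  have hA : ((agree f f').card : ℤ) =
      1 + ∑ x ∈ Finset.univ.erase p, if f x = f' x then (1 : ℤ) else 0 := by
    rw [card_agree_eq_sum, ← Finset.add_sum_erase _ _ (Finset.mem_univ p),
      if_pos (hfp.trans hfp'.symm)]
  have : ∑ g ∈ G.filter (fun g => g p ≠ b), ((agree f g).card : ℤ) * (agree f' g).card =
      ∑ x, ∑ g ∈ G.filter (fun g => g p ≠ b),
        (if f x = g x then (1 : ℤ) else 0) * (agree f' g).card := by
    rw [Finset.sum_comm]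
    refine Finset.sum_congr rfl fun g _ => ?_
    rw [card_agree_eq_sum f g, Finset.sum_mul]
  rw [this, ← Finset.add_sum_erase _ _ (Finset.mem_univ p), hp0, Finset.sum_congr rfl key,
    Finset.sum_add_distrib, Finset.sum_const, hG.card_erase, hA, nsmul_eq_mul]
  have hc : ∀ x, (if f x = f' x then (q : ℤ) ^ 2 - q - 1 else 0) =
      (if f x = f' x then (1 : ℤ) else 0) * ((q : ℤ) ^ 2 - q - 1) := by
    intro x; split_ifs <;> simp
  simp only [hc]
  rw [← Finset.sum_mul]
  ring

lemma sum_avoid_tangency_mul_agree (hG : IsSharp G q) {f f' : X → X} (hf : f ∈ G) (hf' : f' ∈ G)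
    (hfp : f p = b) (hfp' : f' p = b) :
    ∑ g ∈ G.filter (fun g => g p ≠ b), tangency f' g * ((agree f g).card : ℤ) =
      q * (q - 2) + ((agree f f').card - 1) := by
  rw [hG.sum_avoid_tangency_mul hfp']
  have key : ∀ a ∈ Finset.univ.erase p,
      ∑ g ∈ (pencil G f' a).erase f', ((agree f g).card : ℤ) =
        (q - 1 - (agree f f').card) + (if f a = f' a then 1 else 0) * (q + 1) := by
    intro a _
    have h1 := Finset.add_sum_erase _ (fun g => ((agree g f).card : ℤ)) (mem_pencil_self hf' a)
    simp only [agree_comm f]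
    split_ifs with h
    · rw [hG.sum_pencil_agree' hf' hf h.symm] at h1
      linarith
    · rw [hG.sum_pencil_agree hf' hf (fun h' => h h'.symm)] at h1
      linarith
  have hA : ((agree f f').card : ℤ) =
      1 + ∑ x ∈ Finset.univ.erase p, if f x = f' x then (1 : ℤ) else 0 := by
    rw [card_agree_eq_sum, ← Finset.add_sum_erase _ _ (Finset.mem_univ p),
      if_pos (hfp.trans hfp'.symm)]
  rw [Finset.sum_congr rfl key, Finset.sum_add_distrib, ← Finset.sum_mul, Finset.sum_const,
    hG.card_erase, nsmul_eq_mul, hA]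
  ring

lemma sum_avoid_weight (hG : IsSharp G q) {f : X → X} (hf : f ∈ G) (hfp : f p = b) :
    ∑ g ∈ G.filter (fun g => g p ≠ b), (((agree f g).card : ℤ) + tangency f g) =
      q ^ 2 * (q - 1) := by
  have h2 := hG.two_le
  rw [Finset.sum_add_distrib]
  have h1 := hG.sum_avoid_tangency_mul hfp (fun _ => 1)
  simp only [mul_one] at h1
  rw [h1, Finset.sum_congr rfl (g := fun _ => (q : ℤ) - 1) (s₁ := Finset.univ.erase p)]
  · simp only [card_agree_eq_sum]
    rw [Finset.sum_comm, ← Finset.add_sum_erase _ _ (Finset.mem_univ p), Finset.sum_eq_zero,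
      Finset.sum_congr rfl (g := fun _ => ((q : ℤ) - 1) ^ 2) (s₁ := Finset.univ.erase p)]
    · rw [Finset.sum_const, Finset.sum_const, hG.card_erase]
      simp only [nsmul_eq_mul]
      ring
    · intro x hx
      have hxp := Finset.ne_of_mem_erase hx
      rw [← hG.card_avoid_through (p := p) (b := b) hxp
        (fun h => hxp (hG.inj f hf (h.trans hfp.symm)))]
      simp [eq_comm]
    · intro g hg
      rw [if_neg]
      rw [hfp]
      exact (Finset.mem_filter.1 hg).2.symm
  · intro a _
    rw [Finset.sum_const, Finset.card_erase_of_mem (mem_pencil_self hf a), hG.card_pencil hf]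
    rw [nsmul_eq_mul, mul_one]
    omega

end Point

lemma sum_sq_sum {ι κ : Type*} (S : Finset κ) (A : Finset ι) (w : ι → κ → ℤ) :
    ∑ g ∈ S, (∑ f ∈ A, w f g) ^ 2 = ∑ f ∈ A, ∑ f' ∈ A, ∑ g ∈ S, w f g * w f' g := by
  simp only [sq, Finset.sum_mul_sum]
  rw [Finset.sum_comm]
  exact Finset.sum_congr rfl fun f _ => Finset.sum_comm

lemma card_avoid (hG : IsSharp G q) (p b : X) :
    ((G.filter fun g => g p ≠ b).card : ℤ) = q ^ 2 * (q - 1) := by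
  have h3 := Finset.card_filter_add_card_filter_not (s := G) (fun g => g p = b)
  rw [hG.card_through_one, hG.card_eq_mul] at h3
  have := hG.two_le
  zify [(by omega : 1 ≤ q)] at h3
  linear_combination h3

lemma sum_avoid_weight_mul_weight_le (hG : IsSharp G q)
    (hr : ∀ f ∈ G, ∀ g ∈ G, ∀ a, f a ≠ g a → ∑ h ∈ pencil G f a, tangency h g ≤ 2)
    {p b : X} {f f' : X → X} (hf : f ∈ G) (hf' : f' ∈ G) (hne : f ≠ f')
    (hfp : f p = b) (hfp' : f' p = b) :
    ∑ g ∈ G.filter (fun g => g p ≠ b), (((agree f g).card : ℤ) + tangency f g) *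
      ((agree f' g).card + tangency f' g) ≤ q ^ 2 * (q - 1) + (q - 1) := by
  have h2 : (2 : ℤ) ≤ q := by exact_mod_cast hG.two_le
  have h1 := hG.sum_avoid_agree_mul hf hf' hfp hfp'
  have h3 := hG.sum_avoid_tangency_mul_agree hf hf' hfp hfp'
  have h4 := hG.sum_avoid_tangency_mul_agree hf' hf hfp' hfp
  rw [agree_comm f' f] at h4
  have h5 := hG.sum_tangency_mul_tangency_le le_rfl hr hf hf' hne ⟨p, hfp.trans hfp'.symm⟩
  have h6 : ∑ g ∈ G.filter (fun g => g p ≠ b), tangency f g * tangency f' g ≤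
      ∑ g ∈ G, tangency f g * tangency f' g :=
    Finset.sum_le_sum_of_subset_of_nonneg (Finset.filter_subset _ _)
      fun g _ _ => mul_nonneg (tangency_nonneg _ _) (tangency_nonneg _ _)
  have hle : ((agree f f').card : ℤ) ≤ 2 := by exact_mod_cast hG.card_agree_le hf hf' hne
  have hexp : ∑ g ∈ G.filter (fun g => g p ≠ b), (((agree f g).card : ℤ) + tangency f g) *
      ((agree f' g).card + tangency f' g) =
      ∑ g ∈ G.filter (fun g => g p ≠ b), ((agree f g).card : ℤ) * (agree f' g).card +
      ∑ g ∈ G.filter (fun g => g p ≠ b), tangency f' g * ((agree f g).card : ℤ) +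
      ∑ g ∈ G.filter (fun g => g p ≠ b), tangency f g * ((agree f' g).card : ℤ) +
      ∑ g ∈ G.filter (fun g => g p ≠ b), tangency f g * tangency f' g := by
    simp only [← Finset.sum_add_distrib]
    exact Finset.sum_congr rfl fun g _ => by ring
  rw [hexp, h1, h3, h4]
  push_cast at h5
  nlinarith [mul_nonneg (sub_nonneg.2 hle) (by nlinarith : (0 : ℤ) ≤ (q : ℤ) ^ 2 - q + 1)]

/-- In an intersecting family, the number of maps sending `p` to `b` is either small or nearly
the size of the family. -/
lemma card_mul_card_le (hG : IsSharp G q)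
    (hr : ∀ f ∈ G, ∀ g ∈ G, ∀ a, f a ≠ g a → ∑ h ∈ pencil G f a, tangency h g ≤ 2)
    {s : Finset (X → X)} (hs : s ⊆ G) (hint : ∀ f ∈ s, ∀ g ∈ s, ∃ x, f x = g x) (p b : X) :
    ((s.filter fun f => f p = b).card : ℤ) * (s.card - (s.filter fun f => f p = b).card) ≤
      (q - 1) * (q ^ 2 + (s.filter fun f => f p = b).card) := by
  have h2 : (2 : ℤ) ≤ q := by exact_mod_cast hG.two_le
  have hB := Finset.card_filter_add_card_filter_not (s := s) (fun f => f p = b)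
  set A := s.filter fun f => f p = b with hA
  set B := s.filter fun f => ¬ f p = b with hBdef
  set S := G.filter fun g => g p ≠ b with hS
  set M : ℤ := (A.card : ℤ) with hM
  have hAG : ∀ f ∈ A, f ∈ G ∧ f p = b := fun f hf =>
    ⟨hs (Finset.mem_filter.1 hf).1, (Finset.mem_filter.1 hf).2⟩
  have hBS : B ⊆ S := fun f hf =>
    Finset.mem_filter.2 ⟨hs (Finset.mem_filter.1 hf).1, (Finset.mem_filter.1 hf).2⟩
  let w : (X → X) → (X → X) → ℤ := fun f g => ((agree f g).card : ℤ) + tangency f g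
  have hne : ∀ f ∈ A, ∀ g ∈ S, f ≠ g := by
    rintro f hf g hg rfl
    exact (Finset.mem_filter.1 hg).2 (hAG f hf).2
  have hY1 : ∑ g ∈ S, ∑ f ∈ A, w f g = M * (q ^ 2 * (q - 1)) := by
    rw [Finset.sum_comm, Finset.sum_congr rfl
      (fun f hf => hG.sum_avoid_weight (hAG f hf).1 (hAG f hf).2), Finset.sum_const, nsmul_eq_mul]
  have hY2 : ∑ g ∈ S, (∑ f ∈ A, w f g) ^ 2 ≤
      M * (M * (q ^ 2 * (q - 1) + (q - 1)) + q ^ 2 * (q - 1)) := by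
    rw [sum_sq_sum]
    have hrow : ∀ f ∈ A, ∑ f' ∈ A, ∑ g ∈ S, w f g * w f' g ≤
        M * (q ^ 2 * (q - 1) + (q - 1)) + q ^ 2 * (q - 1) := by
      intro f hf
      have hentry : ∀ f' ∈ A, ∑ g ∈ S, w f g * w f' g ≤
          (q ^ 2 * (q - 1) + (q - 1)) + if f = f' then (q : ℤ) ^ 2 * (q - 1) else 0 := by
        intro f' hf'
        split_ifs with hff
        · subst hff
          have : ∑ g ∈ S, w f g * w f g = 2 * ∑ g ∈ S, w f g := by
            rw [Finset.mul_sum]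
            refine Finset.sum_congr rfl fun g hg => ?_
            rw [← sq]
            exact hG.weight_sq (hAG f hf).1 (Finset.mem_filter.1 hg).1 (hne f hf g hg)
          rw [this, hG.sum_avoid_weight (hAG f hf).1 (hAG f hf).2]
          linarith
        · rw [add_zero]
          exact hG.sum_avoid_weight_mul_weight_le hr (hAG f hf).1 (hAG f' hf').1 hff
            (hAG f hf).2 (hAG f' hf').2
      refine (Finset.sum_le_sum hentry).trans ?_
      rw [Finset.sum_add_distrib, Finset.sum_const, nsmul_eq_mul, Finset.sum_ite_eq, if_pos hf]
    refine (Finset.sum_le_sum hrow).trans ?_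
    rw [Finset.sum_const, nsmul_eq_mul]
  have hvar : ∑ g ∈ S, (∑ f ∈ A, w f g - M) ^ 2 ≤ M * ((q - 1) * (q ^ 2 + M)) := by
    have hexp : ∑ g ∈ S, (∑ f ∈ A, w f g - M) ^ 2 = ∑ g ∈ S, (∑ f ∈ A, w f g) ^ 2 -
        2 * M * ∑ g ∈ S, ∑ f ∈ A, w f g + M ^ 2 * S.card := by
      rw [Finset.mul_sum, ← Finset.sum_sub_distrib, mul_comm (M ^ 2), ← nsmul_eq_mul,
        ← Finset.sum_const, ← Finset.sum_add_distrib]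
      exact Finset.sum_congr rfl fun g _ => by ring
    rw [hexp, hY1, hG.card_avoid]
    linarith
  have hBsum : ∑ g ∈ B, (∑ f ∈ A, w f g - M) ^ 2 = B.card * M ^ 2 := by
    rw [← nsmul_eq_mul, ← Finset.sum_const]
    refine Finset.sum_congr rfl fun g hg => ?_
    have : ∑ f ∈ A, w f g = M * 2 := by
      rw [← nsmul_eq_mul, ← Finset.sum_const]
      exact Finset.sum_congr rfl fun f hf => hG.weight_of_meet (hAG f hf).1
        (Finset.mem_filter.1 (hBS hg)).1 (hne f hf g (hBS hg))
        (hint f (Finset.mem_filter.1 hf).1 g (Finset.mem_filter.1 hg).1)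
    rw [this]
    ring
  have hle := (Finset.sum_le_sum_of_subset_of_nonneg hBS
    (fun g _ _ => sq_nonneg (∑ f ∈ A, w f g - M))).trans hvar
  rw [hBsum] at hle
  have hBc : (B.card : ℤ) = s.card - M := by rw [hM, ← hB]; push_cast; ring
  rw [← hBc]
  rcases (Nat.cast_nonneg A.card : (0 : ℤ) ≤ A.card).eq_or_lt with h0 | h0
  · rw [hM, ← h0]
    nlinarith [sq_nonneg (q : ℤ)]
  · refine le_of_mul_le_mul_left ?_ h0
    linarith

/-- A member of an intersecting family not sending `p` to `b` meets only half of the maps that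
do. -/
lemma two_mul_card_le (hG : IsSharp G q) {s : Finset (X → X)} (hs : s ⊆ G)
    (hint : ∀ f ∈ s, ∀ g ∈ s, ∃ x, f x = g x) {p b : X} {g : X → X} (hg : g ∈ s)
    (hgp : g p ≠ b) : 2 * ((s.filter fun f => f p = b).card : ℤ) ≤ q * (q - 1) := by
  have h2 := hG.two_le
  have hgG := hs hg
  set A := s.filter fun f => f p = b with hA
  set C := G.filter fun f => f p = b with hC
  have hAC : A ⊆ C := Finset.filter_subset_filter _ hs
  have hsum1 : ∑ f ∈ C, ((agree f g).card : ℤ) = (q - 1) * (q - 1) := by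
    simp only [card_agree_eq_sum]
    rw [Finset.sum_comm]
    obtain ⟨z, hz⟩ := hG.surj hgG b
    have hpz : p ≠ z := fun h => hgp (by rw [h, hz])
    rw [← Finset.sum_add_sum_compl ({p, z} : Finset X), Finset.sum_eq_zero, zero_add,
      Finset.sum_congr rfl (g := fun _ => (q : ℤ) - 1), Finset.sum_const,
      hG.card_compl_pair hpz, nsmul_eq_mul]
    · congr 1; omega
    · intro x hx
      have hx' : x ≠ p ∧ x ≠ z := by simpa using hx
      have h3 := hG.card_through_two hx'.1.symm (a' := b) (b' := g x)
        (fun h => hx'.2 (hG.inj g hgG (h.symm.trans hz.symm)))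
      rw [Finset.sum_boole, hC, Finset.filter_filter, h3]
      push_cast [Nat.cast_sub (by omega : 1 ≤ q)]
      rfl
    · intro x hx
      refine Finset.sum_eq_zero fun f hf => if_neg fun h => ?_
      obtain ⟨hfG, hfp⟩ := Finset.mem_filter.1 hf
      have hx' : x = p ∨ x = z := by simpa using hx
      rcases hx' with rfl | rfl
      · exact hgp (h.symm.trans hfp)
      · exact hpz (hG.inj f hfG (hfp.trans (hz.symm.trans h.symm)))
  have hsum2 : ∑ f ∈ C, tangency f g ≤ q - 1 := by
    have h3 := hG.sum_tangency_mul g (fun f => if f p = b then 1 else 0)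
    simp only [mul_ite, mul_one, mul_zero] at h3
    simp only [tangency_comm _ g]
    rw [hC, Finset.sum_filter, h3]
    obtain ⟨z, hz⟩ := hG.surj hgG b
    have hpz : p ≠ z := fun h => hgp (by rw [h, hz])
    rw [← Finset.sum_add_sum_compl ({p, z} : Finset X), Finset.sum_eq_zero, zero_add]
    · refine (Finset.sum_le_card_nsmul _ _ 1 ?_).trans ?_
      · intro a ha
        have ha' : a ≠ p ∧ a ≠ z := by simpa using ha
        have h4 := hG.card_pencil_through hgG ha'.1.symm (y := b)
          (fun h => ha'.2 (hG.inj g hgG (h.symm.trans hz.symm)))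
        have h5 : ∑ f ∈ pencil G g a, (if f p = b then (1 : ℤ) else 0) = 1 := by
          rw [Finset.sum_boole, h4]; rfl
        refine le_trans ?_ h5.le
        exact Finset.sum_le_sum_of_subset_of_nonneg (Finset.erase_subset _ _)
          fun f _ _ => by split_ifs <;> simp
      · rw [hG.card_compl_pair hpz, nsmul_eq_mul]
        omega
    · intro x hx
      refine Finset.sum_eq_zero fun f hf => if_neg fun h => ?_
      have hfm := Finset.mem_of_mem_erase hf
      have hfx := apply_of_mem_pencil hfm
      have hfG := (mem_pencil.1 hfm).1
      have hx' : x = p ∨ x = z := by simpa using hx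
      rcases hx' with rfl | rfl
      · exact hgp (hfx.symm.trans h)
      · exact hpz (hG.inj f hfG (h.trans (hz.symm.trans hfx.symm)))
  have hA2 : ∑ f ∈ A, (((agree f g).card : ℤ) + tangency f g) = A.card * 2 := by
    rw [← nsmul_eq_mul, ← Finset.sum_const]
    refine Finset.sum_congr rfl fun f hf => ?_
    obtain ⟨hfs, hfp⟩ := Finset.mem_filter.1 hf
    exact hG.weight_of_meet (hs hfs) hgG (fun h => hgp (h ▸ hfp)) (hint f hfs g hg)
  have hle : ∑ f ∈ A, (((agree f g).card : ℤ) + tangency f g) ≤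
      ∑ f ∈ C, (((agree f g).card : ℤ) + tangency f g) :=
    Finset.sum_le_sum_of_subset_of_nonneg hAC
      fun f _ _ => add_nonneg (Nat.cast_nonneg _) (tangency_nonneg _ _)
  rw [hA2, Finset.sum_add_distrib, hsum1] at hle
  linarith

/-- Some member of an intersecting family is tangent to few other members. -/
lemma exists_sum_tangency_le (hG : IsSharp G q) {r : ℕ} (hr2 : r ≤ 2)
    (hr : ∀ f ∈ G, ∀ g ∈ G, ∀ a, f a ≠ g a → ∑ h ∈ pencil G f a, tangency h g ≤ r)
    (cls : (X → X) → ℤ) (hcls : ∀ f ∈ G, ∀ g ∈ G, tangency f g = 1 → cls f = cls g)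
    (hcard : ∀ f ∈ G, r * (G.filter fun g => cls g = cls f).card ≤ G.card)
    {s : Finset (X → X)} (hs : s ⊆ G) (hint : ∀ f ∈ s, ∀ g ∈ s, ∃ x, f x = g x)
    (hne : s.Nonempty) :
    ∃ f ∈ s, (q : ℤ) * ∑ g ∈ s, tangency f g ≤ q ^ 2 + 2 * s.card := by
  have h2 : (2 : ℤ) ≤ q := by exact_mod_cast hG.two_le
  by_contra! hcon
  obtain ⟨f₀, hf₀⟩ := hne
  set K := G.filter fun g => cls g = cls f₀ with hK
  set s₀ := s.filter fun g => cls g = cls f₀ with hs₀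
  set N : ℤ := (s₀.card : ℤ) with hN
  have hs₀K : s₀ ⊆ K := Finset.filter_subset_filter _ hs
  have hs₀s : s₀ ⊆ s := Finset.filter_subset _ _
  have hKG : K ⊆ G := Finset.filter_subset _ _
  have hf₀s : f₀ ∈ s₀ := Finset.mem_filter.2 ⟨hf₀, rfl⟩
  have hNpos : 0 < N := by
    rw [hN]
    exact_mod_cast Finset.card_pos.2 ⟨f₀, hf₀s⟩
  have hNle : N ≤ s.card := by
    rw [hN]
    exact_mod_cast Finset.card_le_card hs₀s
  have hzero : ∀ f ∈ K, ∀ g ∈ G, g ∉ K → tangency f g = 0 := by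
    intro f hf g hg hgK
    by_contra h
    have h1 : tangency f g = 1 := by
      rw [tangency] at h ⊢
      split_ifs at h ⊢ with h3
      · rfl
      · exact absurd rfl h
    exact hgK (Finset.mem_filter.2 ⟨hg, (hcls f (hKG hf) g hg h1).symm.trans
      (Finset.mem_filter.1 hf).2⟩)
  have hT1 : ∑ g ∈ K, ∑ f ∈ s₀, tangency f g = N * ((q + 1) * (q - 1)) := by
    rw [Finset.sum_comm, ← nsmul_eq_mul, ← Finset.sum_const]
    refine Finset.sum_congr rfl fun f hf => ?_
    rw [← hG.sum_tangency (hKG (hs₀K hf))]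
    exact Finset.sum_subset hKG fun g hg hgK => hzero f (hs₀K hf) g hg hgK
  have hT2 : ∑ g ∈ K, (∑ f ∈ s₀, tangency f g) ^ 2 ≤
      N * (N * (r * (q - 1)) + (q + 1) * (q - 1)) := by
    rw [sum_sq_sum]
    have hrow : ∀ f ∈ s₀, ∑ f' ∈ s₀, ∑ g ∈ K, tangency f g * tangency f' g ≤
        N * (r * (q - 1)) + (q + 1) * (q - 1) := by
      intro f hf
      have hentry : ∀ f' ∈ s₀, ∑ g ∈ K, tangency f g * tangency f' g ≤
          (r * (q - 1)) + if f = f' then ((q : ℤ) + 1) * (q - 1) else 0 := by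
        intro f' hf'
        refine (Finset.sum_le_sum_of_subset_of_nonneg hKG
          fun g _ _ => mul_nonneg (tangency_nonneg _ _) (tangency_nonneg _ _)).trans ?_
        split_ifs with hff
        · subst hff
          have h3 : ∑ g ∈ G, tangency f g * tangency f g = (q + 1) * (q - 1) := by
            rw [← hG.sum_tangency (hKG (hs₀K hf))]
            refine Finset.sum_congr rfl fun g _ => ?_
            rw [tangency]; split_ifs <;> simp
          rw [h3]
          have : (0 : ℤ) ≤ r * (q - 1) := mul_nonneg (Nat.cast_nonneg _) (by linarith)
          linarith
        · rw [add_zero]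
          exact hG.sum_tangency_mul_tangency_le hr2 hr (hKG (hs₀K hf)) (hKG (hs₀K hf')) hff
            (hint f (hs₀s hf) f' (hs₀s hf'))
      refine (Finset.sum_le_sum hentry).trans ?_
      rw [Finset.sum_add_distrib, Finset.sum_const, nsmul_eq_mul, Finset.sum_ite_eq, if_pos hf]
    refine (Finset.sum_le_sum hrow).trans ?_
    rw [Finset.sum_const, nsmul_eq_mul]
  have hKcard : (r : ℤ) * K.card ≤ (q + 1) * (q * (q - 1)) := by
    have h3 := hcard f₀ (hs hf₀)
    rw [hG.card_eq_mul] at h3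
    have := hG.two_le
    zify [(by omega : 1 ≤ q)] at h3
    exact h3
  have hexp : ∑ g ∈ K, (q * ∑ f ∈ s₀, tangency f g - r * N) ^ 2 =
      q ^ 2 * ∑ g ∈ K, (∑ f ∈ s₀, tangency f g) ^ 2 -
        2 * (q * (r * N)) * ∑ g ∈ K, ∑ f ∈ s₀, tangency f g + r * N ^ 2 * (r * K.card) := by
    have hconst : r * N ^ 2 * (r * (K.card : ℤ)) = ∑ _g ∈ K, r * N ^ 2 * r := by
      rw [Finset.sum_const, nsmul_eq_mul]
      ring
    rw [hconst, Finset.mul_sum, Finset.mul_sum, ← Finset.sum_sub_distrib,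
      ← Finset.sum_add_distrib]
    exact Finset.sum_congr rfl fun g _ => by ring
  have hup : ∑ g ∈ K, (q * ∑ f ∈ s₀, tangency f g - r * N) ^ 2 ≤ q ^ 4 * N := by
    rw [hexp, hT1]
    have h3 := mul_le_mul_of_nonneg_left hT2 (sq_nonneg (q : ℤ))
    have hrN : 0 ≤ (r : ℤ) * N ^ 2 := mul_nonneg (Nat.cast_nonneg _) (sq_nonneg _)
    have h4 := mul_le_mul_of_nonneg_left hKcard hrN
    have h5 : 0 ≤ (r : ℤ) * N ^ 2 * (q * (q - 1)) :=
      mul_nonneg hrN (by nlinarith)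
    have h6 : 0 ≤ (q : ℤ) ^ 2 * N := by positivity
    linarith
  have hr2' : (r : ℤ) ≤ 2 := by exact_mod_cast hr2
  have hlow : ∀ g ∈ s₀, (q : ℤ) ^ 4 < (q * ∑ f ∈ s₀, tangency f g - r * N) ^ 2 := by
    intro g hg
    have h3 := hcon g (hs₀s hg)
    have h4 : ∑ f ∈ s, tangency g f = ∑ f ∈ s₀, tangency f g := by
      simp only [tangency_comm _ g]
      refine (Finset.sum_subset hs₀s fun f hf hfs => hzero g (hs₀K hg) f (hs hf) fun hfK => ?_).symm
      exact hfs (Finset.mem_filter.2 ⟨hf, (Finset.mem_filter.1 hfK).2⟩)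
    rw [h4] at h3
    have h5 : (q : ℤ) ^ 2 < q * ∑ f ∈ s₀, tangency f g - r * N := by nlinarith
    calc (q : ℤ) ^ 4 = (q ^ 2) ^ 2 := by ring
      _ < _ := by gcongr
  have hlt : ∑ g ∈ s₀, (q : ℤ) ^ 4 < ∑ g ∈ s₀, (q * ∑ f ∈ s₀, tangency f g - r * N) ^ 2 :=
    Finset.sum_lt_sum_of_nonempty ⟨f₀, hf₀s⟩ hlow
  have hsub := Finset.sum_le_sum_of_subset_of_nonneg hs₀K
    (fun g _ _ => sq_nonneg (q * ∑ f ∈ s₀, tangency f g - r * N))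
  rw [Finset.sum_const, nsmul_eq_mul] at hlt
  linarith

/-- The size bound is incompatible with the inequalities for the number `M` of members of an
intersecting family with `N` members that share a value. -/
lemma numeric_contradiction {q N M : ℝ} (hq : 2 ≤ q)
    (hN : (1 / Real.sqrt 2) * q ^ 2 + 2 * Real.sqrt 2 * q + 8 ≤ N)
    (hlow : 2 * N * (q - 1) - q ≤ q * (q + 1) * M) (hhigh : 2 * M ≤ q * (q - 1))
    (hM : M * (N - M) ≤ (q - 1) * (q ^ 2 + M)) : False := by
  obtain ⟨α, hα⟩ : ∃ α, α = Real.sqrt 2 := ⟨_, rfl⟩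
  have hα2 : α ^ 2 = 2 := by rw [hα]; exact Real.sq_sqrt (by norm_num)
  have hα0 : 0 ≤ α := hα ▸ Real.sqrt_nonneg 2
  have hα1 : 1.41 < α := by nlinarith
  have hα3 : α < 1.42 := by nlinarith
  have hinv : 1 / Real.sqrt 2 = α / 2 := by
    rw [← hα, div_eq_div_iff (by linarith) (by norm_num)]
    linarith
  rw [hinv, ← hα] at hN
  set N₀ := α / 2 * q ^ 2 + 2 * α * q + 8 with hN₀
  have hq0 : 0 < q := by linarith
  set D := q * (q + 1) with hD
  have hDpos : 0 < D := by positivity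
  -- the lower endpoint
  have hx : (q - 1) * q ^ 2 * D ^ 2 <
      (2 * N * (q - 1) - q) * ((N - q + 1) * D - (2 * N * (q - 1) - q)) := by
    have e1 : α * q ^ 3 + 3 * α * q ^ 2 + (15 - 4 * α) * q - 16 ≤ 2 * N * (q - 1) - q := by
      have : 0 ≤ (N - N₀) * (q - 1) := mul_nonneg (by linarith) (by linarith)
      rw [hN₀] at this
      linarith
    have e2 : α / 2 * q ^ 4 + (3 / 2 * α - 1) * q ^ 3 + (8 - α) * q ^ 2 + (4 * α - 6) * q + 16 ≤
        (N - q + 1) * D - (2 * N * (q - 1) - q) := by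
      have : 0 ≤ (N - N₀) * (q ^ 2 - q + 2) := mul_nonneg (by linarith) (by nlinarith)
      rw [hN₀] at this
      rw [hD]
      linarith
    have e3 : α * q ^ 3 + 3 * α * q ^ 2 ≤
        α * q ^ 3 + 3 * α * q ^ 2 + (15 - 4 * α) * q - 16 := by nlinarith
    have e4 : α / 2 * q ^ 4 + (3 / 2 * α - 1) * q ^ 3 ≤
        α / 2 * q ^ 4 + (3 / 2 * α - 1) * q ^ 3 + (8 - α) * q ^ 2 + (4 * α - 6) * q + 16 := by
      nlinarith
    have e5 : (q - 1) * q ^ 2 * D ^ 2 <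
        (α * q ^ 3 + 3 * α * q ^ 2) * (α / 2 * q ^ 4 + (3 / 2 * α - 1) * q ^ 3) := by
      have : (α * q ^ 3 + 3 * α * q ^ 2) * (α / 2 * q ^ 4 + (3 / 2 * α - 1) * q ^ 3) -
          (q - 1) * q ^ 2 * D ^ 2 = q ^ 4 * ((5 - α) * q ^ 2 + (10 - 3 * α) * q + 1) := by
        rw [hD]
        linear_combination (q ^ 7 / 2 + 3 * q ^ 6 + 9 / 2 * q ^ 5) * hα2
      have h3 : 0 < q ^ 4 * ((5 - α) * q ^ 2 + (10 - 3 * α) * q + 1) :=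
        mul_pos (by positivity) (by nlinarith [sq_nonneg q])
      linarith
    refine e5.trans_le ?_
    refine mul_le_mul (e3.trans e1) (e4.trans e2) ?_ ?_
    · have : 0 ≤ 3 / 2 * α - 1 := by linarith
      positivity
    · refine le_trans ?_ (e3.trans e1)
      positivity
  -- the upper endpoint
  have hu : (q - 1) * q ^ 2 < q * (q - 1) / 2 * (N - q + 1 - q * (q - 1) / 2) := by
    have h3 : 2 * q < N - q + 1 - q * (q - 1) / 2 := by
      rw [hN₀] at hN
      nlinarith
    have h4 : 0 < q * (q - 1) / 2 := by
      have : 0 < q - 1 := by linarith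
      positivity
    have := mul_lt_mul_of_pos_left h3 h4
    linarith
  set x := (2 * N * (q - 1) - q) / D with hxdef
  have hxD : 2 * N * (q - 1) - q = x * D := by
    rw [hxdef]; field_simp
  have hx' : (q - 1) * q ^ 2 < x * (N - q + 1 - x) := by
    rw [hxD] at hx
    have h3 : (q - 1) * q ^ 2 * D ^ 2 < x * (N - q + 1 - x) * D ^ 2 := by linarith
    exact lt_of_mul_lt_mul_right h3 (by positivity)
  have hxM : x ≤ M := by
    rw [hxD, mul_comm] at hlow
    exact le_of_mul_le_mul_left hlow hDpos
  set u := q * (q - 1) / 2 with hudef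
  have hMu : M ≤ u := by rw [hudef]; linarith
  have hφ : M * (N - q + 1 - M) ≤ (q - 1) * q ^ 2 := by linarith
  have hconc : 0 ≤ (M - x) * (u - M) := mul_nonneg (by linarith) (by linarith)
  rcases hxM.eq_or_lt with h | h
  · rw [← h] at hφ; linarith
  · have hxu : x < u := by linarith
    have h6 : (u - M) * ((q - 1) * q ^ 2) + (M - x) * ((q - 1) * q ^ 2) <
        (u - M) * (x * (N - q + 1 - x)) + (M - x) * (u * (N - q + 1 - u)) := by
      have h7 : (u - M) * ((q - 1) * q ^ 2) ≤ (u - M) * (x * (N - q + 1 - x)) :=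
        mul_le_mul_of_nonneg_left hx'.le (by linarith)
      have h8 : (M - x) * ((q - 1) * q ^ 2) < (M - x) * (u * (N - q + 1 - u)) :=
        mul_lt_mul_of_pos_left hu (by linarith)
      linarith
    have h9 : (u - M) * (x * (N - q + 1 - x)) + (M - x) * (u * (N - q + 1 - u)) =
        (u - x) * (M * (N - q + 1 - M)) - (u - x) * ((M - x) * (u - M)) := by ring
    have h10 := mul_le_mul_of_nonneg_left hφ (by linarith : 0 ≤ u - x)
    have h11 : 0 ≤ (u - x) * ((M - x) * (u - M)) := mul_nonneg (by linarith) hconc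
    linarith

/-- A large intersecting family in a sharply 3-transitive set of maps fixes an image. -/
theorem exists_common_value (hG : IsSharp G q) {r : ℕ} (hr2 : r ≤ 2)
    (hr : ∀ f ∈ G, ∀ g ∈ G, ∀ a, f a ≠ g a → ∑ h ∈ pencil G f a, tangency h g ≤ r)
    (cls : (X → X) → ℤ) (hcls : ∀ f ∈ G, ∀ g ∈ G, tangency f g = 1 → cls f = cls g)
    (hcard : ∀ f ∈ G, r * (G.filter fun g => cls g = cls f).card ≤ G.card)
    {s : Finset (X → X)} (hs : s ⊆ G) (hint : ∀ f ∈ s, ∀ g ∈ s, ∃ x, f x = g x)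
    (hsize : (1 / Real.sqrt 2) * (q : ℝ) ^ 2 + 2 * Real.sqrt 2 * (q : ℝ) + 8 ≤ s.card) :
    ∃ p b : X, ∀ f ∈ s, f p = b := by
  by_contra! hno
  have h2 : (2 : ℤ) ≤ q := by exact_mod_cast hG.two_le
  have hr2' : (r : ℤ) ≤ 2 := by exact_mod_cast hr2
  have hne : s.Nonempty := by
    rw [← Finset.card_pos]
    have : (0 : ℝ) < s.card := lt_of_lt_of_le (by positivity) hsize
    exact_mod_cast this
  obtain ⟨f, hf, hft⟩ := hG.exists_sum_tangency_le hr2 hr cls hcls hcard hs hint hne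
  have hX : ∑ x, ((s.filter fun g => g x = f x).card : ℤ) =
      q + 1 + 2 * (s.card - 1) - ∑ g ∈ s, tangency f g := by
    have h3 : ∑ x, ((s.filter fun g => g x = f x).card : ℤ) =
        ∑ g ∈ s, ((agree f g).card : ℤ) := by
      simp only [card_agree_eq_sum]
      rw [Finset.sum_comm]
      refine Finset.sum_congr rfl fun x _ => ?_
      simp [eq_comm]
    have h4 : ∑ g ∈ s.erase f, (((agree f g).card : ℤ) + tangency f g) = 2 * (s.card - 1) := by
      rw [Finset.sum_congr rfl (g := fun _ => (2 : ℤ)), Finset.sum_const,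
        Finset.card_erase_of_mem hf, nsmul_eq_mul]
      · have := Finset.card_pos.2 hne
        push_cast [Nat.cast_sub (by omega : 1 ≤ s.card)]
        ring
      · intro g hg
        obtain ⟨hgf, hgs⟩ := Finset.mem_erase.1 hg
        exact hG.weight_of_meet (hs hf) (hs hgs) hgf.symm (hint f hf g hgs)
    rw [Finset.sum_add_distrib] at h4
    rw [h3, ← Finset.add_sum_erase _ _ hf, ← Finset.add_sum_erase s (tangency f) hf,
      hG.card_agree_self, hG.tangency_self]
    push_cast
    linarith
  obtain ⟨x, hx⟩ : ∃ x, q + 1 + 2 * ((s.card : ℤ) - 1) - ∑ g ∈ s, tangency f g ≤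
      (q + 1) * ((s.filter fun g => g x = f x).card : ℤ) := by
    by_contra! hcon
    have : Nonempty X := Fintype.card_pos_iff.1 (by rw [hG.card_eq]; omega)
    have h3 := Finset.sum_lt_sum_of_nonempty (Finset.univ_nonempty (α := X)) fun x _ => hcon x
    rw [← Finset.mul_sum, hX, Finset.sum_const, Finset.card_univ, hG.card_eq, nsmul_eq_mul] at h3
    push_cast at h3
    linarith
  obtain ⟨g, hgs, hgx⟩ := hno x (f x)
  have hhigh := hG.two_mul_card_le hs hint hgs hgx
  have hM := hG.card_mul_card_le
    (fun f hf g hg a h => (hr f hf g hg a h).trans hr2') hs hint x (f x)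
  set M : ℤ := ((s.filter fun g => g x = f x).card : ℤ) with hMdef
  have hlow : 2 * (s.card : ℤ) * (q - 1) - q ≤ q * (q + 1) * M := by
    have := mul_le_mul_of_nonneg_left hx (by linarith : (0 : ℤ) ≤ q)
    linarith
  refine numeric_contradiction (q := q) (N := s.card) (M := (M : ℝ)) (by exact_mod_cast h2) hsize
    (by exact_mod_cast hlow) (by exact_mod_cast hhigh) ?_
  exact_mod_cast hM

end IsSharp

section ProjectiveLine

open Projectivization

variable {F : Type} [Field F]

lemma mk_eq_mk_iff_cross {v w : Fin 2 → F} (hv : v ≠ 0) (hw : w ≠ 0) :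
    mk F v hv = mk F w hw ↔ v 0 * w 1 = v 1 * w 0 := by
  rw [mk_eq_mk_iff']
  constructor
  · rintro ⟨a, rfl⟩
    simp only [Pi.smul_apply, smul_eq_mul]
    ring
  · intro h
    by_cases h0 : w 0 = 0
    · have h1 : w 1 ≠ 0 := fun h1 => hw (by ext i; fin_cases i <;> simp [h0, h1])
      refine ⟨v 1 / w 1, ?_⟩
      ext i
      fin_cases i
      · have : v 0 = 0 := by simpa [h0, h1] using h
        simp [h0, this]
      · simp [h1]
    · refine ⟨v 0 / w 0, ?_⟩
      ext i
      fin_cases i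
      · simp [h0]
      · simp only [Fin.mk_one, Pi.smul_apply, smul_eq_mul]
        field_simp
        linear_combination h

lemma mulVec_ne_zero (M : GL (Fin 2) F) {v : Fin 2 → F} (hv : v ≠ 0) : M.1.mulVec v ≠ 0 := by
  intro h
  apply hv
  have h1 : (M⁻¹).1.mulVec (M.1.mulVec v) = v := by
    rw [Matrix.mulVec_mulVec, ← Units.val_mul, inv_mul_cancel, Units.val_one, Matrix.one_mulVec]
  rw [← h1, h, Matrix.mulVec_zero]

lemma indMap_mk (M : GL (Fin 2) F) {v : Fin 2 → F} (hv : v ≠ 0) :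
    indMap M (mk F v hv) = mk F (M.1.mulVec v) (mulVec_ne_zero M hv) := rfl

lemma indMap_eq_indMap_iff (M N : GL (Fin 2) F) {v : Fin 2 → F} (hv : v ≠ 0) :
    indMap M (mk F v hv) = indMap N (mk F v hv) ↔
      (M.1 0 0 * v 0 + M.1 0 1 * v 1) * (N.1 1 0 * v 0 + N.1 1 1 * v 1) =
      (M.1 1 0 * v 0 + M.1 1 1 * v 1) * (N.1 0 0 * v 0 + N.1 0 1 * v 1) := by
  rw [indMap_mk, indMap_mk, mk_eq_mk_iff_cross]
  simp [Matrix.mulVec, dotProduct, Fin.sum_univ_two]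

lemma indMap_mul (M N : GL (Fin 2) F) : indMap (M * N) = indMap M ∘ indMap N := by
  funext x
  induction x using Projectivization.ind with
  | h v hv =>
    simp only [Function.comp_apply, indMap_mk, Units.val_mul, Matrix.mulVec_mulVec]

lemma indMap_one : indMap (1 : GL (Fin 2) F) = id := by
  funext x
  induction x using Projectivization.ind with
  | h v hv => simp [indMap_mk]

lemma indMap_inv_apply (M : GL (Fin 2) F) (x : Projectivization F (Fin 2 → F)) :
    indMap M⁻¹ (indMap M x) = x := by
  rw [← Function.comp_apply (f := indMap M⁻¹), ← indMap_mul, inv_mul_cancel, indMap_one, id]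

lemma indMap_apply_inv (M : GL (Fin 2) F) (x : Projectivization F (Fin 2 → F)) :
    indMap M (indMap M⁻¹ x) = x := by
  rw [← Function.comp_apply (f := indMap M), ← indMap_mul, mul_inv_cancel, indMap_one, id]

lemma indMap_injective (M : GL (Fin 2) F) : Function.Injective (indMap M) :=
  Function.LeftInverse.injective (indMap_inv_apply M)

/-- The point at infinity of the projective line. -/
def infPt (F : Type) [Field F] : Projectivization F (Fin 2 → F) :=
  mk F ![1, 0] fun h => one_ne_zero (congrFun h 0)

/-- The origin of the projective line. -/
def zeroPt (F : Type) [Field F] : Projectivization F (Fin 2 → F) :=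
  mk F ![0, 1] fun h => one_ne_zero (congrFun h 1)

/-- The unit point of the projective line. -/
def onePt (F : Type) [Field F] : Projectivization F (Fin 2 → F) :=
  mk F ![1, 1] fun h => one_ne_zero (congrFun h 0)

lemma exists_frame {a b c : Projectivization F (Fin 2 → F)} (hab : a ≠ b) (hac : a ≠ c)
    (hbc : b ≠ c) :
    ∃ A : GL (Fin 2) F, indMap A (infPt F) = a ∧ indMap A (zeroPt F) = b ∧
      indMap A (onePt F) = c := by
  induction a using Projectivization.ind with | h v hv => ?_
  induction b using Projectivization.ind with | h w hw => ?_
  induction c using Projectivization.ind with | h u hu => ?_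
  rw [Ne, mk_eq_mk_iff_cross, ← sub_eq_zero] at hab hac hbc
  refine ⟨Matrix.GeneralLinearGroup.mkOfDetNeZero
    !![(u 0 * w 1 - u 1 * w 0) * v 0, (v 0 * u 1 - v 1 * u 0) * w 0;
      (u 0 * w 1 - u 1 * w 0) * v 1, (v 0 * u 1 - v 1 * u 0) * w 1] ?_, ?_, ?_, ?_⟩
  · rw [Matrix.det_fin_two_of]
    have : (w 0 * u 1 - w 1 * u 0) * (v 0 * u 1 - v 1 * u 0) * (v 0 * w 1 - v 1 * w 0) ≠ 0 :=
      mul_ne_zero (mul_ne_zero hbc hac) hab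
    intro h
    apply this
    linear_combination -h
  · rw [infPt, indMap_mk, mk_eq_mk_iff_cross]
    simp [Matrix.mulVec, dotProduct, Fin.sum_univ_two]
    ring
  · rw [zeroPt, indMap_mk, mk_eq_mk_iff_cross]
    simp [Matrix.mulVec, dotProduct, Fin.sum_univ_two]
    ring
  · rw [onePt, indMap_mk, mk_eq_mk_iff_cross]
    simp [Matrix.mulVec, dotProduct, Fin.sum_univ_two]
    ring

lemma exists_indMap_infPt (a : Projectivization F (Fin 2 → F)) :
    ∃ A : GL (Fin 2) F, indMap A (infPt F) = a := by
  induction a using Projectivization.ind with | h v hv => ?_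
  by_cases h0 : v 0 = 0
  · have h1 : v 1 ≠ 0 := fun h1 => hv (by ext i; fin_cases i <;> simp [h0, h1])
    refine ⟨Matrix.GeneralLinearGroup.mkOfDetNeZero !![v 0, 1; v 1, 0] (by simpa using h1), ?_⟩
    rw [infPt, indMap_mk, mk_eq_mk_iff_cross]
    simp [Matrix.mulVec, dotProduct, Fin.sum_univ_two, mul_comm]
  · refine ⟨Matrix.GeneralLinearGroup.mkOfDetNeZero !![v 0, 0; v 1, 1] (by simpa using h0), ?_⟩
    rw [infPt, indMap_mk, mk_eq_mk_iff_cross]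
    simp [Matrix.mulVec, dotProduct, Fin.sum_univ_two, mul_comm]

lemma indMap_eq_of_proportional {M N : GL (Fin 2) F} {c d : F} (hc : c ≠ 0)
    (h : ∀ i j, c * M.1 i j = d * N.1 i j) : indMap M = indMap N := by
  funext x
  induction x using Projectivization.ind with | h v hv => ?_
  rw [indMap_eq_indMap_iff]
  refine mul_left_cancel₀ hc ?_
  linear_combination (v 0 * (N.1 1 0 * v 0 + N.1 1 1 * v 1)) * h 0 0 +
    (v 1 * (N.1 1 0 * v 0 + N.1 1 1 * v 1)) * h 0 1 -
    (v 0 * (N.1 0 0 * v 0 + N.1 0 1 * v 1)) * h 1 0 -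
    (v 1 * (N.1 0 0 * v 0 + N.1 0 1 * v 1)) * h 1 1

lemma indMap_conj_apply_eq_iff (A M N : GL (Fin 2) F) (x : Projectivization F (Fin 2 → F)) :
    indMap (A⁻¹ * M⁻¹ * N * A) x = x ↔ indMap N (indMap A x) = indMap M (indMap A x) := by
  simp only [indMap_mul, Function.comp_apply]
  constructor
  · intro h
    have := congrArg (fun y => indMap M (indMap A y)) h
    simpa only [indMap_apply_inv] using this
  · intro h
    rw [h, indMap_inv_apply, indMap_inv_apply]

lemma indMap_eq_of_three {M N : GL (Fin 2) F} {a b c : Projectivization F (Fin 2 → F)}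
    (hab : a ≠ b) (hac : a ≠ c) (hbc : b ≠ c) (ha : indMap M a = indMap N a)
    (hb : indMap M b = indMap N b) (hc : indMap M c = indMap N c) : indMap M = indMap N := by
  obtain ⟨A, rfl, rfl, rfl⟩ := exists_frame hab hac hbc
  rw [← indMap_conj_apply_eq_iff] at ha hb hc
  set U := A⁻¹ * N⁻¹ * M * A with hU
  have e : ∀ x, indMap U x = x ↔ indMap U x = indMap 1 x := by simp [indMap_one]
  rw [e, infPt, indMap_eq_indMap_iff] at ha
  rw [e, zeroPt, indMap_eq_indMap_iff] at hb
  rw [e, onePt, indMap_eq_indMap_iff] at hc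
  have h10 : U.1 1 0 = 0 := by simpa using ha.symm
  have h01 : U.1 0 1 = 0 := by simpa using hb
  have h11 : U.1 1 1 = U.1 0 0 := by simpa [h10, h01] using hc.symm
  have h1 : indMap U = indMap 1 := by
    refine indMap_eq_of_proportional (c := 1) (d := U.1 0 0) one_ne_zero fun i j => ?_
    fin_cases i <;> fin_cases j <;> simp [h10, h01, h11]
  funext x
  have h2 := (indMap_conj_apply_eq_iff A N M (indMap A⁻¹ x)).1 (by rw [← hU, h1, indMap_one]; rfl)
  simpa only [indMap_apply_inv] using h2

/-- A matrix whose only fixed point is the point at infinity, or which acts trivially, is a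
scalar multiple of a unipotent matrix. -/
lemma unipotent_of_fixed {U : GL (Fin 2) F} (h0 : indMap U (infPt F) = infPt F)
    (h : indMap U = id ∨ ∀ x, indMap U x = x → x = infPt F) :
    U.1 1 0 = 0 ∧ U.1 1 1 = U.1 0 0 := by
  have e : ∀ x, indMap U x = x ↔ indMap U x = indMap 1 x := by simp [indMap_one]
  rw [e, infPt, indMap_eq_indMap_iff] at h0
  have h10 : U.1 1 0 = 0 := by simpa using h0.symm
  refine ⟨h10, ?_⟩
  rcases h with h | h
  · have h1 := (e (zeroPt F)).1 (congrFun h _)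
    have h2 := (e (onePt F)).1 (congrFun h _)
    rw [zeroPt, indMap_eq_indMap_iff] at h1
    rw [onePt, indMap_eq_indMap_iff] at h2
    have h01 : U.1 0 1 = 0 := by simpa using h1
    simpa [h01, h10] using h2.symm
  · by_contra hne
    have hw : (![U.1 0 1, U.1 1 1 - U.1 0 0] : Fin 2 → F) ≠ 0 := fun h3 =>
      hne (sub_eq_zero.1 (by simpa using congrFun h3 1))
    have h1 := h (mk F _ hw) (by
      rw [e, indMap_eq_indMap_iff]
      simp [h10]
      ring)
    rw [infPt, mk_eq_mk_iff_cross] at h1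
    exact hne (sub_eq_zero.1 (by simpa using h1.symm))

/-- If two matrices act equally on exactly one point, the binary quadratic form whose zeros are
the points of agreement is degenerate. -/
lemma discrim_eq_zero {M N : GL (Fin 2) F} {a : Projectivization F (Fin 2 → F)}
    (h : ∀ x, indMap M x = indMap N x ↔ x = a) :
    (M.1 0 0 * N.1 1 1 + M.1 1 1 * N.1 0 0 - M.1 0 1 * N.1 1 0 - M.1 1 0 * N.1 0 1) ^ 2 =
      4 * M.1.det * N.1.det := by
  induction a using Projectivization.ind with | h v hv => ?_
  set P := M.1 0 0 * N.1 1 0 - M.1 1 0 * N.1 0 0 with hP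
  set Q := M.1 0 0 * N.1 1 1 + M.1 0 1 * N.1 1 0 - M.1 1 0 * N.1 0 1 - M.1 1 1 * N.1 0 0 with hQ
  set R := M.1 0 1 * N.1 1 1 - M.1 1 1 * N.1 0 1 with hR
  have hΦ : ∀ (w : Fin 2 → F) (hw : w ≠ 0), P * w 0 ^ 2 + Q * w 0 * w 1 + R * w 1 ^ 2 = 0 ↔
      v 0 * w 1 - v 1 * w 0 = 0 := by
    intro w hw
    have h1 := h (mk F w hw)
    rw [indMap_eq_indMap_iff, mk_eq_mk_iff_cross] at h1
    have h2 : w 0 * v 1 = w 1 * v 0 ↔ v 0 * w 1 - v 1 * w 0 = 0 := by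
      rw [sub_eq_zero, eq_comm, mul_comm (w 1), mul_comm (w 0)]
    rw [← h2, ← h1, ← sub_eq_zero (a := (_ : F) * (_ : F))]
    rw [show P * w 0 ^ 2 + Q * w 0 * w 1 + R * w 1 ^ 2 =
      (M.1 0 0 * w 0 + M.1 0 1 * w 1) * (N.1 1 0 * w 0 + N.1 1 1 * w 1) -
      (M.1 1 0 * w 0 + M.1 1 1 * w 1) * (N.1 0 0 * w 0 + N.1 0 1 * w 1) by
        rw [hP, hQ, hR]; ring]
  have hv0 : P * v 0 ^ 2 + Q * v 0 * v 1 + R * v 1 ^ 2 = 0 := (hΦ v hv).2 (by ring)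
  suffices hdisc : Q ^ 2 = 4 * P * R by
    rw [Matrix.det_fin_two, Matrix.det_fin_two]
    rw [hP, hQ, hR] at hdisc
    linear_combination hdisc
  have key : ∀ w : Fin 2 → F, v 0 * w 1 - v 1 * w 0 = 1 →
      2 * P * v 0 * w 0 + Q * (v 0 * w 1 + v 1 * w 0) + 2 * R * v 1 * w 1 = 0 := by
    intro w hw
    by_contra hB
    set B := 2 * P * v 0 * w 0 + Q * (v 0 * w 1 + v 1 * w 0) + 2 * R * v 1 * w 1 with hBdef
    set s := P * w 0 ^ 2 + Q * w 0 * w 1 + R * w 1 ^ 2 with hs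
    have hc : v 0 * (B • w - s • v) 1 - v 1 * (B • w - s • v) 0 = B := by
      simp only [Pi.sub_apply, Pi.smul_apply, smul_eq_mul]
      linear_combination B * hw
    have hne : B • w - s • v ≠ 0 := by
      intro h0
      rw [h0] at hc
      apply hB
      simpa using hc.symm
    refine hB (hc.symm.trans ((hΦ _ hne).1 ?_))
    simp only [Pi.sub_apply, Pi.smul_apply, smul_eq_mul]
    linear_combination B ^ 2 * (-hs) + s * B * hBdef + s ^ 2 * hv0
  obtain ⟨w, hw⟩ : ∃ w : Fin 2 → F, v 0 * w 1 - v 1 * w 0 = 1 := by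
    by_cases h0 : v 0 = 0
    · have h1 : v 1 ≠ 0 := fun h1 => hv (by ext i; fin_cases i <;> simp [h0, h1])
      exact ⟨![-(v 1)⁻¹, 0], by simp [h1]⟩
    · exact ⟨![0, (v 0)⁻¹], by simp [h0]⟩
  have hk := key w hw
  set B := 2 * P * v 0 * w 0 + Q * (v 0 * w 1 + v 1 * w 0) + 2 * R * v 1 * w 1 with hBdef
  have : B ^ 2 - 4 * (P * v 0 ^ 2 + Q * v 0 * v 1 + R * v 1 ^ 2) *
      (P * w 0 ^ 2 + Q * w 0 * w 1 + R * w 1 ^ 2) =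
      (Q ^ 2 - 4 * P * R) * (v 0 * w 1 - v 1 * w 0) ^ 2 := by
    rw [hBdef]; ring
  rw [hk, hv0, hw] at this
  linear_combination -this

/-- The maps whose agreement set with `indMap M` is the point `a`, or which equal `indMap M`,
come from `M` by conjugated unipotent matrices. -/
lemma unipotent_of_agree {A M N : GL (Fin 2) F}
    (h : indMap N = indMap M ∨
      ∀ x, indMap M x = indMap N x ↔ x = indMap A (infPt F)) :
    (A⁻¹ * M⁻¹ * N * A).1 1 0 = 0 ∧ (A⁻¹ * M⁻¹ * N * A).1 1 1 = (A⁻¹ * M⁻¹ * N * A).1 0 0 := by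
  refine unipotent_of_fixed ?_ (h.imp (fun h => ?_) fun h x hx => ?_)
  · rw [indMap_conj_apply_eq_iff]
    rcases h with h | h
    · rw [h]
    · exact ((h _).2 rfl).symm
  · funext x
    exact (indMap_conj_apply_eq_iff A M N x).2 (by rw [h])
  · rw [indMap_conj_apply_eq_iff] at hx
    exact indMap_injective A ((h _).1 hx.symm)

lemma quadraticChar_det_eq [Fintype F] [DecidableEq F] {M N : GL (Fin 2) F}
    (h : indMap N = indMap M ∨ ∃ a, ∀ x, indMap M x = indMap N x ↔ x = a) :
    quadraticChar F N.1.det = quadraticChar F M.1.det := by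
  obtain ⟨A, hA⟩ : ∃ A : GL (Fin 2) F, indMap N = indMap M ∨
      ∀ x, indMap M x = indMap N x ↔ x = indMap A (infPt F) := by
    rcases h with h | ⟨a, h⟩
    · exact ⟨1, Or.inl h⟩
    · obtain ⟨A, rfl⟩ := exists_indMap_infPt a
      exact ⟨A, Or.inr h⟩
  obtain ⟨h1, h2⟩ := unipotent_of_agree hA
  set U := A⁻¹ * M⁻¹ * N * A with hU
  have hdet : U.1.det = U.1 0 0 ^ 2 := by
    rw [Matrix.det_fin_two, h1, h2]; ring
  have hU0 : U.1 0 0 ≠ 0 := by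
    intro h0
    have h3 := (Matrix.isUnits_det_units U).ne_zero
    rw [hdet, h0] at h3
    simp at h3
  have hN : M * A * U = N * A := by rw [hU]; group
  have h4 := congrArg (fun B : GL (Fin 2) F => B.1.det) hN
  simp only [Units.val_mul, Matrix.det_mul, hdet] at h4
  have hA0 : A.1.det ≠ 0 := (Matrix.isUnits_det_units A).ne_zero
  have h5 : N.1.det = M.1.det * U.1 0 0 ^ 2 := mul_right_cancel₀ hA0 (by linear_combination -h4)
  rw [h5, map_mul, quadraticChar_sq_one' hU0, mul_one]

open Classical in
/-- The square class of the determinant of a matrix inducing the given map. -/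
def detClass [Fintype F]
    (f : Projectivization F (Fin 2 → F) → Projectivization F (Fin 2 → F)) : ℤ :=
  if h : f ∈ pglMaps F then quadraticChar F h.choose.1.det else 0

open Classical in
lemma detClass_indMap [Fintype F] (M : GL (Fin 2) F) :
    detClass (indMap M) = quadraticChar F M.1.det := by
  have h : indMap M ∈ pglMaps F := ⟨M, rfl⟩
  rw [detClass, dif_pos h]
  exact quadraticChar_det_eq (Or.inl h.choose_spec)

/-- The number of square roots of a nonzero square in `F`. -/
def sqrtBound (F : Type) [Field F] : ℕ := if ringChar F = 2 then 1 else 2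

lemma sqrtBound_le_two : sqrtBound F ≤ 2 := by
  rw [sqrtBound]; split_ifs <;> norm_num

lemma card_sq_eq_le [Fintype F] [DecidableEq F] (D : F) :
    (Finset.univ.filter fun s : F => s ^ 2 = D).card ≤ sqrtBound F := by
  have hsub : ∀ s t : F, s ^ 2 = t ^ 2 → s = t ∨ s = -t :=
    fun s t h => sq_eq_sq_iff_eq_or_eq_neg.1 h
  rcases (Finset.univ.filter fun s : F => s ^ 2 = D).eq_empty_or_nonempty with h0 | ⟨t, ht⟩
  · rw [h0]; simp
  have ht2 : t ^ 2 = D := (Finset.mem_filter.1 ht).2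
  rw [sqrtBound]
  split_ifs with h2
  · have : CharP F 2 := ringChar.of_eq h2
    refine Finset.card_le_one.2 fun s hs u hu => ?_
    rcases hsub s u ((Finset.mem_filter.1 hs).2.trans (Finset.mem_filter.1 hu).2.symm) with h | h
    · exact h
    · rw [h, CharTwo.neg_eq]
  · refine (Finset.card_le_card (t := {t, -t}) fun s hs => ?_).trans Finset.card_le_two
    simpa using hsub s t ((Finset.mem_filter.1 hs).2.trans ht2.symm)

section Sharp

variable [Fintype F] [Fintype (Projectivization F (Fin 2 → F))]
  [DecidableEq (Projectivization F (Fin 2 → F))]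
  {G : Finset (Projectivization F (Fin 2 → F) → Projectivization F (Fin 2 → F))}

lemma isSharp_pgl (hG : ∀ f, f ∈ G ↔ f ∈ pglMaps F) : IsSharp G (Fintype.card F) where
  card_eq := by
    have := Projectivization.card_of_finrank_two F (Fin 2 → F) (by simp)
    simpa [Nat.card_eq_fintype_card] using this
  two_le := Fintype.one_lt_card
  inj f hf := by
    obtain ⟨M, rfl⟩ := (hG f).1 hf
    exact indMap_injective M
  exists_map a b c a' b' c' h1 h2 h3 h1' h2' h3' := by
    obtain ⟨A, rfl, rfl, rfl⟩ := exists_frame h1 h2 h3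
    obtain ⟨B, rfl, rfl, rfl⟩ := exists_frame h1' h2' h3'
    refine ⟨indMap (B * A⁻¹), (hG _).2 ⟨_, rfl⟩, ?_, ?_, ?_⟩ <;>
      rw [indMap_mul, Function.comp_apply, indMap_inv_apply]
  unique f hf g hg a b c hab hac hbc ha hb hc := by
    obtain ⟨M, rfl⟩ := (hG f).1 hf
    obtain ⟨N, rfl⟩ := (hG g).1 hg
    exact indMap_eq_of_three hab hac hbc ha hb hc

lemma detClass_eq_of_tangency (hG : ∀ f, f ∈ G ↔ f ∈ pglMaps F) :
    ∀ f ∈ G, ∀ g ∈ G, tangency f g = 1 → detClass f = detClass g := by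
  classical
  intro f hf g hg h
  obtain ⟨M, rfl⟩ := (hG f).1 hf
  obtain ⟨N, rfl⟩ := (hG g).1 hg
  rw [detClass_indMap, detClass_indMap]
  exact (quadraticChar_det_eq (Or.inr (exists_of_tangency h))).symm

lemma sqrtBound_mul_card_class_le (hG : ∀ f, f ∈ G ↔ f ∈ pglMaps F) :
    ∀ f ∈ G, sqrtBound F * (G.filter fun g => detClass g = detClass f).card ≤ G.card := by
  classical
  intro f hf
  rw [sqrtBound]
  split_ifs with h2
  · rw [one_mul]
    exact Finset.card_le_card (Finset.filter_subset _ _)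
  obtain ⟨M, rfl⟩ := (hG f).1 hf
  obtain ⟨ε, hε⟩ := quadraticChar_exists_neg_one h2
  have hε0 : ε ≠ 0 := by
    rintro rfl
    simp at hε
  let E : GL (Fin 2) F := Matrix.GeneralLinearGroup.mkOfDetNeZero
    !![ε, 0; 0, 1] (by simpa using hε0)
  have hE : E.1.det = ε := by simp [E]
  set C := G.filter fun g => detClass g = detClass (indMap M) with hC
  have hneg : ∀ N : GL (Fin 2) F, detClass (indMap (E * N)) = -detClass (indMap N) := by
    intro N
    rw [detClass_indMap, detClass_indMap, Units.val_mul, Matrix.det_mul, hE, map_mul, hε]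
    ring
  have hM0 : detClass (indMap M) ≠ 0 := by
    rw [detClass_indMap, Ne, quadraticChar_eq_zero_iff]
    exact (Matrix.isUnits_det_units M).ne_zero
  have hinj : (C.image fun g => indMap E ∘ g).card = C.card :=
    Finset.card_image_of_injective _ fun g h hgh =>
      (indMap_injective E).comp_left hgh
  have hdisj : Disjoint C (C.image fun g => indMap E ∘ g) := by
    rw [Finset.disjoint_left]
    intro g hg hg'
    obtain ⟨h, hh, rfl⟩ := Finset.mem_image.1 hg'
    obtain ⟨N, rfl⟩ := (hG h).1 (Finset.mem_filter.1 hh).1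
    have h3 := (Finset.mem_filter.1 hg).2
    rw [← indMap_mul, hneg, (Finset.mem_filter.1 hh).2] at h3
    exact hM0 (by linarith)
  have hsub : C ∪ C.image (fun g => indMap E ∘ g) ⊆ G := by
    refine Finset.union_subset (Finset.filter_subset _ _) fun g hg => ?_
    obtain ⟨h, hh, rfl⟩ := Finset.mem_image.1 hg
    obtain ⟨N, rfl⟩ := (hG h).1 (Finset.mem_filter.1 hh).1
    exact (hG _).2 ⟨E * N, indMap_mul E N⟩
  have := Finset.card_le_card hsub
  rw [Finset.card_union_of_disjoint hdisj, hinj] at this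
  omega

/-- The unipotent upper triangular matrix with upper right entry `β`. -/
def shear (β : F) : GL (Fin 2) F :=
  Matrix.GeneralLinearGroup.mkOfDetNeZero !![1, β; 0, 1] (by simp)

lemma sum_pencil_tangency_le (hG : ∀ f, f ∈ G ↔ f ∈ pglMaps F) :
    ∀ f ∈ G, ∀ g ∈ G, ∀ a, f a ≠ g a →
      ∑ h ∈ pencil G f a, tangency h g ≤ (sqrtBound F : ℤ) := by
  classical
  intro f hf g hg a hfg
  obtain ⟨M, rfl⟩ := (hG f).1 hf
  obtain ⟨N, rfl⟩ := (hG g).1 hg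
  obtain ⟨A, rfl⟩ := exists_indMap_infPt a
  set V := A⁻¹ * M⁻¹ * N * A with hV
  have hV10 : V.1 1 0 ≠ 0 := by
    intro h0
    apply hfg
    have h1 : indMap V (infPt F) = indMap 1 (infPt F) := by
      rw [infPt, indMap_eq_indMap_iff]
      simp [h0]
    rw [indMap_one, id, hV, indMap_conj_apply_eq_iff] at h1
    exact h1.symm
  simp only [tangency]
  rw [Finset.sum_boole, Nat.cast_le]
  refine le_trans ?_ (card_sq_eq_le (4 * V.1.det))
  refine (Finset.card_le_card fun h hh => ?_).trans (Finset.card_image_le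
    (f := fun s : F => indMap (M * A * shear ((V.1 0 0 + V.1 1 1 - s) / V.1 1 0) * A⁻¹)))
  obtain ⟨hp, ht⟩ := Finset.mem_filter.1 hh
  obtain ⟨hhG, hp⟩ := mem_pencil.1 hp
  obtain ⟨L, rfl⟩ := (hG h).1 hhG
  obtain ⟨h10, h11⟩ := unipotent_of_agree (A := A) (M := M) (N := L)
    (hp.imp id agree_eq_singleton_iff.1)
  set U := A⁻¹ * M⁻¹ * L * A with hU
  have hdet : U.1.det = U.1 0 0 ^ 2 := by
    rw [Matrix.det_fin_two, h10, h11]; ring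
  have hU0 : U.1 0 0 ≠ 0 := by
    intro h0
    have h3 := (Matrix.isUnits_det_units U).ne_zero
    rw [hdet, h0] at h3
    simp at h3
  obtain ⟨y, hy⟩ := exists_of_tangency (f := indMap L) (g := indMap N) (by rw [tangency, if_pos ht])
  have hUV : ∀ x, indMap U x = indMap V x ↔ x = indMap A⁻¹ y := by
    intro x
    have h1 : indMap U x = indMap V x ↔ indMap L (indMap A x) = indMap N (indMap A x) := by
      simp only [hU, hV, indMap_mul, Function.comp_apply, (indMap_injective _).eq_iff]
    rw [h1, hy]
    constructor
    · rintro rfl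
      rw [indMap_inv_apply]
    · rintro rfl
      rw [indMap_apply_inv]
  have hd := discrim_eq_zero hUV
  rw [hdet, h10, h11] at hd
  refine Finset.mem_image.2 ⟨V.1 0 0 + V.1 1 1 - U.1 0 1 / U.1 0 0 * V.1 1 0, ?_, ?_⟩
  · refine Finset.mem_filter.2 ⟨Finset.mem_univ _, ?_⟩
    field_simp
    linear_combination hd
  · have h1 : (V.1 0 0 + V.1 1 1 - (V.1 0 0 + V.1 1 1 - U.1 0 1 / U.1 0 0 * V.1 1 0)) / V.1 1 0 =
        U.1 0 1 / U.1 0 0 := by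
      field_simp
      ring
    have h2 : indMap (shear (U.1 0 1 / U.1 0 0)) = indMap U := by
      refine indMap_eq_of_proportional (c := U.1 0 0) (d := 1) hU0 fun i j => ?_
      fin_cases i <;> fin_cases j <;> simp [shear, h10, h11]
      field_simp
    have h3 : L = M * A * U * A⁻¹ := by rw [hU]; group
    simp only [h1]
    rw [h3, indMap_mul, indMap_mul (M * A), h2, ← indMap_mul, ← indMap_mul]

end Sharp

end ProjectiveLine

/-- **Stability of intersecting families in `PGL(2,q)`.**
An intersecting family in `PGL(2,q)` of size at least `q²/√2 + 2√2·q + 8` lies in a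
coset of the stabiliser of a point of `ℙ¹`. -/
theorem stmt_3 (q : ℕ) (hq : IsPrimePow q)
    (F : Type) [Field F] [Fintype F] (hF : Fintype.card F = q)
    (𝒻 : Set (Projectivization F (Fin 2 → F) → Projectivization F (Fin 2 → F)))
    (h𝒻 : 𝒻 ⊆ pglMaps F)
    (hint : ∀ f ∈ 𝒻, ∀ g ∈ 𝒻, ∃ x, f x = g x)
    (hsize : (1 / Real.sqrt 2) * (q : ℝ) ^ 2 + 2 * Real.sqrt 2 * (q : ℝ) + 8 ≤ (𝒻.ncard : ℝ)) :
    ∃ P Q : Projectivization F (Fin 2 → F), ∀ f ∈ 𝒻, f P = Q := by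
  classical
  subst hF
  have : Fintype (Projectivization F (Fin 2 → F)) := Fintype.ofFinite _
  have hG : ∀ f, f ∈ (pglMaps F).toFinset ↔ f ∈ pglMaps F := fun f => Set.mem_toFinset
  obtain ⟨p, b, h⟩ := (isSharp_pgl hG).exists_common_value sqrtBound_le_two
    (sum_pencil_tangency_le hG) detClass (detClass_eq_of_tangency hG)
    (sqrtBound_mul_card_class_le hG) (s := 𝒻.toFinset)
    (fun f hf => (hG f).2 (h𝒻 (Set.mem_toFinset.1 hf)))
    (fun f hf g hg => hint f (Set.mem_toFinset.1 hf) g (Set.mem_toFinset.1 hg))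
    (by rwa [← Set.ncard_eq_toFinset_card'])
  exact ⟨p, b, fun f hf => h f (Set.mem_toFinset.2 hf)⟩
end
end

section
/- Let q be an odd prime power and F a finite field with |F| = q. Let 𝒻 be a set of polynomials over F of degree at most 2 such that for all f, g ∈ 𝒻, either there exists x ∈ F with f(x) = g(x), or f and g have the same coefficient of X². If |𝒻| ≥ (1/√2)·q² + 2√2·q + 8 (as real numbers), then either there exist x, y ∈ F with f(x) = y for every f ∈ 𝒻, or there exists a ∈ F such that every f ∈ 𝒻 has coefficient of X² equal to a. -/
open Finset

section QuadraticFamilies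

variable {F : Type*} [Field F] [Fintype F]

open Classical in
/-- The nonsquares of a finite field. -/
noncomputable def nonsquares (F : Type*) [Field F] [Fintype F] : Finset F :=
  {a | ¬ IsSquare a}

lemma mem_nonsquares {a : F} : a ∈ nonsquares F ↔ ¬ IsSquare a := by
  simp [nonsquares]

lemma two_mul_card_nonsquares_add_one (hF : ringChar F ≠ 2) :
    2 * #(nonsquares F) + 1 = Fintype.card F := by
  classical
  have h := quadraticChar_sum_zero hF
  have key : ∀ a : F, quadraticChar F a =
      1 - (if a = 0 then 1 else 0) - 2 * (if ¬ IsSquare a then 1 else 0) := by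
    intro a
    by_cases ha : a = 0
    · simp [ha]
    · by_cases hs : IsSquare a
      · simp [ha, hs, (quadraticChar_one_iff_isSquare ha).2 hs]
      · simp [ha, hs, quadraticChar_neg_one_iff_not_isSquare.2 hs]
  simp_rw [key, Finset.sum_sub_distrib, ← Finset.mul_sum] at h
  rw [← Finset.sum_filter, ← Finset.sum_filter] at h
  have h1 : #{a : F | a = 0} = 1 := Finset.card_eq_one.2 ⟨0, by ext; simp⟩
  simp only [sum_const, card_univ, nsmul_eq_mul, mul_one, h1] at h
  have h2 : #(nonsquares F) = #{a : F | ¬ IsSquare a} := by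
    unfold nonsquares; congr
  zify
  rw [h2]
  push_cast at h ⊢
  linarith

open Classical in
/-- If `b² - 4ac` is a square, the number of zeros in the projective line of `(a, b, c)` is
bounded below in terms of the number of solutions of `aβ² + bβ + c = na`, `n` a nonsquare. -/
lemma card_zeros_lower_bound (hF : ringChar F ≠ 2) (a b c : F)
    (hsq : IsSquare (b ^ 2 - 4 * a * c)) :
    #(nonsquares F) + #{p ∈ (univ : Finset F) ×ˢ nonsquares F |
        a * p.1 ^ 2 + b * p.1 + c = p.2 * a} ≤
      #(nonsquares F) * (#{x : F | a * x ^ 2 + b * x + c = 0} + if a = 0 then 1 else 0) := by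
  have h2 : (2 : F) ≠ 0 := Ring.two_ne_zero hF
  have hq := two_mul_card_nonsquares_add_one hF
  by_cases ha : a = 0
  · subst ha
    by_cases hb : b = 0
    · subst hb
      by_cases hc : c = 0
      · subst hc
        simp only [zero_mul, add_zero, mul_zero, Finset.filter_true, card_product, card_univ, if_true]
        rw [mul_add, mul_one, mul_comm (Fintype.card F), add_comm]
      · simp [hc]
    · have e1 : #{p ∈ (univ : Finset F) ×ˢ nonsquares F |
          0 * p.1 ^ 2 + b * p.1 + c = p.2 * 0} ≤ #(nonsquares F) := by
        apply card_le_card_of_injOn Prod.snd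
        · rintro p hp
          simp only [coe_filter, mem_product, mem_univ, true_and, Set.mem_ofPred_eq] at hp
          exact hp.1
        · rintro ⟨p, n⟩ hp ⟨p', n'⟩ hp' h
          simp only [coe_filter, mem_product, mem_univ, true_and, Set.mem_ofPred_eq] at hp hp' h
          have : b * p = b * p' := by linear_combination hp.2 - hp'.2
          rw [mul_left_cancel₀ hb this, h]
      have e2 : 1 ≤ #{x : F | 0 * x ^ 2 + b * x + c = 0} := by
        apply Finset.card_pos.2
        refine ⟨-c / b, ?_⟩
        simp only [mem_filter, mem_univ, true_and]
        field_simp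
        ring
      simp only [if_true]
      nlinarith
  · obtain ⟨δ, hδ⟩ := hsq
    simp only [ha, if_false, add_zero]
    obtain ⟨u, v, hb, hc⟩ : ∃ u v, b = -a * (u + v) ∧ c = a * (u * v) := by
      refine ⟨(-b + δ) / (2 * a), (-b - δ) / (2 * a), ?_, ?_⟩
      · field_simp; ring
      · field_simp; linear_combination -hδ
    have hfac : ∀ x, a * x ^ 2 + b * x + c = a * ((x - u) * (x - v)) := by
      intro x; rw [hb, hc]; ring
    simp_rw [hfac]
    by_cases huv : u = v
    · subst huv
      have e1 : #{p ∈ (univ : Finset F) ×ˢ nonsquares F |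
          a * ((p.1 - u) * (p.1 - u)) = p.2 * a} = 0 := by
        rw [Finset.card_eq_zero, Finset.filter_eq_empty_iff]
        rintro ⟨x, n⟩ hp h
        simp only [mem_product, mem_univ, true_and, mem_nonsquares] at hp h
        apply hp
        refine ⟨x - u, mul_left_cancel₀ ha ?_⟩
        rw [h, mul_comm]
      have e2 : 1 ≤ #{x : F | a * ((x - u) * (x - u)) = 0} :=
        Finset.card_pos.2 ⟨u, by simp⟩
      nlinarith
    · have e1 : #{p ∈ (univ : Finset F) ×ˢ nonsquares F |
          a * ((p.1 - u) * (p.1 - v)) = p.2 * a} ≤ #(nonsquares F) := by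
        have aux : ∀ x n, ¬ IsSquare n → a * ((x - u) * (x - v)) = n * a →
            n = (x - u) * (x - v) ∧ x - v ≠ 0 := by
          intro x n hn h
          have h' : n = (x - u) * (x - v) := by
            apply mul_left_cancel₀ ha; rw [h, mul_comm]
          refine ⟨h', fun h0 => hn ?_⟩
          rw [h', h0, mul_zero]; exact IsSquare.zero
        apply card_le_card_of_injOn (fun p => (p.1 - u) / (p.1 - v))
        · rintro ⟨x, n⟩ hp
          simp only [coe_filter, mem_product, mem_univ, true_and, Set.mem_ofPred_eq,
            mem_nonsquares, mem_coe] at hp ⊢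
          obtain ⟨h1, h3⟩ := aux x n hp.1 hp.2
          rintro ⟨w, hw⟩
          apply hp.1
          refine ⟨w * (x - v), ?_⟩
          rw [div_eq_iff h3] at hw
          rw [h1, hw]; ring
        · rintro ⟨x, n⟩ hp ⟨x', n'⟩ hp' h
          simp only [coe_filter, mem_product, mem_univ, true_and, Set.mem_ofPred_eq,
            mem_nonsquares] at hp hp' h
          obtain ⟨h1, h3⟩ := aux x n hp.1 hp.2
          obtain ⟨h1', h3'⟩ := aux x' n' hp'.1 hp'.2
          rw [div_eq_div_iff h3 h3'] at h
          have : (u - v) * x = (u - v) * x' := by linear_combination h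
          have hx := mul_left_cancel₀ (sub_ne_zero.2 huv) this
          subst hx
          rw [h1, h1']
      have e2 : 2 ≤ #{x : F | a * ((x - u) * (x - v)) = 0} := by
        rw [← Finset.card_pair huv]
        apply Finset.card_le_card
        intro x
        simp only [mem_insert, mem_singleton, mem_filter, mem_univ, true_and]
        rintro (rfl | rfl) <;> simp
      nlinarith

open Classical in
lemma card_sq_le_card_mul_sum_card_fiber {ι κ : Type*} [Fintype κ] (S : Finset ι) (φ : ι → κ) :
    #S ^ 2 ≤ Fintype.card κ * ∑ f ∈ S, #{g ∈ S | φ f = φ g} := by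
  have h1 : ∑ f ∈ S, #{g ∈ S | φ f = φ g} = ∑ y : κ, #{g ∈ S | φ g = y} ^ 2 := by
    rw [← Finset.sum_fiberwise (s := S) (g := φ)]
    refine Finset.sum_congr rfl fun y _ => ?_
    rw [sq, ← smul_eq_mul, ← Finset.sum_const]
    refine Finset.sum_congr rfl fun f hf => ?_
    rw [mem_filter] at hf
    simp only [hf.2, eq_comm]
  rw [h1, Finset.card_eq_sum_card_fiberwise (f := φ) (t := univ) (by simp)]
  exact sq_sum_le_card_mul_sum_sq

open Classical in
/-- Two-point counting of the nonsquare relation between the points `(b, c)` of a plane and the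
points `(t, B, C)` off it. -/
lemma card_common_nonsquare_le (hF : ringChar F ≠ 2) {R R' : F × F} (hR : R ≠ R') :
    #{P : F × F × F | P.1 ≠ 0 ∧
        (P.2.1 - R.1) ^ 2 - 4 * P.1 * (P.2.2 - R.2) ∈ nonsquares F ∧
        (P.2.1 - R'.1) ^ 2 - 4 * P.1 * (P.2.2 - R'.2) ∈ nonsquares F} ≤
      2 * #(nonsquares F) ^ 3 := by
  have h2 : (2 : F) ≠ 0 := Ring.two_ne_zero hF
  have h4 : (4 : F) ≠ 0 := by
    have : (4 : F) = 2 * 2 := by norm_num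
    rw [this]; exact mul_ne_zero h2 h2
  have hq := two_mul_card_nonsquares_add_one hF
  obtain ⟨b, c⟩ := R
  obtain ⟨b', c'⟩ := R'
  by_cases hb : b = b'
  · subst hb
    have hc : c - c' ≠ 0 := by
      intro h; apply hR; rw [sub_eq_zero.1 h]
    have : Fintype.card F * (#(nonsquares F) * #(nonsquares F) - #(nonsquares F)) ≤
        2 * #(nonsquares F) ^ 3 := by
      rw [← hq]
      generalize #(nonsquares F) = h
      obtain _ | h := h
      · simp
      · have : (h + 1) * (h + 1) - (h + 1) = (h + 1) * h := by
          rw [Nat.sub_eq_iff_eq_add (by nlinarith)]; ring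
        rw [this]
        nlinarith
    refine le_trans ?_ this
    rw [← Finset.offDiag_card, ← Finset.card_univ, ← Finset.card_product]
    apply card_le_card_of_injOn (fun P => (P.2.1, (P.2.1 - b) ^ 2 - 4 * P.1 * (P.2.2 - c),
      (P.2.1 - b) ^ 2 - 4 * P.1 * (P.2.2 - c')))
    · rintro ⟨t, B, C⟩ hP
      simp only [coe_filter, mem_univ, true_and, Set.mem_ofPred_eq] at hP
      simp only [mem_coe, mem_product, mem_univ, true_and, mem_offDiag]
      refine ⟨hP.2.1, hP.2.2, fun h => ?_⟩
      have : (4 * t) * (c - c') = 0 := by linear_combination h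
      exact mul_ne_zero (mul_ne_zero h4 hP.1) hc this
    · rintro ⟨t, B, C⟩ hP ⟨t', B', C'⟩ hP' h
      simp only [coe_filter, mem_univ, true_and, Set.mem_ofPred_eq] at hP
      simp only [Prod.mk.injEq] at h
      obtain ⟨rfl, h3, h5⟩ := h
      have ht : (4 * (c - c')) * t = (4 * (c - c')) * t' := by linear_combination h3 - h5
      have ht := mul_left_cancel₀ (mul_ne_zero h4 hc) ht
      subst ht
      have hC : (4 * t) * C = (4 * t) * C' := by linear_combination -h3
      rw [mul_left_cancel₀ (mul_ne_zero h4 hP.1) hC]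
  · have : #({0}ᶜ ×ˢ nonsquares F ×ˢ nonsquares F : Finset (F × F × F)) =
        2 * #(nonsquares F) ^ 3 := by
      rw [card_product, card_product, card_compl, card_singleton, ← hq, Nat.add_sub_cancel]
      ring
    rw [← this]
    apply card_le_card_of_injOn (fun P => (P.1, (P.2.1 - b) ^ 2 - 4 * P.1 * (P.2.2 - c),
      (P.2.1 - b') ^ 2 - 4 * P.1 * (P.2.2 - c')))
    · rintro ⟨t, B, C⟩ hP
      simpa using hP
    · rintro ⟨t, B, C⟩ hP ⟨t', B', C'⟩ hP' h
      simp only [coe_filter, mem_univ, true_and, Set.mem_ofPred_eq] at hP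
      simp only [Prod.mk.injEq] at h
      obtain ⟨rfl, h3, h5⟩ := h
      have hB : (2 * (b - b')) * B = (2 * (b - b')) * B' := by linear_combination h5 - h3
      have hB := mul_left_cancel₀ (mul_ne_zero h2 (sub_ne_zero.2 hb)) hB
      subst hB
      have hC : (4 * t) * C = (4 * t) * C' := by linear_combination -h3
      rw [mul_left_cancel₀ (mul_ne_zero h4 hP.1) hC]

open Classical in
lemma card_nonsquare_neighbours (hF : ringChar F ≠ 2) (R : F × F) :
    #{P : F × F × F | P.1 ≠ 0 ∧
        (P.2.1 - R.1) ^ 2 - 4 * P.1 * (P.2.2 - R.2) ∈ nonsquares F} =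
      2 * Fintype.card F * #(nonsquares F) ^ 2 := by
  have h2 : (2 : F) ≠ 0 := Ring.two_ne_zero hF
  have h4 : (4 : F) ≠ 0 := by
    have : (4 : F) = 2 * 2 := by norm_num
    rw [this]; exact mul_ne_zero h2 h2
  have hq := two_mul_card_nonsquares_add_one hF
  obtain ⟨b, c⟩ := R
  have : #({0}ᶜ ×ˢ univ ×ˢ nonsquares F : Finset (F × F × F)) =
      2 * Fintype.card F * #(nonsquares F) ^ 2 := by
    rw [card_product, card_product, card_compl, card_singleton, card_univ,
      Nat.sub_eq_of_eq_add hq.symm]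
    ring
  rw [← this]
  apply Finset.card_nbij' (fun P => (P.1, P.2.1, (P.2.1 - b) ^ 2 - 4 * P.1 * (P.2.2 - c)))
    (fun P => (P.1, P.2.1, c + ((P.2.1 - b) ^ 2 - P.2.2) / (4 * P.1)))
  · rintro ⟨t, B, C⟩ hP
    simpa using hP
  · rintro ⟨t, B, u⟩ hP
    simp only [coe_product, coe_compl, coe_singleton, Set.mem_prod, Set.mem_compl_iff,
      Set.mem_singleton_iff, coe_univ, Set.mem_univ, true_and, mem_coe] at hP
    simp only [coe_filter, mem_univ, true_and, Set.mem_ofPred_eq]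
    refine ⟨hP.1, ?_⟩
    convert hP.2 using 1
    have := hP.1
    field_simp
    ring
  · rintro ⟨t, B, C⟩ hP
    simp only [coe_filter, mem_univ, true_and, Set.mem_ofPred_eq] at hP
    have := hP.1
    simp only [Prod.mk.injEq, true_and]
    field_simp
    ring
  · rintro ⟨t, B, u⟩ hP
    simp only [coe_product, coe_compl, coe_singleton, Set.mem_prod, Set.mem_compl_iff,
      Set.mem_singleton_iff, coe_univ, Set.mem_univ, true_and, mem_coe] at hP
    have := hP.1
    simp only [Prod.mk.injEq, true_and]
    field_simp
    ring

open Classical in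
/-- A set `M` of points of a plane and a set `T` of points off it, with no nonsquare
relation between them, cannot both be large. -/
lemma card_mul_card_le_of_isSquare (hF : ringChar F ≠ 2) (M : Finset (F × F))
    (T : Finset (F × F × F)) (hT : ∀ P ∈ T, P.1 ≠ 0)
    (h : ∀ P ∈ T, ∀ R ∈ M, IsSquare ((P.2.1 - R.1) ^ 2 - 4 * P.1 * (P.2.2 - R.2))) :
    #T * #M ≤ Fintype.card F ^ 2 * (Fintype.card F + 1) := by
  have hq := two_mul_card_nonsquares_add_one hF
  set U : Finset (F × F × F) := {P | P.1 ≠ 0} with hU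
  have hUc : #U = 2 * #(nonsquares F) * Fintype.card F ^ 2 := by
    have : U = ({0}ᶜ ×ˢ univ ×ˢ univ : Finset (F × F × F)) := by
      ext ⟨t, B, C⟩; simp [hU]
    rw [this, card_product, card_product, card_compl, card_singleton, card_univ,
      Nat.sub_eq_of_eq_add hq.symm]
    ring
  have hTU : T ⊆ U := fun P hP => by simpa [hU] using hT P hP
  set N : F × F × F → F × F → Prop :=
    fun P R => (P.2.1 - R.1) ^ 2 - 4 * P.1 * (P.2.2 - R.2) ∈ nonsquares F with hN
  have hdeg : ∀ R, #{P ∈ U | N P R} = 2 * Fintype.card F * #(nonsquares F) ^ 2 := by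
    intro R
    rw [← card_nonsquare_neighbours hF R, hU, Finset.filter_filter]
  have hco : ∀ R R', R ≠ R' → #{P ∈ U | N P R ∧ N P R'} ≤ 2 * #(nonsquares F) ^ 3 := by
    intro R R' hR
    refine le_trans (le_of_eq ?_) (card_common_nonsquare_le hF hR)
    rw [hU, Finset.filter_filter]
  have hzero : ∀ P ∈ T, #{R ∈ M | N P R} = 0 := by
    intro P hP
    rw [Finset.card_eq_zero, Finset.filter_eq_empty_iff]
    intro R hR hn
    exact mem_nonsquares.1 hn (h P hP R hR)
  have first : ∑ P ∈ U \ T, #{R ∈ M | N P R} =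
      #M * (2 * Fintype.card F * #(nonsquares F) ^ 2) := by
    have : ∑ P ∈ U, #{R ∈ M | N P R} = #M * (2 * Fintype.card F * #(nonsquares F) ^ 2) := by
      simp_rw [Finset.card_filter]
      rw [Finset.sum_comm]
      rw [← smul_eq_mul, ← Finset.sum_const]
      refine Finset.sum_congr rfl fun R _ => ?_
      rw [← Finset.card_filter, hdeg]
    rw [← this, ← Finset.sum_sdiff hTU, Finset.sum_eq_zero hzero, add_zero]
  have second : ∑ P ∈ U \ T, #{R ∈ M | N P R} ^ 2 ≤
      #M * (2 * Fintype.card F * #(nonsquares F) ^ 2) +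
        (#M * #M - #M) * (2 * #(nonsquares F) ^ 3) := by
    have e : ∀ P, #{R ∈ M | N P R} ^ 2 =
        ∑ x ∈ M ×ˢ M, if N P x.1 ∧ N P x.2 then 1 else 0 := by
      intro P
      rw [sq, ← Finset.card_product, ← Finset.filter_product, Finset.card_filter]
    calc ∑ P ∈ U \ T, #{R ∈ M | N P R} ^ 2 ≤ ∑ P ∈ U, #{R ∈ M | N P R} ^ 2 :=
          Finset.sum_le_sum_of_subset Finset.sdiff_subset
      _ = ∑ x ∈ M ×ˢ M, #{P ∈ U | N P x.1 ∧ N P x.2} := by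
          simp_rw [e]
          rw [Finset.sum_comm]
          exact Finset.sum_congr rfl fun x _ => (Finset.card_filter _ _).symm
      _ = ∑ x ∈ M.diag, #{P ∈ U | N P x.1 ∧ N P x.2} +
            ∑ x ∈ M.offDiag, #{P ∈ U | N P x.1 ∧ N P x.2} := by
          rw [← Finset.diag_union_offDiag, Finset.sum_union (Finset.disjoint_diag_offDiag M)]
      _ ≤ _ := by
          apply add_le_add
          · rw [Finset.sum_diag]
            simp_rw [and_self, hdeg]
            simp
          · rw [← Finset.offDiag_card, ← smul_eq_mul]
            apply Finset.sum_le_card_nsmul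
            intro x hx
            exact hco _ _ (Finset.mem_offDiag.1 hx).2.2
  have cs := sq_sum_le_card_mul_sum_sq (s := U \ T) (f := fun P => #{R ∈ M | N P R})
  rw [first] at cs
  have hcard : #(U \ T) + #T = #U := Finset.card_sdiff_add_card_eq_card hTU
  rw [hUc] at hcard
  have cs := cs.trans (Nat.mul_le_mul_left _ second)
  generalize hm : #M = m at *
  rcases Nat.eq_zero_or_pos m with rfl | hmpos
  · simp
  obtain ⟨k, rfl⟩ : ∃ k, m = k + 1 := ⟨m - 1, by omega⟩
  have hk : (k + 1) * (k + 1) - (k + 1) = (k + 1) * k := by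
    rw [Nat.sub_eq_iff_eq_add (by nlinarith)]; ring
  rw [hk] at cs
  generalize hh : #(nonsquares F) = n at *
  have hn : 0 < n := by
    have := Fintype.one_lt_card (α := F)
    omega
  generalize Fintype.card F = q at *
  generalize #T = r at *
  generalize #(U \ T) = w at *
  zify at *
  have c1 : (2 * (k + 1) * n ^ 2 : ℤ) * (2 * (k + 1) * q ^ 2 * n ^ 2) ≤
      (2 * (k + 1) * n ^ 2) * (w * (q + k * n)) := by
    linarith [cs]
  have c2 := le_of_mul_le_mul_left c1 (by positivity)
  have hw : (w : ℤ) = 2 * n * q ^ 2 - r := by linarith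
  rw [hw] at c2
  have c3 : (n : ℤ) * (r * (k + 1)) ≤ n * (q ^ 2 * (q + 1)) := by
    have : (0 : ℤ) ≤ r * (q - n) := by
      apply mul_nonneg (by positivity); linarith
    have e : (q : ℤ) + 1 = 2 * n + 2 := by linarith
    have e2 : (q : ℤ) ^ 2 * (n * q) = q ^ 2 * (n * (2 * n + 1)) := by rw [hq]
    rw [e]
    nlinarith
  exact le_of_mul_le_mul_left c3 (by positivity)

open Classical in
/-- In a family of quadratics whose differences all have square discriminant, some value, at a
point of `F` or at infinity, is taken by at least `2 / (q + 1)` of the members. -/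
lemma exists_large_fiber (hF : ringChar F ≠ 2) (S : Finset (F × F × F)) (hS : S.Nonempty)
    (h : ∀ f ∈ S, ∀ g ∈ S,
      IsSquare ((f.2.1 - g.2.1) ^ 2 - 4 * (f.1 - g.1) * (f.2.2 - g.2.2))) :
    ∃ f ∈ S,
      (∃ x : F, 2 * #S ≤ (Fintype.card F + 1) * #{g ∈ S |
        f.1 * x ^ 2 + f.2.1 * x + f.2.2 = g.1 * x ^ 2 + g.2.1 * x + g.2.2}) ∨
      2 * #S ≤ (Fintype.card F + 1) * #{g ∈ S | f.1 = g.1} := by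
  set φ : F → F × F × F → F := fun x f => f.1 * x ^ 2 + f.2.1 * x + f.2.2 with hφ
  set ψ : F × F → F × F × F → F := fun p f => φ p.1 f - p.2 * f.1 with hψ
  set n := #(nonsquares F) with hn
  have hq := two_mul_card_nonsquares_add_one hF
  have hnpos : 0 < n := by
    have := Fintype.one_lt_card (α := F)
    omega
  have pair : ∀ f ∈ S, ∀ g ∈ S,
      n + #{p ∈ (univ : Finset F) ×ˢ nonsquares F | ψ p f = ψ p g} ≤
        n * (#{x : F | φ x f = φ x g} + if f.1 = g.1 then 1 else 0) := by
    intro f hf g hg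
    convert card_zeros_lower_bound hF _ _ _ (h f hf g hg) using 3
    · refine Finset.filter_congr fun p _ => ?_
      rw [← sub_eq_zero, ← sub_eq_zero (b := p.2 * (f.1 - g.1))]
      simp only [hψ, hφ]
      ring_nf
    · refine congrArg Finset.card (Finset.filter_congr fun x _ => ?_)
      rw [← sub_eq_zero]
      simp only [hφ]
      ring_nf
    · simp [sub_eq_zero]
  have swap : ∀ {κ : Type _} (A : Finset κ) (χ : κ → F × F × F → F) (f : F × F × F),
      ∑ g ∈ S, #{x ∈ A | χ x f = χ x g} = ∑ x ∈ A, #{g ∈ S | χ x f = χ x g} := by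
    intro κ A χ f
    simp_rw [Finset.card_filter]
    exact Finset.sum_comm
  have hext : n * #S ^ 2 ≤
      ∑ f ∈ S, ∑ g ∈ S, #{p ∈ (univ : Finset F) ×ˢ nonsquares F | ψ p f = ψ p g} := by
    rw [Finset.sum_congr rfl fun f _ => swap _ ψ f, Finset.sum_comm]
    have : 0 < Fintype.card F := Fintype.card_pos
    refine le_of_mul_le_mul_left ?_ this
    rw [Finset.mul_sum]
    calc Fintype.card F * (n * #S ^ 2)
        = ∑ p ∈ (univ : Finset F) ×ˢ nonsquares F, #S ^ 2 := by
          rw [Finset.sum_const, card_product, card_univ, smul_eq_mul, mul_assoc]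
      _ ≤ _ := Finset.sum_le_sum fun p _ => card_sq_le_card_mul_sum_card_fiber S (ψ p)
  have htot : ∑ f ∈ S, 2 * #S ≤
      ∑ f ∈ S, (∑ x : F, #{g ∈ S | φ x f = φ x g} + #{g ∈ S | f.1 = g.1}) := by
    have h1 := Finset.sum_le_sum fun f hf => Finset.sum_le_sum fun g hg => pair f hf g hg
    have h2 : ∀ f, ∑ g ∈ S, (#{x : F | φ x f = φ x g} + if f.1 = g.1 then 1 else 0) =
        ∑ x : F, #{g ∈ S | φ x f = φ x g} + #{g ∈ S | f.1 = g.1} := by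
      intro f
      rw [Finset.sum_add_distrib, swap univ φ f, Finset.card_filter]
    simp only [Finset.sum_add_distrib (f := fun _ => n), ← Finset.mul_sum, h2, Finset.sum_const,
      smul_eq_mul] at h1
    rw [Finset.sum_add_distrib, Finset.sum_const, smul_eq_mul] at h1
    rw [Finset.sum_const, smul_eq_mul]
    refine le_of_mul_le_mul_left ?_ hnpos
    nlinarith
  obtain ⟨f, hf, hle⟩ := Finset.exists_le_of_sum_le hS htot
  refine ⟨f, hf, ?_⟩
  by_contra! hcon
  obtain ⟨h1, h2⟩ := hcon
  have h3 : ∑ x : F, (Fintype.card F + 1) * #{g ∈ S | φ x f = φ x g} ≤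
      ∑ x : F, 2 * #S := Finset.sum_le_sum fun x _ => (h1 x).le
  rw [← Finset.mul_sum, Finset.sum_const, card_univ, smul_eq_mul] at h3
  nlinarith [Nat.mul_le_mul_left (Fintype.card F + 1) hle]

lemma not_large_of_plane_bounds {q r m s : ℕ} (hq : 3 ≤ q) (hs : r + m = s)
    (hlow : 2 * s ≤ (q + 1) * m) (hup : 2 * m ≤ q * (q + 1)) (hrm : r * m ≤ q ^ 2 * (q + 1))
    (hbig : (q ^ 2 + 4 * q + 11) ^ 2 ≤ 2 * s ^ 2) : False := by
  have h3 : 2 * (q ^ 2 + 4 * q + 11) ≤ 3 * s := by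
    by_contra! hc
    nlinarith [Nat.mul_self_lt_mul_self hc]
  zify at *
  have hr : (r : ℤ) = s - m := by linarith
  rw [hr] at hrm
  have hK : (0 : ℤ) ≤ 2 * (q - 1) * s - (q + 1) ^ 2 * q := by
    have e1 : 2 * ((q : ℤ) - 1) * (2 * (q ^ 2 + 4 * q + 11)) ≤ 2 * ((q : ℤ) - 1) * (3 * s) :=
      mul_le_mul_of_nonneg_left h3 (by linarith)
    nlinarith [pow_pos (show (0 : ℤ) < q by linarith) 3, sq_nonneg (q : ℤ)]
  have hmK : (m : ℤ) * (2 * (q - 1) * s - (q + 1) ^ 2 * q) ≤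
      2 * q ^ 2 * (q + 1) ^ 2 - 2 * s * q * (q + 1) := by
    have e1 : (0 : ℤ) ≤ ((q + 1) * m - 2 * s) * (q * (q + 1) - 2 * m) :=
      mul_nonneg (by linarith) (by linarith)
    have e2 : ((q : ℤ) + 1) * ((s - m) * m) ≤ (q + 1) * (q ^ 2 * (q + 1)) :=
      mul_le_mul_of_nonneg_left hrm (by linarith)
    linarith
  have hsK : 2 * (s : ℤ) * (2 * (q - 1) * s - (q + 1) ^ 2 * q) ≤
      (q + 1) * (2 * q ^ 2 * (q + 1) ^ 2 - 2 * s * q * (q + 1)) := by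
    have e1 := mul_le_mul_of_nonneg_right hlow hK
    have e2 := mul_le_mul_of_nonneg_left hmK (show (0 : ℤ) ≤ q + 1 by linarith)
    linarith
  have hfin : ((q : ℤ) - 1) * (2 * s ^ 2) ≤ q ^ 2 * (q + 1) ^ 3 := by linarith
  have hfin2 := mul_le_mul_of_nonneg_left hbig (show (0 : ℤ) ≤ q - 1 by linarith)
  have : (0 : ℤ) ≤ q ^ 4 := by positivity
  have : (0 : ℤ) ≤ q ^ 3 := by positivity
  nlinarith

open Classical in
/-- A large family of quadratics whose differences all have square discriminant, and for which
sufficiently many members have leading coefficient `y`, has all leading coefficients `y`. -/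
lemma forall_fst_eq_of_large_fiber (hF : ringChar F ≠ 2) (S : Finset (F × F × F)) (y : F)
    (h : ∀ f ∈ S, ∀ g ∈ S,
      IsSquare ((f.2.1 - g.2.1) ^ 2 - 4 * (f.1 - g.1) * (f.2.2 - g.2.2)))
    (hbig : (Fintype.card F ^ 2 + 4 * Fintype.card F + 11) ^ 2 ≤ 2 * #S ^ 2)
    (hy : 2 * #S ≤ (Fintype.card F + 1) * #{g ∈ S | y = g.1}) :
    ∀ f ∈ S, f.1 = y := by
  by_contra! hcon
  obtain ⟨⟨a, B, C⟩, hP, hPy⟩ := hcon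
  have h2 : (2 : F) ≠ 0 := Ring.two_ne_zero hF
  have h4 : (4 : F) ≠ 0 := by
    have : (4 : F) = 2 * 2 := by norm_num
    rw [this]; exact mul_ne_zero h2 h2
  have hay : a - y ≠ 0 := sub_ne_zero.2 hPy
  have hq := two_mul_card_nonsquares_add_one hF
  have hcard : 3 ≤ Fintype.card F := by
    have := Fintype.one_lt_card (α := F)
    omega
  set M₀ : Finset (F × F × F) := {g ∈ S | y = g.1} with hM₀
  set T₀ : Finset (F × F × F) := {g ∈ S | ¬ y = g.1} with hT₀
  have hsum : #T₀ + #M₀ = #S := by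
    rw [add_comm]; exact Finset.card_filter_add_card_filter_not _
  have hM : #(M₀.image Prod.snd) = #M₀ := by
    apply Finset.card_image_of_injOn
    rintro f hf g hg hfg
    simp only [hM₀, mem_coe, mem_filter] at hf hg
    exact Prod.ext (hf.2.symm.trans hg.2) hfg
  have hT : #(T₀.image fun f => (f.1 - y, f.2)) = #T₀ := by
    apply Finset.card_image_of_injective
    intro f g hfg
    simp only [Prod.mk.injEq, sub_left_inj] at hfg
    exact Prod.ext hfg.1 hfg.2
  have hprod := card_mul_card_le_of_isSquare hF (M₀.image Prod.snd)
    (T₀.image fun f => (f.1 - y, f.2)) (by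
      simp only [mem_image]
      rintro _ ⟨f, hf, rfl⟩
      rw [hT₀, mem_filter] at hf
      exact sub_ne_zero.2 (Ne.symm hf.2)) (by
      simp only [mem_image]
      rintro _ ⟨f, hf, rfl⟩ _ ⟨g, hg, rfl⟩
      rw [hT₀, mem_filter] at hf
      rw [hM₀, mem_filter] at hg
      have := h f hf.1 g hg.1
      rwa [← hg.2] at this)
  rw [hM, hT] at hprod
  have hup : #M₀ ≤ Fintype.card F * (#(nonsquares F) + 1) := by
    have hc : #((univ : Finset F) ×ˢ (nonsquares F)ᶜ) =
        Fintype.card F * (#(nonsquares F) + 1) := by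
      rw [card_product, card_univ, card_compl,
        Nat.sub_eq_of_eq_add (b := #(nonsquares F)) (c := #(nonsquares F) + 1) (by omega)]
    rw [← hc]
    apply card_le_card_of_injOn
      (fun g => (g.2.1, (B - g.2.1) ^ 2 - 4 * (a - g.1) * (C - g.2.2)))
    · intro g hg
      simp only [hM₀, mem_coe, mem_filter] at hg
      simpa [mem_nonsquares] using h _ hP g hg.1
    · rintro ⟨a₁, b₁, c₁⟩ hf ⟨a₂, b₂, c₂⟩ hg hfg
      simp only [hM₀, mem_coe, mem_filter] at hf hg
      obtain ⟨-, rfl⟩ := hf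
      obtain ⟨-, rfl⟩ := hg
      simp only [Prod.mk.injEq] at hfg
      obtain ⟨rfl, h3⟩ := hfg
      have hc : (4 * (a - y)) * c₁ = (4 * (a - y)) * c₂ := by linear_combination h3
      rw [mul_left_cancel₀ (mul_ne_zero h4 hay) hc]
  refine not_large_of_plane_bounds hcard hsum hy ?_ hprod hbig
  have e : Fintype.card F + 1 = 2 * (#(nonsquares F) + 1) := by omega
  rw [e]
  linarith

open Classical in
/-- Stability for large families of quadratics, given by coefficients, whose differences all have
square discriminant. -/
lemma common_value_or_common_leadingCoeff (hF : ringChar F ≠ 2) (S : Finset (F × F × F))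
    (h : ∀ f ∈ S, ∀ g ∈ S,
      IsSquare ((f.2.1 - g.2.1) ^ 2 - 4 * (f.1 - g.1) * (f.2.2 - g.2.2)))
    (hbig : (Fintype.card F ^ 2 + 4 * Fintype.card F + 11) ^ 2 ≤ 2 * #S ^ 2) :
    (∃ x y : F, ∀ f ∈ S, f.1 * x ^ 2 + f.2.1 * x + f.2.2 = y) ∨ ∃ a : F, ∀ f ∈ S, f.1 = a := by
  have hS : S.Nonempty := by
    rw [Finset.nonempty_iff_ne_empty]
    rintro rfl
    simp at hbig
  obtain ⟨f, -, ⟨x, hx⟩ | hinf⟩ := exists_large_fiber hF S hS h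
  · left
    refine ⟨x, f.1 * x ^ 2 + f.2.1 * x + f.2.2, ?_⟩
    set L : F × F × F → F × F × F :=
      fun g => (g.1 * x ^ 2 + g.2.1 * x + g.2.2, g.2.1 + 2 * g.1 * x, g.1) with hL
    have hLinj : Function.Injective L := by
      rintro ⟨a, b, c⟩ ⟨a', b', c'⟩ hg
      simp only [hL, Prod.mk.injEq] at hg
      obtain ⟨h1, h2, rfl⟩ := hg
      obtain rfl : b = b' := add_right_cancel h2
      rw [add_left_cancel h1]
    have hcardL : #(S.image L) = #S := Finset.card_image_of_injective _ hLinj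
    have key := forall_fst_eq_of_large_fiber hF (S.image L) (f.1 * x ^ 2 + f.2.1 * x + f.2.2)
      (by
        simp only [mem_image]
        rintro _ ⟨g, hg, rfl⟩ _ ⟨g', hg', rfl⟩
        convert h g hg g' hg' using 1
        simp only [hL]
        ring)
      (by rwa [hcardL])
      (by
        rw [hcardL, Finset.filter_image, Finset.card_image_of_injective _ hLinj]
        exact hx)
    intro g hg
    exact key (L g) (Finset.mem_image_of_mem L hg)
  · exact Or.inr ⟨f.1, forall_fst_eq_of_large_fiber hF S f.1 h hbig hinf⟩

end QuadraticFamilies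

lemma Polynomial.eval_eq_of_degree_le_two {R : Type*} [CommRing R] {f : Polynomial R}
    (hf : f.degree ≤ 2) (x : R) :
    f.eval x = f.coeff 2 * x ^ 2 + f.coeff 1 * x + f.coeff 0 := by
  rw [Polynomial.eval_eq_sum_range' (n := 3)
    (Nat.lt_succ_of_le (Polynomial.natDegree_le_of_degree_le hf))]
  simp only [Finset.sum_range_succ, Finset.sum_range_zero]
  ring


/-- **Stability of intersecting families of quadratic polynomials, `q` odd.** If `𝒻` is a
set of polynomials of degree at most 2 over `F`, any two of which agree at some `x ∈ F` or
have the same coefficient of `X²`, and `|𝒻| ≥ q²/√2 + 2√2·q + 8`, then all members of `𝒻`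
take a common value at a common point, or all have the same coefficient of `X²`. -/
theorem stmt_4 (q : ℕ) (hq : Odd q) (hqp : IsPrimePow q)
    (F : Type) [Field F] [Fintype F] (hF : Fintype.card F = q)
    (𝒻 : Set (Polynomial F)) (hdeg : ∀ f ∈ 𝒻, f.degree ≤ 2)
    (hint : ∀ f ∈ 𝒻, ∀ g ∈ 𝒻, (∃ x : F, f.eval x = g.eval x) ∨ f.coeff 2 = g.coeff 2)
    (hsize : (1 / Real.sqrt 2) * (q : ℝ) ^ 2 + 2 * Real.sqrt 2 * (q : ℝ) + 8 ≤ (𝒻.ncard : ℝ)) :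
    (∃ x y : F, ∀ f ∈ 𝒻, f.eval x = y) ∨ (∃ a : F, ∀ f ∈ 𝒻, f.coeff 2 = a) := by
  classical
  subst hF
  have hchar : ringChar F ≠ 2 := by
    intro h2
    have := FiniteField.even_card_of_char_two h2
    rw [Nat.odd_iff] at hq
    omega
  have hfin : 𝒻.Finite := by
    apply Set.finite_of_ncard_pos
    have : (0 : ℝ) < 𝒻.ncard := lt_of_lt_of_le (by positivity) hsize
    exact_mod_cast this
  have hev : ∀ f ∈ 𝒻, ∀ x : F, f.eval x = f.coeff 2 * x ^ 2 + f.coeff 1 * x + f.coeff 0 :=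
    fun f hf x => Polynomial.eval_eq_of_degree_le_two (hdeg f hf) x
  set c : Polynomial F → F × F × F := fun f => (f.coeff 2, f.coeff 1, f.coeff 0) with hc
  have hinj : Set.InjOn c 𝒻 := by
    intro f hf g hg hfg
    simp only [hc, Prod.mk.injEq] at hfg
    ext n
    match n with
    | 0 => exact hfg.2.2
    | 1 => exact hfg.2.1
    | 2 => exact hfg.1
    | n + 3 =>
      rw [(Polynomial.degree_le_iff_coeff_zero f 2).1 (hdeg f hf) (n + 3) (by norm_cast; omega),
        (Polynomial.degree_le_iff_coeff_zero g 2).1 (hdeg g hg) (n + 3) (by norm_cast; omega)]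
  have hcard : #(hfin.toFinset.image c) = 𝒻.ncard := by
    rw [Finset.card_image_of_injOn (by simpa using hinj), Set.ncard_eq_toFinset_card 𝒻 hfin]
  have hmem : ∀ f ∈ 𝒻, c f ∈ hfin.toFinset.image c := fun f hf =>
    Finset.mem_image_of_mem c (hfin.mem_toFinset.2 hf)
  have key := common_value_or_common_leadingCoeff hchar (hfin.toFinset.image c)
    (by
      simp only [mem_image, Set.Finite.mem_toFinset]
      rintro _ ⟨f, hf, rfl⟩ _ ⟨g, hg, rfl⟩
      simp only [hc]
      rcases hint f hf g hg with ⟨x, hx⟩ | h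
      · rw [hev f hf, hev g hg] at hx
        refine ⟨2 * (f.coeff 2 - g.coeff 2) * x + (f.coeff 1 - g.coeff 1), ?_⟩
        linear_combination -4 * (f.coeff 2 - g.coeff 2) * hx
      · refine ⟨f.coeff 1 - g.coeff 1, ?_⟩
        rw [h]; ring)
    (by
      rw [hcard]
      have hs2 : Real.sqrt 2 ^ 2 = 2 := Real.sq_sqrt (by norm_num)
      have hs0 : 0 < Real.sqrt 2 := by positivity
      have h11 : (11 : ℝ) ≤ 8 * Real.sqrt 2 := by nlinarith
      have h1 := mul_le_mul_of_nonneg_left hsize hs0.le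
      have h2 : Real.sqrt 2 * (1 / Real.sqrt 2 * (Fintype.card F : ℝ) ^ 2 +
          2 * Real.sqrt 2 * (Fintype.card F : ℝ) + 8) =
          (Fintype.card F : ℝ) ^ 2 + 4 * Fintype.card F + 8 * Real.sqrt 2 := by
        field_simp
        rw [hs2]
        ring
      have h3 : (Fintype.card F : ℝ) ^ 2 + 4 * Fintype.card F + 11 ≤
          Real.sqrt 2 * 𝒻.ncard := by linarith
      have h4 := pow_le_pow_left₀ (by positivity) h3 2
      rw [mul_pow, hs2] at h4
      exact_mod_cast h4)
  rcases key with ⟨x, y, hxy⟩ | ⟨a, ha⟩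
  · exact Or.inl ⟨x, y, fun f hf => (hev f hf x).trans (hxy _ (hmem f hf))⟩
  · exact Or.inr ⟨a, fun f hf => ha _ (hmem f hf)⟩
end

section
/- Let q be an even prime power and F a finite field with |F| = q. Let 𝒻 be a set of polynomials over F of degree at most 2 such that for all f, g ∈ 𝒻, either there exists x ∈ F with f(x) = g(x), or f and g have the same coefficient of X², or f and g have the same coefficient of X. If |𝒻| ≥ (1/√2)·q² + 2√2·q + 8 (as real numbers), then either there exist x, y ∈ F with f(x) = y for every f ∈ 𝒻, or there exists a ∈ F such that every f ∈ 𝒻 has coefficient of X² equal to a, or there exists b ∈ F such that every f ∈ 𝒻 has coefficient of X equal to b. -/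
open Finset

section Agreement

variable {ι α T : Type*} [Fintype α] [DecidableEq α]

/-- The number of members of `S` that take the value `y` at the index `i`. -/
def countThrough (e : T → ι → α) (S : Finset T) (i : ι) (y : α) : ℕ :=
  #{f ∈ S | e f i = y}

lemma sum_countThrough (e : T → ι → α) (S : Finset T) (i : ι) :
    ∑ y, countThrough e S i y = #S := by
  simpa [countThrough] using
    (card_eq_sum_card_fiberwise (f := fun f => e f i) (s := S) (t := univ) (by simp)).symm

lemma sum_countThrough_mul (e : T → ι → α) (A B : Finset T) (I : Finset ι) :
    ∑ i ∈ I, ∑ y, countThrough e A i y * countThrough e B i y =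
      ∑ f ∈ A, ∑ g ∈ B, #{i ∈ I | e f i = e g i} := by
  simp only [countThrough, card_filter, sum_mul_sum]
  calc _ = ∑ i ∈ I, ∑ f ∈ A, ∑ g ∈ B, if e f i = e g i then 1 else 0 := by
        refine sum_congr rfl fun i _ => ?_
        rw [sum_comm]
        refine sum_congr rfl fun f _ => ?_
        rw [sum_comm]
        refine sum_congr rfl fun g _ => ?_
        simp [eq_comm]
    _ = _ := by
        rw [sum_comm]
        exact sum_congr rfl fun f _ => sum_comm

lemma sum_sum_eq_of_pairwise {T : Type*} [DecidableEq T] (A : Finset T) (c : T → T → ℕ) (d k : ℕ)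
    (hd : ∀ f ∈ A, c f f = d) (hk : ∀ f ∈ A, ∀ g ∈ A, f ≠ g → c f g = k) :
    ∑ f ∈ A, ∑ g ∈ A, c f g = #A * (d + (#A - 1) * k) := by
  rw [sum_const_nat fun f hf => ?_]
  rw [← add_sum_erase A _ hf, hd f hf,
    sum_const_nat fun g hg => hk f hf g (mem_of_mem_erase hg) (ne_of_mem_erase hg).symm,
    card_erase_of_mem hf]

variable [Fintype ι] {e : T → ι → α} {S : Finset T} {q : ℕ}

/-- Some point lies on at least the average number of members, weighted by incidence. -/
lemma exists_countThrough_large (hι : Fintype.card ι = q + 2)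
    (hS : ∀ f ∈ S, ∀ g ∈ S, f ≠ g → #{i | e f i = e g i} = 2) (hne : S.Nonempty) :
    ∃ i y, 2 * #S + q ≤ countThrough e S i y * (q + 2) := by
  classical
  obtain ⟨f₀, hf₀⟩ := hne
  have hι' : Nonempty ι := Fintype.card_pos_iff.mp (by lia)
  obtain ⟨p, -, hp⟩ := exists_max_image (univ : Finset (ι × α))
    (fun p => countThrough e S p.1 p.2) ⟨(hι'.some, e f₀ hι'.some), mem_univ _⟩
  refine ⟨p.1, p.2, ?_⟩
  have h := sum_countThrough_mul e S S univ
  rw [sum_sum_eq_of_pairwise S _ (q + 2) 2 (by simp [hι]) hS] at h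
  have hle : ∑ i, ∑ y, countThrough e S i y * countThrough e S i y ≤
      ∑ _i : ι, countThrough e S p.1 p.2 * #S := by
    refine sum_le_sum fun i _ => ?_
    rw [← sum_countThrough e S i, mul_sum]
    exact sum_le_sum fun y _ => Nat.mul_le_mul_right _ (hp (i, y) (mem_univ _))
  rw [h, sum_const, card_univ, hι, smul_eq_mul] at hle
  have hpos : 0 < #S := card_pos.mpr ⟨f₀, hf₀⟩
  have : #S * (q + 2 + (#S - 1) * 2) ≤ #S * (countThrough e S p.1 p.2 * (q + 2)) := by
    calc _ ≤ _ := hle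
      _ = _ := by ring
  have := Nat.le_of_mul_le_mul_left this hpos
  lia

variable [DecidableEq ι]

/-- Two-point stars are small: members of a family any two of which agree at exactly two indices
are determined by a third value once two are fixed. -/
lemma card_filter_two_values_le
    (hS : ∀ f ∈ S, ∀ g ∈ S, f ≠ g → #{i | e f i = e g i} = 2) (hι : 3 ≤ Fintype.card ι)
    {i j : ι} (hij : i ≠ j) (y z : α) :
    #{f ∈ S | e f i = y ∧ e f j = z} ≤ Fintype.card α := by
  obtain ⟨k, hk⟩ : ∃ k, k ∉ ({i, j} : Finset ι) := by
    by_contra! h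
    have h1 : #(univ : Finset ι) ≤ #({i, j} : Finset ι) := card_le_card fun k _ => h k
    have h2 := card_le_two (a := i) (b := j)
    rw [card_univ] at h1
    lia
  simp only [mem_insert, mem_singleton, not_or] at hk
  refine card_le_card_of_injOn (fun f => e f k) (by simp) ?_
  intro f hf g hg hfg
  simp only [coe_filter, Set.mem_ofPred_eq] at hf hg hfg
  by_contra hne
  have h2 := hS f hf.1 g hg.1 hne
  have h3 : #({i, j, k} : Finset ι) ≤ #{l | e f l = e g l} := by
    apply card_le_card
    intro l hl
    simp only [mem_insert, mem_singleton] at hl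
    simp only [mem_filter, mem_univ, true_and]
    rcases hl with rfl | rfl | rfl
    · rw [hf.2.1, hg.2.1]
    · rw [hf.2.2, hg.2.2]
    · exact hfg
  rw [card_eq_three.mpr ⟨i, j, k, hij, Ne.symm hk.1, Ne.symm hk.2, rfl⟩] at h3
  lia

/-- A point not on all members lies on at most `q (q + 1) / 2` of them. -/
lemma two_mul_countThrough_le (hι : Fintype.card ι = q + 2) (hα : Fintype.card α = q)
    (hq : 1 ≤ q) (hS : ∀ f ∈ S, ∀ g ∈ S, f ≠ g → #{i | e f i = e g i} = 2)
    {i₀ : ι} {y₀ : α} {g : T} (hg : g ∈ S) (hgy : e g i₀ ≠ y₀) :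
    2 * countThrough e S i₀ y₀ ≤ (q + 1) * q := by
  have h := sum_countThrough_mul e {f ∈ S | e f i₀ = y₀} {g} (univ.erase i₀)
  have hR : ∑ f ∈ S with e f i₀ = y₀, ∑ g' ∈ {g}, #{i ∈ univ.erase i₀ | e f i = e g' i} =
      countThrough e S i₀ y₀ * 2 := by
    refine sum_const_nat fun f hf => ?_
    rw [mem_filter] at hf
    have hfg : e f i₀ ≠ e g i₀ := by rw [hf.2]; exact hgy.symm
    rw [sum_singleton, filter_erase, erase_eq_of_notMem (by simpa using hfg)]
    exact hS f hf.1 g hg (by rintro rfl; exact hfg rfl)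
  rw [hR] at h
  have hL : ∑ i ∈ univ.erase i₀, ∑ y, countThrough e {f ∈ S | e f i₀ = y₀} i y *
      countThrough e {g} i y ≤ ∑ _i ∈ univ.erase i₀, q := by
    refine sum_le_sum fun i hi => ?_
    rw [sum_eq_single (e g i) (fun y _ hy => by simp [countThrough, filter_singleton, hy.symm])
      (by simp)]
    have := card_filter_two_values_le hS (by lia) (ne_of_mem_erase hi).symm y₀ (e g i)
    rw [hα] at this
    simpa [countThrough, filter_singleton, filter_filter] using this
  rw [h, sum_const, card_erase_of_mem (mem_univ _), card_univ, hι, smul_eq_mul] at hL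
  simpa [mul_comm] using hL

/-- The Cauchy–Schwarz bound for two cross-agreeing parts of the family: the members through a
point and those not through it. -/
lemma countThrough_cauchy_schwarz (hι : Fintype.card ι = q + 2) (hα : Fintype.card α = q)
    (hS : ∀ f ∈ S, ∀ g ∈ S, f ≠ g → #{i | e f i = e g i} = 2)
    (i₀ : ι) (y₀ : α) {a m : ℕ} (ha : #{f ∈ S | e f i₀ = y₀} = a)
    (hm : #{f ∈ S | e f i₀ ≠ y₀} = m) :
    (q * (q - 1) * a * m : ℝ) ^ 2 ≤
      (q ^ 3 * a - q * a ^ 2) * (q ^ 2 * m ^ 2 - q * m ^ 2 + q ^ 3 * m) := by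
  classical
  set A := {f ∈ S | e f i₀ = y₀} with hA
  set B := {f ∈ S | e f i₀ ≠ y₀} with hB
  set J := (univ : Finset ι).erase i₀ with hJ
  have hJc : #J = q + 1 := by simp [hJ, card_erase_of_mem, hι]
  have hAS : ∀ f ∈ A, f ∈ S := fun f hf => (mem_filter.mp hf).1
  have hBS : ∀ f ∈ B, f ∈ S := fun f hf => (mem_filter.mp hf).1
  have hUU : ∑ i ∈ J, ∑ y, countThrough e A i y * countThrough e A i y = a * (q + a) := by
    rw [sum_countThrough_mul, sum_sum_eq_of_pairwise A _ (q + 1) 1 (by simp [hJc]), ha]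
    · rcases a with _ | a
      · simp
      · simp; ring
    · intro f hf g hg hfg
      rw [hJ, filter_erase, card_erase_of_mem, hS f (hAS f hf) g (hAS g hg) hfg]
      simp [(mem_filter.mp hf).2, (mem_filter.mp hg).2]
  have hUV : ∑ i ∈ J, ∑ y, countThrough e A i y * countThrough e B i y = 2 * a * m := by
    rw [sum_countThrough_mul, sum_const_nat (m := m * 2), ha]
    · ring
    · intro f hf
      rw [sum_const_nat (m := 2), hm]
      intro g hg
      have hfg : e f i₀ ≠ e g i₀ := by
        rw [(mem_filter.mp hf).2]; exact (mem_filter.mp hg).2.symm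
      rw [hJ, filter_erase, erase_eq_of_notMem (by simpa using hfg)]
      exact hS f (hAS f hf) g (hBS g hg) (by rintro rfl; exact hfg rfl)
  have hVV : ∑ i ∈ J, ∑ y, countThrough e B i y * countThrough e B i y ≤ m * (q + 2 * m) := by
    calc _ ≤ ∑ i, ∑ y, countThrough e B i y * countThrough e B i y :=
          sum_le_sum_of_subset (subset_univ J)
      _ = m * (q + 2 + (m - 1) * 2) := by
          rw [sum_countThrough_mul, sum_sum_eq_of_pairwise B _ (q + 2) 2 (by simp [hι]), hm]
          exact fun f hf g hg => hS f (hBS f hf) g (hBS g hg)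
      _ ≤ _ := by
          rcases m with _ | m
          · simp
          · simp; ring_nf; rfl
  have hU : ∑ i ∈ J, ∑ y, countThrough e A i y = (q + 1) * a := by
    rw [sum_const_nat fun i _ => sum_countThrough e A i, hJc, ha]
  have hV : ∑ i ∈ J, ∑ y, countThrough e B i y = (q + 1) * m := by
    rw [sum_const_nat fun i _ => sum_countThrough e B i, hJc, hm]
  rw [← sum_product'] at hUU hUV hVV hU hV
  have hcard : #(J ×ˢ (univ : Finset α)) = (q + 1) * q := by
    rw [card_product, hJc, card_univ, hα]
  have key := sum_mul_sq_le_sq_mul_sq (J ×ˢ (univ : Finset α))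
    (fun p => (q * countThrough e A p.1 p.2 - a : ℝ))
    (fun p => (q * countThrough e B p.1 p.2 - m : ℝ))
  have expand (W X : ι × α → ℝ) (w x : ℝ) :
      ∑ p ∈ J ×ˢ (univ : Finset α), (q * W p - w) * (q * X p - x) =
        q ^ 2 * ∑ p ∈ J ×ˢ univ, W p * X p - q * x * ∑ p ∈ J ×ˢ univ, W p
          - q * w * ∑ p ∈ J ×ˢ univ, X p + (q + 1) * q * (w * x) := by
    have : ((q + 1) * q * (w * x) : ℝ) = ∑ _p ∈ J ×ˢ (univ : Finset α), w * x := by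
      rw [sum_const, hcard]; simp
    rw [this]
    simp only [mul_sum, ← sum_sub_distrib, ← sum_add_distrib]
    exact sum_congr rfl fun p _ => by ring
  simp only [sq (_ - _ : ℝ), expand] at key
  have hUU' : ∑ p ∈ J ×ˢ (univ : Finset α),
      (countThrough e A p.1 p.2 * countThrough e A p.1 p.2 : ℝ) = a * (q + a) := mod_cast hUU
  have hUV' : ∑ p ∈ J ×ˢ (univ : Finset α),
      (countThrough e A p.1 p.2 * countThrough e B p.1 p.2 : ℝ) = 2 * a * m := mod_cast hUV
  have hVV' : ∑ p ∈ J ×ˢ (univ : Finset α),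
      (countThrough e B p.1 p.2 * countThrough e B p.1 p.2 : ℝ) ≤ m * (q + 2 * m) :=
    mod_cast hVV
  have hU' : ∑ p ∈ J ×ˢ (univ : Finset α), (countThrough e A p.1 p.2 : ℝ) = (q + 1) * a :=
    mod_cast hU
  have hV' : ∑ p ∈ J ×ˢ (univ : Finset α), (countThrough e B p.1 p.2 : ℝ) = (q + 1) * m :=
    mod_cast hV
  rw [hUU', hUV', hU', hV'] at key
  have haq : 0 ≤ (q ^ 3 * a - q * a ^ 2 : ℝ) := by
    have h0 : 0 ≤ ∑ p ∈ J ×ˢ (univ : Finset α),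
        (q * countThrough e A p.1 p.2 - a : ℝ) * (q * countThrough e A p.1 p.2 - a) :=
      sum_nonneg fun p _ => mul_self_nonneg _
    rw [expand, hUU', hU'] at h0
    linarith
  calc (q * (q - 1) * a * m : ℝ) ^ 2 = _ := by ring
    _ ≤ _ := key
    _ = (q ^ 3 * a - q * a ^ 2 : ℝ) * _ := by congr 1; ring
    _ ≤ _ := by
      refine mul_le_mul_of_nonneg_left ?_ haq
      have := mul_le_mul_of_nonneg_left hVV' (sq_nonneg (q : ℝ))
      linarith

/-- A large family of functions any two of which agree at exactly two of `q + 2` indices takes a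
constant value at some index. -/
theorem exists_common_value (hι : Fintype.card ι = q + 2) (hα : Fintype.card α = q) (hq : 2 ≤ q)
    (hS : ∀ f ∈ S, ∀ g ∈ S, f ≠ g → #{i | e f i = e g i} = 2)
    (hsize : (7 / 10 : ℝ) * (q ^ 2 + 4 * q) + 8 ≤ #S) :
    ∃ i y, ∀ f ∈ S, e f i = y := by
  have hne : S.Nonempty := by
    rw [← card_pos]
    have : (0 : ℝ) < #S := lt_of_lt_of_le (by positivity) hsize
    exact_mod_cast this
  obtain ⟨i₀, y₀, hlarge⟩ := exists_countThrough_large hι hS hne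
  refine ⟨i₀, y₀, ?_⟩
  by_contra! hcon
  obtain ⟨g, hg, hgy⟩ := hcon
  have hsmall := two_mul_countThrough_le hι hα (by lia) hS hg hgy
  have hcs := countThrough_cauchy_schwarz hι hα hS i₀ y₀ rfl rfl
  have hsum := card_filter_add_card_filter_not (s := S) (fun f => e f i₀ = y₀)
  unfold countThrough at hlarge hsmall
  generalize #{f ∈ S | e f i₀ = y₀} = a at *
  generalize hm : #{f ∈ S | e f i₀ ≠ y₀} = m at *
  have hsum' : (#S : ℝ) = a + m := by exact_mod_cast hsum.symm
  have hlarge' : (2 * #S + q : ℝ) ≤ a * (q + 2) := mod_cast hlarge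
  have hsmall' : (2 * a : ℝ) ≤ (q + 1) * q := mod_cast hsmall
  have hq' : (2 : ℝ) ≤ q := mod_cast hq
  generalize (#S : ℝ) = n at *
  generalize (a : ℝ) = a at *
  generalize (m : ℝ) = m at *
  generalize (q : ℝ) = q at *
  have ha : 7 / 5 * q + 19 / 5 ≤ a := by
    refine le_of_mul_le_mul_right (?_ : _ * (q + 2) ≤ _) (by linarith)
    nlinarith
  have hm : q ^ 2 / 5 + 23 / 10 * q + 8 ≤ m := by nlinarith
  have hapos : 0 < a := by linarith
  have hmpos : 0 < m := by nlinarith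
  have hred : m * ((q - 1) * (a - q)) ≤ q * (q ^ 2 - a) := by
    have hc : 0 < q ^ 3 * a * m := by positivity
    refine le_of_mul_le_mul_left ?_ hc
    linarith
  have h1 : (q - 1) * (2 / 5 * q + 19 / 5) ≤ (q - 1) * (a - q) :=
    mul_le_mul_of_nonneg_left (by linarith) (by linarith)
  have h2 : (q ^ 2 / 5 + 23 / 10 * q + 8) * ((q - 1) * (2 / 5 * q + 19 / 5)) ≤
      m * ((q - 1) * (a - q)) :=
    mul_le_mul hm h1 (mul_nonneg (by linarith) (by linarith)) hmpos.le
  have h3 : q * (q ^ 2 - a) ≤ q * (q ^ 2 - (7 / 5 * q + 19 / 5)) :=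
    mul_le_mul_of_nonneg_left (by linarith) (by linarith)
  have h4 := h2.trans (hred.trans h3)
  have h5 : 0 ≤ (q - 2) ^ 4 := by positivity
  have h6 : 0 ≤ (q - 2) ^ 3 := pow_nonneg (by linarith) 3
  nlinarith [sq_nonneg (q - 2)]

end Agreement

section Quadratic

variable {F : Type*} [Field F]

/-- The value of a polynomial of degree at most two at the points of the extended Laguerre
plane: `none` and `some none` stand for `+∞` and `-∞`. -/
noncomputable def extendedEval (f : Polynomial F) : Option (Option F) → F
  | none => f.coeff 2
  | some none => f.coeff 1
  | some (some x) => f.eval x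

lemma extendedEval_sub (f g : Polynomial F) (i : Option (Option F)) :
    extendedEval (f - g) i = extendedEval f i - extendedEval g i := by
  rcases i with _ | _ | x <;> simp [extendedEval]

lemma eval_eq_of_degree_le_two {h : Polynomial F} (hd : h.degree ≤ 2) (x : F) :
    h.eval x = h.coeff 2 * x ^ 2 + h.coeff 1 * x + h.coeff 0 := by
  rw [Polynomial.eval_eq_sum_range' (n := 3)
    (Nat.lt_succ_of_le (Polynomial.natDegree_le_of_degree_le hd))]
  simp [sum_range_succ]
  ring

/-- In even characteristic a nonzero quadratic vanishing at a point of the extended Laguerre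
plane vanishes at exactly two. -/
lemma card_extendedEval_eq_zero [Fintype F] [DecidableEq F] [CharP F 2] {h : Polynomial F}
    (hd : h.degree ≤ 2) (h0 : h ≠ 0) (hz : ∃ i, extendedEval h i = 0) :
    #{i | extendedEval h i = 0} = 2 := by
  have hev := eval_eq_of_degree_le_two hd
  have hc : h.coeff 2 = 0 → h.coeff 1 = 0 → h.coeff 0 ≠ 0 := by
    intro h2 h1 hc
    apply h0
    ext n
    rcases n with _ | _ | _ | n
    · simpa using hc
    · simpa using h1
    · simpa using h2
    · exact Polynomial.coeff_eq_zero_of_degree_lt (hd.trans_lt (by norm_cast; lia))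
  have hsol : ∃ i j, i ≠ j ∧ ∀ k, extendedEval h k = 0 ↔ k = i ∨ k = j := by
    by_cases ha : h.coeff 2 = 0 <;> by_cases hb : h.coeff 1 = 0
    · refine ⟨none, some none, by simp, ?_⟩
      rintro (_ | _ | x) <;> simp [extendedEval, hev, ha, hb, hc]
    · refine ⟨none, some (some (-h.coeff 0 / h.coeff 1)), by simp, ?_⟩
      rintro (_ | _ | x) <;> simp [extendedEval, hev, ha, hb]
      rw [eq_div_iff hb]
      grind
    · obtain ⟨r, hr⟩ := FiniteField.isSquare_of_char_two (ringChar.eq F 2)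
        (-h.coeff 0 / h.coeff 2)
      rw [div_eq_iff ha] at hr
      refine ⟨some none, some (some r), by simp, ?_⟩
      rintro (_ | _ | x) <;> simp [extendedEval, hev, ha, hb]
      have h2 : h.coeff 2 * x ^ 2 + h.coeff 0 = h.coeff 2 * (x - r) ^ 2 := by
        linear_combination -hr + h.coeff 2 * (x * r - r ^ 2) * CharTwo.two_eq_zero (R := F)
      rw [h2]
      simp [ha, sub_eq_zero]
    · obtain ⟨r, hr⟩ : ∃ r, h.coeff 2 * r ^ 2 + h.coeff 1 * r + h.coeff 0 = 0 := by
        obtain ⟨_ | _ | r, hr⟩ := hz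
        · exact absurd hr ha
        · exact absurd hr hb
        · exact ⟨r, by rw [← hev]; exact hr⟩
      refine ⟨some (some r), some (some (-h.coeff 1 / h.coeff 2 - r)), ?_, ?_⟩
      · simp only [ne_eq, Option.some.injEq]
        intro hrr
        rw [eq_sub_iff_add_eq, CharTwo.add_self_eq_zero, eq_comm, div_eq_zero_iff] at hrr
        simp [ha, hb] at hrr
      · rintro (_ | _ | x) <;> simp [extendedEval, hev, ha, hb]
        rw [← sub_eq_zero (b := r), ← sub_eq_zero (b := _ - r), ← mul_eq_zero,
          ← mul_eq_zero_iff_left ha]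
        field_simp
        grind
  obtain ⟨i, j, hij, hk⟩ := hsol
  rw [← card_pair hij]
  congr 1
  ext k
  simp [hk]

end Quadratic


/-- **Stability of intersecting families of quadratic polynomials, `q` even (extended
Laguerre plane).** If `𝒻` is a set of polynomials of degree at most 2 over `F`, any two of
which agree at some `x ∈ F` or have the same coefficient of `X²` or the same coefficient of
`X`, and `|𝒻| ≥ q²/√2 + 2√2·q + 8`, then all members of `𝒻` take a common value at a common
point, or all have the same coefficient of `X²`, or all have the same coefficient of `X`. -/
theorem stmt_5 (q : ℕ) (hq : Even q) (hqp : IsPrimePow q)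
    (F : Type) [Field F] [Fintype F] (hF : Fintype.card F = q)
    (𝒻 : Set (Polynomial F)) (hdeg : ∀ f ∈ 𝒻, f.degree ≤ 2)
    (hint : ∀ f ∈ 𝒻, ∀ g ∈ 𝒻, (∃ x : F, f.eval x = g.eval x) ∨ f.coeff 2 = g.coeff 2 ∨
      f.coeff 1 = g.coeff 1)
    (hsize : (1 / Real.sqrt 2) * (q : ℝ) ^ 2 + 2 * Real.sqrt 2 * (q : ℝ) + 8 ≤ (𝒻.ncard : ℝ)) :
    (∃ x y : F, ∀ f ∈ 𝒻, f.eval x = y) ∨ (∃ a : F, ∀ f ∈ 𝒻, f.coeff 2 = a) ∨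
      (∃ b : F, ∀ f ∈ 𝒻, f.coeff 1 = b) := by
  classical
  have hq2 : 2 ≤ q := by
    have := hqp.one_lt
    lia
  have : CharP F 2 := by
    have h2 : ringChar F = 2 := by
      rw [FiniteField.even_card_iff_char_two, hF]
      exact Nat.even_iff.mp hq
    exact h2 ▸ ringChar.charP F
  have hsize' : (7 / 10 : ℝ) * (q ^ 2 + 4 * q) + 8 ≤ 𝒻.ncard := by
    refine le_trans ?_ hsize
    have hs := Real.sq_sqrt (show (0 : ℝ) ≤ 2 by norm_num)
    have hs' : 7 / 5 ≤ √(2 : ℝ) := Real.le_sqrt_of_sq_le (by norm_num)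
    have hinv : 1 / √(2 : ℝ) = √2 / 2 := by
      rw [div_eq_div_iff (by positivity) two_ne_zero]
      linarith
    rw [hinv]
    have : 0 ≤ (√(2 : ℝ) / 2 - 7 / 10) * ((q : ℝ) ^ 2 + 4 * q) :=
      mul_nonneg (by linarith) (by positivity)
    linarith
  have hfin : 𝒻.Finite := by
    refine Set.finite_of_ncard_pos ?_
    have : (0 : ℝ) < 𝒻.ncard := lt_of_lt_of_le (by positivity) hsize'
    exact_mod_cast this
  rw [Set.ncard_eq_toFinset_card 𝒻 hfin] at hsize'
  obtain ⟨i, y, hi⟩ := exists_common_value (e := extendedEval) (S := hfin.toFinset) (q := q)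
    (by simp [hF]) hF hq2 (by
      intro f hf g hg hfg
      rw [Set.Finite.mem_toFinset] at hf hg
      have hagree : ∃ i, extendedEval (f - g) i = 0 := by
        simp only [extendedEval_sub, sub_eq_zero]
        rcases hint f hf g hg with ⟨x, hx⟩ | hx | hx
        · exact ⟨some (some x), hx⟩
        · exact ⟨none, hx⟩
        · exact ⟨some none, hx⟩
      have hd : (f - g).degree ≤ 2 :=
        (Polynomial.degree_sub_le f g).trans (max_le (hdeg f hf) (hdeg g hg))
      simpa only [extendedEval_sub, sub_eq_zero] using
        card_extendedEval_eq_zero hd (sub_ne_zero.mpr hfg) hagree) hsize'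
  simp only [Set.Finite.mem_toFinset] at hi
  rcases i with _ | _ | x
  · exact Or.inr (Or.inl ⟨y, hi⟩)
  · exact Or.inr (Or.inr ⟨y, hi⟩)
  · exact Or.inl ⟨x, y, hi⟩
end

section
/- Assume the number of isotropic points of ℙ(F⁴) is q² + 1 (elliptic quadric). Let W be a 2-dimensional subspace of F⁴ containing a vector w with κ(w) ≠ 0 (i.e. the corresponding projective line is not contained in the quadric), and let W^⊥ = { v ∈ F⁴ : b(v,w) = 0 for all w ∈ W }. Then the number of isotropic projective points whose representatives lie in W plus the number of isotropic projective points whose representatives lie in W^⊥ equals 2. -/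
open QuadraticMap

section Counting

variable {F V : Type*} [Field F] [Fintype F] [AddCommGroup V] [Module F V]

open Classical in
/-- A scale-invariant set of vectors containing `0` has `1 + (q - 1) m` elements, where `m` is
the number of projective points represented in it. -/
lemma card_filter_eq_one_add_ncard_projectivization [Fintype V] (p : V → Prop)
    [DecidablePred p] (h0 : p 0)
    (hp : ∀ (a : F) (v : V), p v → p (a • v)) :
    ((Finset.univ.filter p).card : ℤ) =
      1 + ((Fintype.card F : ℤ) - 1) * ({P : Projectivization F V | p P.rep}.ncard : ℤ) := by
  have hbij : Function.Bijective
      (fun z : {P : Projectivization F V | p P.rep} × Fˣ =>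
        (⟨z.2 • z.1.1.rep, hp _ _ z.1.2,
          (smul_ne_zero_iff_ne z.2).2 z.1.1.rep_nonzero⟩ : {v : V // p v ∧ v ≠ 0})) := by
    constructor
    · rintro ⟨⟨P, hP⟩, a⟩ ⟨⟨Q, hQ⟩, b⟩ h
      have h' : a • P.rep = b • Q.rep := congrArg Subtype.val h
      have hPQ : P = Q := by
        rw [← P.mk_rep, ← Q.mk_rep, Projectivization.mk_eq_mk_iff]
        exact ⟨a⁻¹ * b, by rw [mul_smul, ← h', inv_smul_smul]⟩
      subst hPQ
      have hab : (a : F) = b := smul_left_injective F P.rep_nonzero h'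
      rw [Units.ext hab]
    · rintro ⟨v, hv, hv0⟩
      obtain ⟨a, ha⟩ := Projectivization.exists_smul_eq_mk_rep F v hv0
      refine ⟨⟨⟨Projectivization.mk F v hv0, ?_⟩, a⁻¹⟩, ?_⟩
      · change p (Projectivization.mk F v hv0).rep
        rw [← ha]
        exact hp _ _ hv
      · apply Subtype.ext
        change a⁻¹ • (Projectivization.mk F v hv0).rep = v
        rw [← ha, inv_smul_smul]
  have hcard := Nat.card_congr (Equiv.ofBijective _ hbij)
  rw [Nat.card_prod, Nat.card_coe_set_eq, Nat.card_eq_fintype_card (α := Fˣ),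
    Fintype.card_units, Nat.card_eq_fintype_card, Fintype.card_subtype] at hcard
  have hsplit : Finset.univ.filter p = insert 0 (Finset.univ.filter fun v => p v ∧ v ≠ 0) := by
    ext v
    by_cases hv : v = 0 <;> simp [hv, h0]
  rw [hsplit, Finset.card_insert_of_notMem (by simp), ← hcard]
  push_cast [Nat.cast_sub Fintype.card_pos]
  ring

lemma two_ne_zero_of_odd_card (hq : Odd (Fintype.card F)) : (2 : F) ≠ 0 := by
  refine Ring.two_ne_zero fun h => ?_
  have := FiniteField.even_card_of_char_two h
  have := Nat.odd_iff.1 hq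
  omega

lemma exists_sq_add_mul_sq (hq : Odd (Fintype.card F)) {d : F} (hd : d ≠ 0) (c : F) :
    ∃ s t : F, s ^ 2 + d * t ^ 2 = c := by
  open Polynomial in
  obtain ⟨s, t, h⟩ := FiniteField.exists_root_sum_quadratic
    (f := (X ^ 2 - C c : F[X])) (g := C d * X ^ 2) (degree_X_pow_sub_C two_pos _)
    (degree_C_mul_X_pow 2 hd) (Nat.odd_iff.1 hq)
  simp only [Polynomial.eval_sub, Polynomial.eval_pow, Polynomial.eval_X, Polynomial.eval_C,
    Polynomial.eval_mul] at h
  exact ⟨s, t, by linear_combination h⟩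

open Classical in
/-- A nondegenerate binary form over a finite field takes all nonzero values equally often. -/
lemma card_binary_form_eq (hq : Odd (Fintype.card F)) {a b c : F} (ha : a ≠ 0) (hb : b ≠ 0)
    (hc : c ≠ 0) :
    (Finset.univ.filter fun z : F × F => a * z.1 ^ 2 + b * z.2 ^ 2 = c).card =
      (Finset.univ.filter fun z : F × F => a * z.1 ^ 2 + b * z.2 ^ 2 = 1).card := by
  obtain ⟨s, t, hst⟩ := exists_sq_add_mul_sq hq (div_ne_zero hb ha) c
  have hst' : a * s ^ 2 + b * t ^ 2 = a * c := by
    rw [← hst]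
    field_simp
  symm
  refine Finset.card_nbij' (fun z => (s * z.1 - b / a * t * z.2, t * z.1 + s * z.2))
    (fun z => ((s * z.1 + b / a * t * z.2) / c, (s * z.2 - t * z.1) / c)) ?_ ?_ ?_ ?_
  · rintro ⟨x, y⟩ h
    simp only [Finset.coe_filter, Finset.mem_univ, true_and, Set.mem_ofPred_eq] at h ⊢
    rw [← hst]
    field_simp
    linear_combination (a * s ^ 2 + b * t ^ 2) * h
  · rintro ⟨x, y⟩ h
    simp only [Finset.coe_filter, Finset.mem_univ, true_and, Set.mem_ofPred_eq] at h ⊢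
    field_simp
    linear_combination (a * s ^ 2 + b * t ^ 2) * h + c * hst'
  · rintro ⟨x, y⟩ -
    simp only [Prod.mk.injEq]
    constructor <;> rw [← hst] at hc ⊢ <;> rw [div_eq_iff hc] <;> ring
  · rintro ⟨x, y⟩ -
    simp only [Prod.mk.injEq]
    constructor <;> field_simp <;> first
      | linear_combination x * hst'
      | linear_combination y * hst'

open Classical in
lemma card_binary_form_zero_add (hq : Odd (Fintype.card F)) {a b : F} (ha : a ≠ 0) (hb : b ≠ 0) :
    ((Finset.univ.filter fun z : F × F => a * z.1 ^ 2 + b * z.2 ^ 2 = 0).card : ℤ) +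
      ((Fintype.card F : ℤ) - 1) *
        (Finset.univ.filter fun z : F × F => a * z.1 ^ 2 + b * z.2 ^ 2 = 1).card =
      (Fintype.card F : ℤ) ^ 2 := by
  have h := Finset.card_eq_sum_card_fiberwise (s := (Finset.univ : Finset (F × F)))
    (t := (Finset.univ : Finset F)) (f := fun z => a * z.1 ^ 2 + b * z.2 ^ 2)
    (fun _ _ => Finset.mem_coe.2 (Finset.mem_univ _))
  rw [← Finset.add_sum_erase _ _ (Finset.mem_univ 0),
    Finset.sum_congr rfl fun c hc => card_binary_form_eq hq ha hb (Finset.ne_of_mem_erase hc),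
    Finset.sum_const, Finset.card_erase_of_mem (Finset.mem_univ _), Finset.card_univ,
    Finset.card_univ, Fintype.card_prod, smul_eq_mul] at h
  have h' := congrArg (Nat.cast : ℕ → ℤ) h
  push_cast [Nat.cast_sub Fintype.card_pos] at h'
  linear_combination -h'

end Counting

section QuadraticForm

variable {F V : Type*} [Field F] [AddCommGroup V] [Module F V] {κ : QuadraticForm F V}

lemma QuadraticForm.map_smul_add_smul {u t : V} (h : polar κ u t = 0) (x y : F) :
    κ (x • u + y • t) = κ u * x ^ 2 + κ t * y ^ 2 := by
  rw [QuadraticMap.map_add κ, QuadraticMap.map_smul, QuadraticMap.map_smul, polar_smul_left,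
    polar_smul_right, h]
  simp only [smul_eq_mul]
  ring

lemma QuadraticForm.polar_self_ne_zero (h2 : (2 : F) ≠ 0) {u : V} (hu : κ u ≠ 0) :
    polar κ u u ≠ 0 := by
  rw [polar_self, two_nsmul, ← two_mul]
  exact mul_ne_zero h2 hu

lemma QuadraticForm.coeff_eq_zero_of_polar (h2 : (2 : F) ≠ 0) {u t : V} (hu : κ u ≠ 0)
    (ht : t ≠ 0) (h : polar κ u t = 0) {x y : F} (hxy : x • u + y • t = 0) : x = 0 ∧ y = 0 := by
  have hx : x = 0 := by
    have := congrArg (polar κ u) hxy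
    rw [polar_add_right, polar_smul_right, polar_smul_right, h, polar_zero_right, smul_zero,
      add_zero, smul_eq_mul] at this
    exact (mul_eq_zero.1 this).resolve_right (polar_self_ne_zero h2 hu)
  subst hx
  rw [zero_smul, zero_add] at hxy
  exact ⟨rfl, (smul_eq_zero.1 hxy).resolve_right ht⟩

lemma QuadraticForm.exists_eq_smul_add_smul (h2 : (2 : F) ≠ 0) {U : Submodule F V}
    (hU : Module.finrank F U = 2) {u t : V} (huU : u ∈ U) (htU : t ∈ U) (hu : κ u ≠ 0)
    (ht : t ≠ 0) (h : polar κ u t = 0) {v : V} (hv : v ∈ U) : ∃ x y : F, x • u + y • t = v := by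
  have hli : LinearIndependent F ![u, t] :=
    LinearIndependent.pair_iff.2 fun x y hxy => coeff_eq_zero_of_polar h2 hu ht h hxy
  have hle : Submodule.span F {u, t} ≤ U := by
    rw [Submodule.span_le]
    rintro z (rfl | rfl) <;> assumption
  have hfin : Module.finrank F (Submodule.span F {u, t}) = 2 := by
    rw [← Matrix.range_cons_cons_empty, finrank_span_eq_card hli, Fintype.card_fin]
  have : FiniteDimensional F U := Module.finite_of_finrank_pos (by omega)
  rw [← Submodule.eq_of_le_of_finrank_eq hle (hfin.trans hU.symm)] at hv
  exact Submodule.mem_span_pair.1 hv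

lemma QuadraticForm.exists_polar_eq_zero (h2 : (2 : F) ≠ 0) {U : Submodule F V}
    (hU : Module.finrank F U = 2) {u : V} (huU : u ∈ U) (hu : κ u ≠ 0) :
    ∃ t ∈ U, t ≠ 0 ∧ polar κ u t = 0 := by
  have : FiniteDimensional F U := Module.finite_of_finrank_pos (by omega)
  have hnle : ¬ U ≤ Submodule.span F {u} := fun hle => by
    have := (Submodule.finrank_mono hle).trans (finrank_span_le_card ({u} : Set V))
    simp [hU] at this
  obtain ⟨v, hvU, hv⟩ := SetLike.not_le_iff_exists.1 hnle
  refine ⟨v - (polar κ u v / polar κ u u) • u, U.sub_mem hvU (U.smul_mem _ huU), ?_, ?_⟩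
  · intro h
    exact hv (Submodule.mem_span_singleton.2 ⟨_, (sub_eq_zero.1 h).symm⟩)
  · rw [polar_sub_right, polar_smul_right, smul_eq_mul,
      div_mul_cancel₀ _ (polar_self_ne_zero h2 hu), sub_self]

/-- A tangent line meets the quadric in exactly one point. -/
lemma QuadraticForm.ncard_isotropic_eq_one (h2 : (2 : F) ≠ 0) {U : Submodule F V}
    (hU : Module.finrank F U = 2) {u t : V} (huU : u ∈ U) (htU : t ∈ U) (hu : κ u ≠ 0)
    (ht : t ≠ 0) (h : polar κ u t = 0) (hκt : κ t = 0) :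
    {P : Projectivization F V | κ P.rep = 0 ∧ P.rep ∈ U}.ncard = 1 := by
  rw [Set.ncard_eq_one]
  refine ⟨Projectivization.mk F t ht, Set.ext fun P => ?_⟩
  rw [Set.mem_ofPred_eq, Set.mem_singleton_iff]
  constructor
  · rintro ⟨hP, hPU⟩
    obtain ⟨x, y, hxy⟩ := exists_eq_smul_add_smul h2 hU huU htU hu ht h hPU
    rw [← hxy, map_smul_add_smul h, hκt, zero_mul, add_zero] at hP
    have hx : x = 0 := by simpa [hu] using hP
    rw [← P.mk_rep, Projectivization.mk_eq_mk_iff']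
    exact ⟨y, by rw [← hxy, hx, zero_smul, zero_add]⟩
  · rintro rfl
    obtain ⟨a, ha⟩ := Projectivization.exists_smul_eq_mk_rep F t ht
    rw [← ha, Units.smul_def, QuadraticMap.map_smul, hκt, smul_zero]
    exact ⟨rfl, U.smul_mem _ htU⟩

/-- A nondegenerate orthogonal pair `u, t` splits off: `V = F u ⊕ F t ⊕ {u, t}^⊥`. -/
lemma QuadraticForm.bijective_smul_add_smul_add (h2 : (2 : F) ≠ 0) {u t : V} (hu : κ u ≠ 0)
    (ht : κ t ≠ 0) (h : polar κ u t = 0) {U : Submodule F V}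
    (hU : ∀ v, v ∈ U ↔ polar κ u v = 0 ∧ polar κ t v = 0) :
    Function.Bijective (fun z : U × (F × F) => z.2.1 • u + z.2.2 • t + (z.1 : V)) := by
  have huu := polar_self_ne_zero h2 hu
  have htt := polar_self_ne_zero h2 ht
  have h' : polar κ t u = 0 := by rw [polar_comm, h]
  constructor
  · rintro ⟨⟨v, hv⟩, x, y⟩ ⟨⟨v', hv'⟩, x', y'⟩ he
    obtain ⟨hv1, hv2⟩ := (hU v).1 hv
    obtain ⟨hv1', hv2'⟩ := (hU v').1 hv'
    simp only at he
    have e1 := congrArg (polar κ u) he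
    have e2 := congrArg (polar κ t) he
    simp only [polar_add_right, polar_smul_right, smul_eq_mul, h, h', hv1, hv2, hv1', hv2',
      mul_zero, add_zero, zero_add] at e1 e2
    obtain rfl := mul_right_cancel₀ huu e1
    obtain rfl := mul_right_cancel₀ htt e2
    obtain rfl := add_left_cancel he
    rfl
  · intro v
    refine ⟨⟨⟨v - ((polar κ u v / polar κ u u) • u + (polar κ t v / polar κ t t) • t), ?_⟩,
      polar κ u v / polar κ u u, polar κ t v / polar κ t t⟩, by simp⟩
    rw [hU]
    simp only [polar_sub_right, polar_add_right, polar_smul_right, smul_eq_mul, h, h', mul_zero,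
      add_zero, zero_add, div_mul_cancel₀ _ huu, div_mul_cancel₀ _ htt, sub_self, and_self]

open Classical in
/-- Counting isotropic vectors along the splitting `V = F u ⊕ F t ⊕ {u, t}^⊥`. -/
lemma QuadraticForm.card_isotropic_eq [Fintype F] [Fintype V] (hq : Odd (Fintype.card F)) {u t : V}
    (hu : κ u ≠ 0) (ht : κ t ≠ 0) (h : polar κ u t = 0) {U : Submodule F V}
    (hU : ∀ v, v ∈ U ↔ polar κ u v = 0 ∧ polar κ t v = 0) :
    ((Finset.univ.filter fun v => κ v = 0).card : ℤ) =
      (Finset.univ.filter fun v => κ v = 0 ∧ v ∈ U).card *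
        (Finset.univ.filter fun z : F × F => κ u * z.1 ^ 2 + κ t * z.2 ^ 2 = 0).card +
      ((Fintype.card U : ℤ) - (Finset.univ.filter fun v => κ v = 0 ∧ v ∈ U).card) *
        (Finset.univ.filter fun z : F × F => κ u * z.1 ^ 2 + κ t * z.2 ^ 2 = 1).card := by
  have h2 := two_ne_zero_of_odd_card hq
  have hκ (v : U) (z : F × F) : κ (z.1 • u + z.2 • t + (v : V)) =
      κ u * z.1 ^ 2 + κ t * z.2 ^ 2 + κ v := by
    obtain ⟨hv1, hv2⟩ := (hU v).1 v.2
    rw [QuadraticMap.map_add κ, map_smul_add_smul h, polar_add_left, polar_smul_left,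
      polar_smul_left, hv1, hv2]
    simp
  have hfiber (v : U) : (∑ z : F × F, if κ (z.1 • u + z.2 • t + (v : V)) = 0 then (1 : ℤ) else 0) =
      if κ v = 0 then
        ((Finset.univ.filter fun z : F × F => κ u * z.1 ^ 2 + κ t * z.2 ^ 2 = 0).card : ℤ)
      else ((Finset.univ.filter fun z : F × F => κ u * z.1 ^ 2 + κ t * z.2 ^ 2 = 1).card : ℤ) := by
    rw [Finset.sum_boole]
    simp only [hκ]
    split_ifs with hv
    · simp only [hv, add_zero]
    · rw [← card_binary_form_eq hq hu ht (neg_ne_zero.2 hv)]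
      simp only [eq_neg_iff_add_eq_zero]
  have hUcard : (Finset.univ.filter fun v => κ v = 0 ∧ v ∈ U).card =
      (Finset.univ.filter fun v : U => κ v = 0).card := by
    symm
    refine Finset.card_bij (fun v _ => (v : V)) ?_ ?_ ?_
    · simp
    · simp
    · simp
  have hsplit := Finset.card_filter_add_card_filter_not (s := (Finset.univ : Finset U))
    (fun v : U => κ v = 0)
  rw [Finset.card_univ] at hsplit
  rw [hUcard, ← hsplit, Finset.natCast_card_filter (R := ℤ) (fun v => κ v = 0),
    ← (Equiv.ofBijective _ (bijective_smul_add_smul_add h2 hu ht h hU)).sum_comp,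
    Fintype.sum_prod_type]
  simp only [Equiv.ofBijective_apply, hfiber]
  rw [Finset.sum_ite, Finset.sum_const, Finset.sum_const]
  push_cast
  simp only [nsmul_eq_mul]
  ring

open Classical in
lemma QuadraticForm.card_isotropic_mem_eq [Fintype F] [Fintype V] (h2 : (2 : F) ≠ 0)
    {W : Submodule F V} (hW : Module.finrank F W = 2) {u t : V} (huW : u ∈ W) (htW : t ∈ W)
    (hu : κ u ≠ 0) (ht : t ≠ 0) (h : polar κ u t = 0) :
    (Finset.univ.filter fun v => κ v = 0 ∧ v ∈ W).card =
      (Finset.univ.filter fun z : F × F => κ u * z.1 ^ 2 + κ t * z.2 ^ 2 = 0).card := by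
  symm
  refine Finset.card_bij (fun z _ => z.1 • u + z.2 • t) ?_ ?_ ?_
  · intro z hz
    simp only [Finset.mem_filter, Finset.mem_univ, true_and] at hz ⊢
    exact ⟨by rw [map_smul_add_smul h, hz], W.add_mem (W.smul_mem _ huW) (W.smul_mem _ htW)⟩
  · rintro ⟨x, y⟩ - ⟨x', y'⟩ - he
    obtain ⟨hx, hy⟩ := coeff_eq_zero_of_polar (x := x - x') (y := y - y') h2 hu ht h (by
      simp only at he
      rw [sub_smul, sub_smul, ← sub_eq_zero.2 he]
      abel)
    rw [sub_eq_zero.1 hx, sub_eq_zero.1 hy]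
  · intro v hv
    simp only [Finset.mem_filter, Finset.mem_univ, true_and] at hv
    obtain ⟨x, y, rfl⟩ := exists_eq_smul_add_smul h2 hW huW htW hu ht h hv.2
    rw [map_smul_add_smul h] at hv
    exact ⟨(x, y), by simpa using hv.1, rfl⟩

end QuadraticForm

/-- In the elliptic quadric in `ℙ(F⁴)` (`q²+1` isotropic points, `q` odd), for a
2-dimensional subspace `W` not contained in the quadric, the number of isotropic
points on `W` plus the number of isotropic points on `W^⊥` equals `2`. -/
theorem stmt_7 (q : ℕ) (hq : Odd q)
    (F : Type) [Field F] [Fintype F] (hF : Fintype.card F = q)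
    (κ : QuadraticForm F (Fin 4 → F))
    (hnd : ∀ x : Fin 4 → F, (∀ y : Fin 4 → F, QuadraticMap.polar (⇑κ) x y = 0) → x = 0)
    (hell : {P : Projectivization F (Fin 4 → F) | κ P.rep = 0}.ncard = q ^ 2 + 1)
    (W : Submodule F (Fin 4 → F)) (hWdim : Module.finrank F W = 2)
    (hw : ∃ w ∈ W, κ w ≠ 0) :
    {P : Projectivization F (Fin 4 → F) | κ P.rep = 0 ∧ P.rep ∈ W}.ncard +
      {P : Projectivization F (Fin 4 → F) | κ P.rep = 0 ∧
        ∀ w ∈ W, QuadraticMap.polar (⇑κ) P.rep w = 0}.ncard = 2 := by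
  classical
  subst hF
  have h2 := two_ne_zero_of_odd_card hq
  have hB : (polarBilin κ).Nondegenerate := by
    refine ⟨hnd, fun y hy => hnd y fun x => ?_⟩
    rw [polar_comm]
    exact hy x
  have hrefl : LinearMap.BilinForm.IsRefl (polarBilin κ) := fun x y h => by
    rw [polarBilin_apply_apply, polar_comm]
    exact h
  obtain ⟨U, hU⟩ : ∃ U, U = LinearMap.BilinForm.orthogonal (polarBilin κ) W := ⟨_, rfl⟩
  have hUdim : Module.finrank F U = 2 := by
    rw [hU, LinearMap.BilinForm.finrank_orthogonal hB, hWdim, Module.finrank_fin_fun]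
  have hmemU (v : Fin 4 → F) : v ∈ U ↔ ∀ w ∈ W, polar κ v w = 0 := by
    rw [hU, LinearMap.BilinForm.mem_orthogonal_iff]
    refine forall₂_congr fun w _ => ?_
    rw [polar_comm]
    rfl
  simp only [← hmemU]
  obtain ⟨u, huW, hu⟩ := hw
  obtain ⟨t, htW, ht, hut⟩ := QuadraticForm.exists_polar_eq_zero h2 hWdim huW hu
  by_cases hκt : κ t = 0
  · have htU : t ∈ U := by
      rw [hmemU]
      intro w hwW
      obtain ⟨x, y, rfl⟩ :=
        QuadraticForm.exists_eq_smul_add_smul h2 hWdim huW htW hu ht hut hwW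
      rw [polar_add_right, polar_smul_right, polar_smul_right, polar_comm, hut, polar_self, hκt]
      simp
    obtain ⟨v, hvU, hv⟩ : ∃ v ∈ U, κ v ≠ 0 := by
      by_contra! hiso
      have hle : U ≤ W := by
        rw [← LinearMap.BilinForm.orthogonal_orthogonal hB hrefl W, ← hU]
        intro v hv w hw
        change polar κ w v = 0
        rw [polar, hiso _ (U.add_mem hw hv), hiso _ hv, hiso _ hw]
        simp
      have hUW := Submodule.eq_of_le_of_finrank_eq hle (hUdim.trans hWdim.symm)
      exact hu (hiso u (hUW ▸ huW))
    rw [QuadraticForm.ncard_isotropic_eq_one h2 hWdim huW htW hu ht hut hκt,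
      QuadraticForm.ncard_isotropic_eq_one h2 hUdim hvU htU hv ht ((hmemU v).1 hvU t htW) hκt]
  · have hU' (v : Fin 4 → F) : v ∈ U ↔ polar κ u v = 0 ∧ polar κ t v = 0 := by
      rw [hmemU, polar_comm κ u v, polar_comm κ t v]
      refine ⟨fun hv => ⟨hv u huW, hv t htW⟩, fun hv w hwW => ?_⟩
      obtain ⟨x, y, rfl⟩ :=
        QuadraticForm.exists_eq_smul_add_smul h2 hWdim huW htW hu ht hut hwW
      rw [polar_add_right, polar_smul_right, polar_smul_right, hv.1, hv.2]
      simp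
    have hN := QuadraticForm.card_isotropic_eq hq hu hκt hut hU'
    have hk := card_binary_form_zero_add hq hu hκt
    rw [← QuadraticForm.card_isotropic_mem_eq h2 hWdim huW htW hu ht hut] at hN hk
    have hsmul (a : F) (v : Fin 4 → F) (hv : κ v = 0) : κ (a • v) = 0 := by
      rw [QuadraticMap.map_smul, hv, smul_zero]
    have hmem (S : Submodule F (Fin 4 → F)) := card_filter_eq_one_add_ncard_projectivization
      (F := F) (fun v : Fin 4 → F => κ v = 0 ∧ v ∈ S) ⟨QuadraticMap.map_zero κ, S.zero_mem⟩
      fun a v hv => ⟨hsmul a v hv.1, S.smul_mem a hv.2⟩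
    have hUcard : Fintype.card U = Fintype.card F ^ 2 := by
      rw [Module.card_eq_pow_finrank (K := F), hUdim]
    rw [card_filter_eq_one_add_ncard_projectivization (F := F) (fun v => κ v = 0) (QuadraticMap.map_zero κ) hsmul,
      hell, hmem U, hUcard, hmem W] at hN
    rw [hmem W] at hk
    push_cast at hN
    have hq1 : 1 < (Fintype.card F : ℤ) := by exact_mod_cast Fintype.one_lt_card
    generalize {P : Projectivization F (Fin 4 → F) | κ P.rep = 0 ∧ P.rep ∈ W}.ncard = m at *
    generalize {P : Projectivization F (Fin 4 → F) | κ P.rep = 0 ∧ P.rep ∈ U}.ncard = n at *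
    generalize (Finset.univ.filter fun z : F × F => κ u * z.1 ^ 2 + κ t * z.2 ^ 2 = 1).card = k at *
    generalize (Fintype.card F : ℤ) = r at *
    have hk' : (k : ℤ) = r + 1 - m := by
      refine mul_left_cancel₀ (sub_ne_zero.2 hq1.ne') ?_
      linear_combination hk
    rw [hk'] at hN
    have hmn : ((m : ℤ) - 1) * (n - 1) = -1 := by
      refine mul_left_cancel₀ (mul_ne_zero (sub_ne_zero.2 hq1.ne') (by omega : r ≠ 0)) ?_
      linear_combination -hN
    rcases Int.mul_eq_neg_one_iff_eq_one_or_neg_one.1 hmn with h | h <;> omega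
end

section
/- Assume the number of isotropic points of ℙ(F⁴) is (q+1)² (hyperbolic quadric). Let W be a 2-dimensional subspace of F⁴ containing a vector w with κ(w) ≠ 0 (i.e. the corresponding projective line is not contained in the quadric), and let W^⊥ = { v ∈ F⁴ : b(v,w) = 0 for all w ∈ W }. Then the number of isotropic projective points whose representatives lie in W^⊥ equals the number of isotropic projective points whose representatives lie in W. -/
open Finset QuadraticMap
open scoped ComplexConjugate

section CharacterSums

variable {F V : Type*} [Field F] [AddCommGroup V] [Module F V] {ψ : AddChar F ℂ}

open Classical in
lemma AddChar.IsPrimitive.sum_linearMap [Fintype V] (hψ : ψ.IsPrimitive) (f : V →ₗ[F] F) :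
    ∑ v, ψ (f v) = if f = 0 then (Fintype.card V : ℂ) else 0 := by
  have h := AddChar.sum_eq_ite (ψ.compAddMonoidHom f.toAddMonoidHom)
  have hiff : ψ.compAddMonoidHom f.toAddMonoidHom = 0 ↔ f = 0 := by
    constructor
    · intro h0
      ext v
      by_contra hv
      refine hψ hv ?_
      ext c
      have := DFunLike.congr_fun h0 (c • v)
      simpa [AddChar.mulShift_apply, mul_comm] using this
    · rintro rfl
      ext v
      simp
  simpa [hiff] using h

open Classical in
lemma AddChar.IsPrimitive.sum_mem_submodule [Fintype V] (hψ : ψ.IsPrimitive)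
    (W : Submodule F V) (f : V →ₗ[F] F) :
    ∑ w with w ∈ W, ψ (f w) = if ∀ w ∈ W, f w = 0 then (Nat.card W : ℂ) else 0 := by
  have h := hψ.sum_linearMap (f ∘ₗ W.subtype)
  have hiff : f ∘ₗ W.subtype = 0 ↔ ∀ w ∈ W, f w = 0 := by
    simp [LinearMap.ext_iff]
  rw [← Finset.sum_subtype_of_mem (p := (· ∈ W)) (fun w ↦ ψ (f w)) (by simp)]
  simp only [hiff, Nat.card_eq_fintype_card] at h ⊢
  rw [← h]
  exact Finset.sum_congr (by ext; simp) (fun _ _ ↦ rfl)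

open Classical in
lemma AddChar.IsPrimitive.sum_mul_left [Fintype F] (hψ : ψ.IsPrimitive) (c : F) :
    ∑ t, ψ (t * c) = if c = 0 then (Fintype.card F : ℂ) else 0 := by
  have h := hψ.sum_linearMap (LinearMap.mulRight F c)
  have hiff : LinearMap.mulRight F c = 0 ↔ c = 0 :=
    LinearMap.mulRight_eq_zero_iff ..
  simpa [hiff] using h

open Classical in
/-- Counting the zeros of a function by orthogonality of characters. -/
lemma AddChar.IsPrimitive.card_mul_card_filter_eq_zero [Fintype F] {α : Type*}
    (hψ : ψ.IsPrimitive) (S : Finset α) (g : α → F) :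
    (Fintype.card F : ℂ) * #{v ∈ S | g v = 0} = ∑ t, ∑ v ∈ S, ψ (t * g v) := by
  rw [Finset.sum_comm]
  simp_rw [hψ.sum_mul_left]
  rw [← Finset.sum_filter, Finset.sum_const, nsmul_eq_mul, mul_comm]

open Classical in
lemma QuadraticForm.sum_sum_polar [Fintype V] (hψ : ψ.IsPrimitive) (κ : QuadraticForm F V)
    (W : Submodule F V) (f : V → ℂ) :
    ∑ w with w ∈ W, ∑ v, f v * ψ (polar κ v w) =
      Nat.card W * ∑ v with ∀ w ∈ W, polar κ v w = 0, f v := by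
  rw [Finset.sum_comm]
  simp_rw [← Finset.mul_sum]
  have h (v : V) := hψ.sum_mem_submodule W (κ.polarBilin v)
  simp only [polarBilin_apply_apply] at h
  simp_rw [h]
  rw [Finset.sum_filter, Finset.mul_sum]
  refine Finset.sum_congr rfl fun v _ ↦ ?_
  split_ifs <;> ring

lemma QuadraticForm.sum_polar [Fintype V] (hψ : ψ.IsPrimitive) {κ : QuadraticForm F V}
    (hnd : ∀ x, (∀ y, polar κ x y = 0) → x = 0) {t : F} (ht : t ≠ 0) {w : V} (hw : w ≠ 0) :
    ∑ v, ψ (t * polar κ v w) = 0 := by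
  have h := hψ.sum_linearMap (t • κ.polarBilin w)
  rw [if_neg] at h
  · simpa [polar_comm κ w] using h
  · intro h0
    refine hw (hnd w fun y ↦ ?_)
    simpa [ht] using DFunLike.congr_fun h0 y

open Classical in
lemma QuadraticForm.card_eq_card_mul_card_orthogonal [Fintype V] (hψ : ψ.IsPrimitive)
    {κ : QuadraticForm F V} (hnd : ∀ x, (∀ y, polar κ x y = 0) → x = 0) (W : Submodule F V) :
    (Fintype.card V : ℂ) = Nat.card W * #{v | ∀ w ∈ W, polar κ v w = 0} := by
  have h := QuadraticForm.sum_sum_polar hψ κ W 1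
  simp only [Pi.one_apply, one_mul, Finset.sum_const, nsmul_eq_mul, mul_one] at h
  rw [← h, Finset.sum_eq_single 0]
  · simp
  · intro w _ hw
    simpa using QuadraticForm.sum_polar hψ hnd one_ne_zero hw
  · simp

open Classical in
/-- Poisson summation for the Gaussian `v ↦ ψ (t * κ v)`. -/
lemma QuadraticForm.gaussSum_mul_sum_mem [Fintype V] (hψ : ψ.IsPrimitive)
    (κ : QuadraticForm F V) (W : Submodule F V) {t : F} (ht : t ≠ 0) :
    (∑ v, ψ (-t⁻¹ * κ v)) * ∑ w with w ∈ W, ψ (t * κ w) =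
      Nat.card W * ∑ v with ∀ w ∈ W, polar κ v w = 0, ψ (-t⁻¹ * κ v) := by
  rw [← QuadraticForm.sum_sum_polar hψ, Finset.mul_sum]
  refine Finset.sum_congr rfl fun w _ ↦ ?_
  rw [Finset.sum_mul, ← (Equiv.subRight (t • w)).sum_comp]
  refine Finset.sum_congr rfl fun v _ ↦ ?_
  rw [← AddChar.map_add_eq_mul, ← AddChar.map_add_eq_mul]
  congr 1
  have h : κ (v - t • w) = κ v + t * t * κ w - t * polar κ v w := by
    rw [sub_eq_add_neg, QuadraticMap.map_add κ, QuadraticMap.map_neg, QuadraticMap.map_smul,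
      polar_neg_right, polar_smul_right]
    simp [sub_eq_add_neg]
  rw [Equiv.subRight_apply, h]
  field_simp
  ring

lemma QuadraticForm.gaussSum_mul_conj [Finite F] [Fintype V] (hψ : ψ.IsPrimitive)
    {κ : QuadraticForm F V} (hnd : ∀ x, (∀ y, polar κ x y = 0) → x = 0) {t : F} (ht : t ≠ 0) :
    (∑ v, ψ (t * κ v)) * conj (∑ v, ψ (t * κ v)) = Fintype.card V := by
  have key (y : V) : (∑ x, ψ (t * κ x)) * conj (ψ (t * κ y)) =
      ∑ z, ψ (t * κ z) * ψ (t * polar κ y z) := by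
    rw [Finset.sum_mul, ← Equiv.sum_comp (Equiv.addLeft y)]
    refine Finset.sum_congr rfl fun z _ ↦ ?_
    rw [← AddChar.map_neg_eq_conj, ← AddChar.map_add_eq_mul, ← AddChar.map_add_eq_mul,
      Equiv.coe_addLeft, QuadraticMap.map_add κ]
    congr 1
    ring
  rw [_root_.map_sum, Finset.mul_sum]
  simp_rw [key]
  rw [Finset.sum_comm, Finset.sum_eq_single 0]
  · simp
  · intro z _ hz
    rw [← Finset.mul_sum, QuadraticForm.sum_polar hψ hnd ht hz, mul_zero]
  · simp

lemma QuadraticForm.norm_gaussSum [Finite F] [Fintype V] (hψ : ψ.IsPrimitive)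
    {κ : QuadraticForm F V} (hnd : ∀ x, (∀ y, polar κ x y = 0) → x = 0) {t : F} (ht : t ≠ 0) {n : ℕ}
    (hn : Fintype.card V = n ^ 2) : ‖∑ v, ψ (t * κ v)‖ = n := by
  have h := QuadraticForm.gaussSum_mul_conj hψ hnd ht
  rw [Complex.mul_conj, Complex.normSq_eq_norm_sq, hn] at h
  have h' : ‖∑ v, ψ (t * κ v)‖ ^ 2 = (n : ℝ) ^ 2 := by exact_mod_cast h
  exact (pow_left_inj₀ (norm_nonneg _) (Nat.cast_nonneg _) two_ne_zero).1 h'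

open Classical in
/-- If a nondegenerate form on a space with `n ^ 2` elements has the maximal number of zeros, all
its nontrivial Gauss sums are equal to `n`. -/
lemma QuadraticForm.gaussSum_eq [Fintype F] [Fintype V] (hψ : ψ.IsPrimitive)
    {κ : QuadraticForm F V} (hnd : ∀ x, (∀ y, polar κ x y = 0) → x = 0) {n : ℕ}
    (hn : Fintype.card V = n ^ 2)
    (hκ : Fintype.card F * #{v | κ v = 0} = n ^ 2 + (Fintype.card F - 1) * n)
    {t : F} (ht : t ≠ 0) : ∑ v, ψ (t * κ v) = n := by
  have hsum : ∑ s ∈ univ.erase (0 : F), (∑ v, ψ (s * κ v)).re =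
      ∑ s ∈ univ.erase (0 : F), (n : ℝ) := by
    have h := hψ.card_mul_card_filter_eq_zero univ κ
    rw [← Finset.add_sum_erase _ _ (mem_univ (0 : F))] at h
    have h0 : ∑ v, ψ ((0 : F) * κ v) = (n : ℂ) ^ 2 := by
      simp [hn]
    rw [h0] at h
    have hκ' : (Fintype.card F : ℂ) * #{v | κ v = 0} =
        (n : ℂ) ^ 2 + ((Fintype.card F - 1 : ℕ) : ℂ) * n := by exact_mod_cast hκ
    rw [hκ', add_right_inj] at h
    rw [← Complex.re_sum, ← h, Finset.sum_const, Finset.card_erase_of_mem (mem_univ _),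
      Finset.card_univ, nsmul_eq_mul]
    norm_cast
  have hnorm {s : F} (hs : s ∈ univ.erase (0 : F)) : ‖∑ v, ψ (s * κ v)‖ = n :=
    QuadraticForm.norm_gaussSum hψ hnd (Finset.ne_of_mem_erase hs) hn
  have hre := (Finset.sum_eq_sum_iff_of_le
    fun s hs ↦ (Complex.re_le_norm _).trans_eq (hnorm hs)).1 hsum t (by simp [ht])
  have him : (∑ v, ψ (t * κ v)).im = 0 := by
    rw [← Complex.abs_re_eq_norm, hre, hnorm (by simp [ht]), Nat.abs_cast]
  exact Complex.ext (by simpa using hre) (by simpa using him)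

open Classical in
lemma QuadraticForm.card_zeros_orthogonal_eq [Fintype F] [Fintype V] {κ : QuadraticForm F V}
    (hnd : ∀ x, (∀ y, polar κ x y = 0) → x = 0) {W : Submodule F V}
    (hW : Fintype.card V = Nat.card W ^ 2)
    (hκ : Fintype.card F * #{v | κ v = 0} =
      Nat.card W ^ 2 + (Fintype.card F - 1) * Nat.card W) :
    #{v | κ v = 0 ∧ ∀ w ∈ W, polar κ v w = 0} = #{v | κ v = 0 ∧ v ∈ W} := by
  have hψ := AddChar.FiniteField.primitiveChar_to_Complex_isPrimitive F
  set ψ := AddChar.FiniteField.primitiveChar_to_Complex F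
  have hW0 : (Nat.card W : ℂ) ≠ 0 := Nat.cast_ne_zero.2 Nat.card_pos.ne'
  have hF0 : (Fintype.card F : ℂ) ≠ 0 := Nat.cast_ne_zero.2 Fintype.card_ne_zero
  have key (t : F) : ∑ v with ∀ w ∈ W, polar κ v w = 0, ψ (-t⁻¹ * κ v) =
      ∑ w with w ∈ W, ψ (t * κ w) := by
    refine mul_left_cancel₀ hW0 ?_
    rcases eq_or_ne t 0 with rfl | ht
    · have h := QuadraticForm.card_eq_card_mul_card_orthogonal hψ hnd W
      simp only [inv_zero, neg_zero, zero_mul, AddChar.map_zero_eq_one, Finset.sum_const,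
        nsmul_eq_mul, mul_one]
      rw [← h, hW, Nat.card_eq_fintype_card, Fintype.card_subtype]
      push_cast
      ring
    · rw [← QuadraticForm.gaussSum_mul_sum_mem hψ κ W ht,
        QuadraticForm.gaussSum_eq hψ hnd hW hκ (neg_ne_zero.2 (inv_ne_zero ht))]
  have hperm := ((Equiv.inv F).trans (Equiv.neg F)).sum_comp
    fun t ↦ ∑ v with ∀ w ∈ W, polar κ v w = 0, ψ (t * κ v)
  simp only [Equiv.trans_apply, Equiv.inv_apply, Equiv.neg_apply, key] at hperm
  rw [← hψ.card_mul_card_filter_eq_zero, ← hψ.card_mul_card_filter_eq_zero] at hperm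
  have h := mul_left_cancel₀ hF0 hperm
  rw [Finset.filter_filter, Finset.filter_filter] at h
  simp only [and_comm (a := κ _ = 0)]
  exact_mod_cast h.symm

end CharacterSums

/-- A cone in a finite vector space consists of zero and `|F| - 1` vectors for each projective
point. -/
lemma Projectivization.card_filter_eq {F V : Type*} [Field F] [Fintype F] [AddCommGroup V]
    [Module F V] [Fintype V] (p : V → Prop) [DecidablePred p] (h0 : p 0)
    (hp : ∀ (a : F) v, p v → p (a • v)) :
    #{v | p v} = {P : Projectivization F V | p P.rep}.ncard * (Fintype.card F - 1) + 1 := by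
  classical
  have e : {P : Projectivization F V | p P.rep} × Fˣ ≃ {v : V // v ≠ 0 ∧ p v} := by
    refine Equiv.ofBijective
      (fun x ↦ ⟨(x.2 : F) • x.1.1.rep, smul_ne_zero x.2.ne_zero x.1.1.rep_nonzero,
        hp _ _ x.1.2⟩) ⟨?_, ?_⟩
    · rintro ⟨⟨P, hP⟩, a⟩ ⟨⟨Q, hQ⟩, b⟩ h
      have h' : (a : F) • P.rep = (b : F) • Q.rep := congrArg Subtype.val h
      have hPQ : P = Q := by
        rw [← P.mk_rep, ← Q.mk_rep, Projectivization.mk_eq_mk_iff]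
        refine ⟨a⁻¹ * b, ?_⟩
        rw [mul_smul, Units.smul_def b, ← h', ← Units.smul_def, inv_smul_smul]
      subst hPQ
      have hab : a = b := Units.ext (smul_left_injective F P.rep_nonzero h')
      simp [hab]
    · rintro ⟨v, hv, hpv⟩
      obtain ⟨a, ha⟩ := Projectivization.exists_smul_eq_mk_rep F v hv
      refine ⟨⟨⟨Projectivization.mk F v hv, ?_⟩, a⁻¹⟩, ?_⟩
      · change p _
        rw [← ha]
        exact hp _ _ hpv
      · refine Subtype.ext ?_
        change ((a⁻¹ : Fˣ) : F) • _ = v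
        rw [← ha, ← Units.smul_def, inv_smul_smul]
  have hcard := Nat.card_congr e
  rw [Nat.card_prod, Nat.card_coe_set_eq, Nat.card_eq_fintype_card (α := Fˣ),
    Fintype.card_units, Nat.card_eq_fintype_card, Fintype.card_subtype] at hcard
  rw [hcard, ← Finset.card_erase_add_one (a := (0 : V)) (by simpa using h0)]
  congr 2
  ext v
  simp

/-- In the hyperbolic quadric in `ℙ(F⁴)` (`(q+1)²` isotropic points, `q` odd), for a
2-dimensional subspace `W` not contained in the quadric, the number of isotropic
points on `W^⊥` equals the number of isotropic points on `W`. -/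
theorem stmt_8 (q : ℕ) (hq : Odd q)
    (F : Type) [Field F] [Fintype F] (hF : Fintype.card F = q)
    (κ : QuadraticForm F (Fin 4 → F))
    (hnd : ∀ x : Fin 4 → F, (∀ y : Fin 4 → F, QuadraticMap.polar (⇑κ) x y = 0) → x = 0)
    (hhyp : {P : Projectivization F (Fin 4 → F) | κ P.rep = 0}.ncard = (q + 1) ^ 2)
    (W : Submodule F (Fin 4 → F)) (hWdim : Module.finrank F W = 2)
    (hw : ∃ w ∈ W, κ w ≠ 0) :
    {P : Projectivization F (Fin 4 → F) | κ P.rep = 0 ∧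
        ∀ w ∈ W, QuadraticMap.polar (⇑κ) P.rep w = 0}.ncard =
      {P : Projectivization F (Fin 4 → F) | κ P.rep = 0 ∧ P.rep ∈ W}.ncard := by
  classical
  have hq1 : 1 < q := hF ▸ Fintype.one_lt_card
  have hW : Nat.card W = q ^ 2 := by
    rw [Module.natCard_eq_pow_finrank (K := F), hWdim, Nat.card_eq_fintype_card, hF]
  have hV : Fintype.card (Fin 4 → F) = Nat.card W ^ 2 := by
    rw [hW, Fintype.card_fun, Fintype.card_fin, hF]
    ring
  have hκ : Fintype.card F * #{v | κ v = 0} =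
      Nat.card W ^ 2 + (Fintype.card F - 1) * Nat.card W := by
    rw [Projectivization.card_filter_eq (F := F) (fun v ↦ κ v = 0) (by simp)
      (fun a v hv ↦ by simp [QuadraticMap.map_smul, hv]), hhyp, hF, hW]
    obtain ⟨m, rfl⟩ := Nat.exists_eq_add_of_lt hq1
    simp only [Nat.add_sub_cancel]
    ring_nf
  have h := QuadraticForm.card_zeros_orthogonal_eq hnd hV hκ
  rw [Projectivization.card_filter_eq (F := F) (fun v ↦ κ v = 0 ∧ ∀ w ∈ W, polar κ v w = 0)
      (by simp) (fun a v hv ↦ ⟨by simp [QuadraticMap.map_smul, hv.1],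
        fun w hw ↦ by simp [polar_smul_left, hv.2 w hw]⟩),
    Projectivization.card_filter_eq (F := F) (fun v ↦ κ v = 0 ∧ v ∈ W)
      (by simp) (fun a v hv ↦ ⟨by simp [QuadraticMap.map_smul, hv.1], W.smul_mem a hv.2⟩),
    hF] at h
  exact Nat.eq_of_mul_eq_mul_right (Nat.sub_pos_of_lt hq1) (Nat.add_right_cancel h)
end

section
/- Let F be a finite field of odd cardinality, V an F-vector space, and κ a quadratic form on V with polar form b(x,y) = κ(x+y) − κ(x) − κ(y). Let x, y ∈ V satisfy κ(x) ≠ 0, κ(y) ≠ 0 and b(x,y) = 0. Then the span of {x, y} contains a nonzero vector v with κ(v) = 0 if and only if −κ(x)·κ(y) is a square in F. -/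
theorem QuadraticMap.map_smul_add_smul_of_polar_eq_zero {R M : Type*} [CommRing R]
    [AddCommGroup M] [Module R M] (Q : QuadraticForm R M) {x y : M}
    (h : QuadraticMap.polar Q x y = 0) (a b : R) :
    Q (a • x + b • y) = a * a * Q x + b * b * Q y := by
  rw [QuadraticMap.map_add Q, QuadraticMap.polar_smul_left, QuadraticMap.polar_smul_right, h,
    QuadraticMap.map_smul, QuadraticMap.map_smul]
  simp

/-- For a quadratic form `κ` over a finite field of odd cardinality and vectors `x, y`
with `κ x ≠ 0`, `κ y ≠ 0`, `b(x,y) = 0`, the span of `{x, y}` contains a nonzero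
isotropic vector iff `−κ(x)·κ(y)` is a square. -/
theorem stmt_9 (F : Type) [Field F] [Fintype F] (hodd : Odd (Fintype.card F))
    (V : Type) [AddCommGroup V] [Module F V]
    (κ : QuadraticForm F V) (x y : V)
    (hx : κ x ≠ 0) (hy : κ y ≠ 0) (hxy : QuadraticMap.polar (⇑κ) x y = 0) :
    (∃ v ∈ Submodule.span F ({x, y} : Set V), v ≠ 0 ∧ κ v = 0) ↔
      IsSquare (-(κ x * κ y)) := by
  have h2 : (2 : F) ≠ 0 := by
    refine Ring.two_ne_zero fun h => ?_
    have := FiniteField.even_card_iff_char_two.mp h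
    rw [Nat.odd_iff] at hodd
    omega
  have key := QuadraticMap.map_smul_add_smul_of_polar_eq_zero κ hxy
  constructor
  · rintro ⟨v, hv, hv0, hκ⟩
    obtain ⟨a, b, rfl⟩ := Submodule.mem_span_pair.mp hv
    rw [key] at hκ
    have hb : b ≠ 0 := by
      rintro rfl
      have ha : a = 0 := by simpa [hx] using hκ
      simp [ha] at hv0
    refine ⟨a * κ x / b, ?_⟩
    field_simp
    linear_combination -hκ
  · rintro ⟨c, hc⟩
    refine ⟨c • x + κ x • y, Submodule.mem_span_pair.mpr ⟨c, κ x, rfl⟩, fun h => ?_, ?_⟩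
    · have hpolar : QuadraticMap.polar κ (c • x + κ x • y) y = 2 * (κ x * κ y) := by
        rw [QuadraticMap.polar_add_left, QuadraticMap.polar_smul_left,
          QuadraticMap.polar_smul_left, hxy, QuadraticMap.polar_self]
        simp only [smul_eq_mul, nsmul_eq_mul, Nat.cast_ofNat]
        ring
      rw [h, QuadraticMap.polar_zero_left] at hpolar
      exact mul_ne_zero h2 (mul_ne_zero hx hy) hpolar.symm
    · rw [key]
      linear_combination -κ x * hc
end
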